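/- arXiv:1202.6129 — 2 statements merged into one kernel-verified Lean document; each statement's English description precedes it below -/
import Mathlib

section
/- Let G be a finite simple graph with maximum average degree mad(G) < 4. Then the acyclic chromatic index of G satisfies χ'_a(G) ≤ Δ(G) + 2, where Δ(G) is the maximum degree of G. -/
open SimpleGraph

/-- A proper edge coloring of `G`: distinct edges sharing a vertex get distinct colors. -/
def IsProperEdgeColoring {V : Type*} {α : Type*} (G : SimpleGraph V) (c : Sym2 V → α) : Prop :=
  ∀ e₁ ∈ G.edgeSet, ∀ e₂ ∈ G.edgeSet, e₁ ≠ e₂ → (∃ v, v ∈ e₁ ∧ v ∈ e₂) → c e₁ ≠ c e₂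

/-- An acyclic edge coloring: proper, and no cycle of `G` uses at most two colors. -/
def IsAcyclicEdgeColoring {V : Type*} {α : Type*} (G : SimpleGraph V) (c : Sym2 V → α) : Prop :=
  IsProperEdgeColoring G c ∧
    ∀ (v : V) (w : G.Walk v v), w.IsCycle →
      ¬ ∃ a b : α, ∀ e ∈ w.edges, c e = a ∨ c e = b

/-- `G` has an acyclic edge coloring with `k` colors. -/
def AcyclicEdgeColorable {V : Type*} (G : SimpleGraph V) (k : ℕ) : Prop :=
  ∃ c : Sym2 V → Fin k, IsAcyclicEdgeColoring G c

/-- The acyclic chromatic index: least `k` such that `G` is acyclically edge `k`-colorable. -/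
noncomputable def acyclicChromaticIndex {V : Type*} (G : SimpleGraph V) : ℕ :=
  sInf {k | AcyclicEdgeColorable G k}

/-- The maximum average degree of `G`: the supremum of `2|E(H)|/|V(H)|` over all subgraphs `H`
of `G` with nonempty vertex set. -/
noncomputable def maxAverageDegree {V : Type*} [Fintype V] (G : SimpleGraph V) : ℝ :=
  sSup {x : ℝ | ∃ H : G.Subgraph, H.verts.Nonempty ∧
    x = 2 * (H.edgeSet.ncard : ℝ) / (H.verts.ncard : ℝ)}

set_option linter.unusedSectionVars false

namespace AcyclicEdge

section

variable {V K : Type*} [DecidableEq V]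

/-- The graph formed by the edges coloured `α` or `β`. -/
def bi (c : Sym2 V → Option K) (α β : K) : SimpleGraph V :=
  fromEdgeSet {e | c e = some α ∨ c e = some β}

/-- `x` and `y` are joined by edges coloured `α` or `β`. -/
def R (c : Sym2 V → Option K) (α β : K) (x y : V) : Prop := (bi c α β).Reachable x y

/-- The colour `α` appears at `x`. -/
def Has (c : Sym2 V → Option K) (x : V) (α : K) : Prop := ∃ y, c s(x, y) = some α

/-- Partial proper acyclic edge colourings of `H`. -/
structure PEC (H : SimpleGraph V) (c : Sym2 V → Option K) : Prop where
  supp : ∀ {x y α}, c s(x, y) = some α → H.Adj x y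
  proper : ∀ {x y z α}, c s(x, y) = some α → c s(x, z) = some α → y = z
  acyc : ∀ α β, (bi c α β).IsAcyclic

/-- Give the edge `xy` the (partial) colour `o`. -/
def set (c : Sym2 V → Option K) (x y : V) (o : Option K) : Sym2 V → Option K :=
  Function.update c s(x, y) o

variable {H : SimpleGraph V} {c c' : Sym2 V → Option K} {α β γ δ p q r : K} {x y z w u v : V}
  {o o' : Option K}

theorem set_apply (c : Sym2 V → Option K) (x y : V) (o : Option K) (e : Sym2 V) :
    set c x y o e = if e = s(x, y) then o else c e := by
  simp [set, Function.update_apply]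

theorem set_mk (c : Sym2 V → Option K) (x y : V) (o : Option K) (z w : V) :
    set c x y o s(z, w) = if (z = x ∧ w = y) ∨ (z = y ∧ w = x) then o else c s(z, w) := by
  simp [set_apply]

theorem set_swap (c : Sym2 V → Option K) (x y : V) (o : Option K) : set c x y o = set c y x o := by
  simp [set, Sym2.eq_swap]

theorem col_swap (c : Sym2 V → Option K) (x y : V) : c s(x, y) = c s(y, x) := by
  rw [Sym2.eq_swap]

theorem col_symm (h : c s(x, y) = o) : c s(y, x) = o := by
  rwa [Sym2.eq_swap]

theorem bi_adj : (bi c α β).Adj x y ↔ (c s(x, y) = some α ∨ c s(x, y) = some β) ∧ x ≠ y := by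
  simp [bi]

theorem bi_comm (c : Sym2 V → Option K) (α β : K) : bi c α β = bi c β α := by
  ext x y; simp only [bi_adj, or_comm]

theorem R.symm (h : R c α β x y) : R c α β y x := SimpleGraph.Reachable.symm h

theorem R.trans (h : R c α β x y) (h' : R c α β y z) : R c α β x z :=
  SimpleGraph.Reachable.trans h h'

theorem R.comm (h : R c α β x y) : R c β α x y := by rwa [R, bi_comm]

theorem R.edge (P : PEC H c) (h : c s(x, y) = some α) : R c α β x y :=
  (bi_adj.2 ⟨.inl h, (P.supp h).ne⟩ : (bi c α β).Adj x y).reachable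

theorem bi_mono (h : ∀ e, (c e = some α ∨ c e = some β) → (c' e = some α ∨ c' e = some β)) :
    bi c α β ≤ bi c' α β := by
  intro x y
  simp only [bi_adj]
  exact fun ⟨h1, h2⟩ => ⟨h _ h1, h2⟩

theorem R.mono (hR : R c α β x y)
    (h : ∀ e, (c e = some α ∨ c e = some β) → (c' e = some α ∨ c' e = some β)) :
    R c' α β x y :=
  SimpleGraph.Reachable.mono (bi_mono h) hR

theorem R.of_set (h1 : o ≠ some α) (h2 : o ≠ some β) (hR : R (set c u v o) α β x y) :
    R c α β x y := by
  refine hR.mono fun e he => ?_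
  rw [set_apply] at he
  split_ifs at he with h
  · simp [h1, h2] at he
  · exact he

theorem not_R_of_miss (h1 : ¬Has c x α) (h2 : ¬Has c x β) (hxy : x ≠ y) : ¬R c α β x y := by
  rintro ⟨p⟩
  cases p with
  | nil => exact hxy rfl
  | cons h _ =>
    rcases (bi_adj.1 h).1 with h | h
    · exact h1 ⟨_, h⟩
    · exact h2 ⟨_, h⟩

theorem not_R_of_miss' (h1 : ¬Has c y α) (h2 : ¬Has c y β) (hxy : x ≠ y) : ¬R c α β x y :=
  fun h => not_R_of_miss h1 h2 hxy.symm h.symm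

/-- First step along a bichromatic path, together with its tail. -/
theorem chase_tail (hR : R c α β x y) (hxy : x ≠ y) (hx : ¬Has c x β) :
    ∃ z, c s(x, z) = some α ∧ R (set c x z none) α β z y := by
  obtain ⟨p, hp⟩ := SimpleGraph.Reachable.exists_isPath hR
  cases p with
  | nil => exact absurd rfl hxy
  | @cons _ z _ h q =>
    have hα : c s(x, z) = some α := by
      rcases (bi_adj.1 h).1 with h | h
      · exact h
      · exact absurd ⟨_, h⟩ hx
    refine ⟨z, hα, ?_⟩
    rw [Walk.cons_isPath_iff] at hp
    refine ⟨q.transfer _ ?_⟩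
    intro e he
    have h2 := q.edges_subset_edgeSet he
    have h3 : e ≠ s(x, z) := fun h => hp.2 (q.fst_mem_support_of_mem_edges (h ▸ he))
    induction e with
    | _ a b =>
    rw [mem_edgeSet, bi_adj] at h2 ⊢
    rw [set_apply, if_neg h3]
    exact h2

theorem has_set_none (h : Has (set c u v none) x α) : Has c x α := by
  obtain ⟨y, h⟩ := h
  rw [set_apply] at h
  split_ifs at h
  exact ⟨y, h⟩

theorem chase (P : PEC H c) (hR : R c α β x y) (hxy : x ≠ y) (hx : ¬Has c x β) :
    ∃ z, c s(x, z) = some α ∧ (z = y ∨ Has c z β) := by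
  obtain ⟨z, h1, h2⟩ := chase_tail hR hxy hx
  refine ⟨z, h1, or_iff_not_imp_left.2 fun hzy => ?_⟩
  by_contra hb
  refine not_R_of_miss ?_ (fun h => hb (has_set_none h)) hzy h2
  rintro ⟨t, ht⟩
  rw [set_apply] at ht
  split_ifs at ht with h
  have := P.proper ht (col_symm h1)
  subst this
  exact h Sym2.eq_swap

theorem closed_support {B : SimpleGraph V} {x y : V} (p : B.Walk x y) (hp : p.IsPath) (hxy : x ≠ y)
    (h2 : ∀ w t₁ t₂ t₃, B.Adj w t₁ → B.Adj w t₂ → B.Adj w t₃ → t₁ ≠ t₂ → t₃ = t₁ ∨ t₃ = t₂)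
    (hx : ∀ t t', B.Adj x t → B.Adj x t' → t = t') (hy : ∀ t t', B.Adj y t → B.Adj y t' → t = t') :
    ∀ w ∈ p.support, ∀ t, B.Adj w t → t ∈ p.support := by
  intro w hw t ht
  obtain ⟨i, rfl, hi⟩ := Walk.mem_support_iff_exists_getVert.1 hw
  have hlen : 0 < p.length := by
    rcases Nat.eq_zero_or_pos p.length with h | h
    · exact absurd (Walk.eq_of_length_eq_zero h) hxy
    · exact h
  rcases Nat.eq_zero_or_pos i with rfl | hpos
  · have h1 := p.adj_getVert_succ hlen
    rw [Walk.getVert_zero] at ht h1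
    rw [hx _ _ ht h1]
    exact Walk.getVert_mem_support _ _
  · have h1 := p.adj_getVert_succ (i := i - 1) (by omega)
    rw [Nat.sub_add_cancel hpos] at h1
    rcases hi.lt_or_eq with h | rfl
    · have h3 := p.adj_getVert_succ h
      have hne : p.getVert (i - 1) ≠ p.getVert (i + 1) := by
        intro h
        have := hp.getVert_injOn (by simp; omega) (by simp; omega) h
        omega
      rcases h2 _ _ _ _ h1.symm h3 ht hne with h | h <;> rw [h] <;>
        exact Walk.getVert_mem_support _ _
    · rw [Walk.getVert_length] at ht h1
      rw [hy _ _ ht h1.symm]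
      exact Walk.getVert_mem_support _ _

/-- A component of a graph of maximum degree `2` contains at most two
vertices of degree at most `1`. -/
theorem three_ends {B : SimpleGraph V} {x y z : V} (hxy : x ≠ y) (hxz : x ≠ z) (hyz : y ≠ z)
    (h2 : ∀ w t₁ t₂ t₃, B.Adj w t₁ → B.Adj w t₂ → B.Adj w t₃ → t₁ ≠ t₂ → t₃ = t₁ ∨ t₃ = t₂)
    (hx : ∀ t t', B.Adj x t → B.Adj x t' → t = t') (hy : ∀ t t', B.Adj y t → B.Adj y t' → t = t')
    (hz : ∀ t t', B.Adj z t → B.Adj z t' → t = t') (h : B.Reachable x y) : ¬B.Reachable x z := by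
  rintro ⟨q⟩
  obtain ⟨p, hp⟩ := h.exists_isPath
  have hcl := closed_support p hp hxy h2 hx hy
  have hmem : ∀ {a b} (q : B.Walk a b), a ∈ p.support → b ∈ p.support := by
    intro a b q
    induction q with
    | nil => exact id
    | cons h _ ih => exact fun ha => ih (hcl _ ha _ h)
  have hzs := hmem q p.start_mem_support
  obtain ⟨i, hi, hil⟩ := Walk.mem_support_iff_exists_getVert.1 hzs
  have hi0 : i ≠ 0 := by rintro rfl; simp at hi; exact hxz hi
  have hil' : i ≠ p.length := by rintro rfl; simp at hi; exact hyz hi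
  have h1 := p.adj_getVert_succ (i := i - 1) (by omega)
  rw [Nat.sub_add_cancel (by omega), hi] at h1
  have h3 := p.adj_getVert_succ (i := i) (by omega)
  rw [hi] at h3
  have := hp.getVert_injOn (by simp; omega) (by simp; omega) (hz _ _ h1.symm h3)
  omega

theorem uniq (P : PEC H c) (hxy : x ≠ y) (hxz : x ≠ z) (hyz : y ≠ z)
    (mx : ¬Has c x α ∨ ¬Has c x β) (my : ¬Has c y α ∨ ¬Has c y β) (mz : ¬Has c z α ∨ ¬Has c z β)
    (h : R c α β x y) : ¬R c α β x z := by
  have key : ∀ w, (¬Has c w α ∨ ¬Has c w β) →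
      ∀ t t', (bi c α β).Adj w t → (bi c α β).Adj w t' → t = t' := by
    intro w hw t t' h1 h2
    rw [bi_adj] at h1 h2
    rcases h1.1 with h1 | h1 <;> rcases h2.1 with h2 | h2
    · exact P.proper h1 h2
    · exact hw.elim (fun h => absurd ⟨_, h1⟩ h) (fun h => absurd ⟨_, h2⟩ h)
    · exact hw.elim (fun h => absurd ⟨_, h2⟩ h) (fun h => absurd ⟨_, h1⟩ h)
    · exact P.proper h1 h2
  refine three_ends hxy hxz hyz ?_ (key x mx) (key y my) (key z mz) h
  intro w t₁ t₂ t₃ h1 h2 h3 hne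
  rw [bi_adj] at h1 h2 h3
  rcases h1.1 with h1 | h1 <;> rcases h2.1 with h2 | h2 <;> rcases h3.1 with h3 | h3
  all_goals first
    | exact absurd (P.proper h1 h2) hne
    | exact .inl (P.proper h3 h1)
    | exact .inr (P.proper h3 h2)

theorem PEC.erase (P : PEC H c) (x y : V) : PEC H (set c x y none) where
  supp h := by
    rw [set_apply] at h; split_ifs at h; exact P.supp h
  proper h h' := by
    rw [set_apply] at h h'; split_ifs at h h'; exact P.proper h h'
  acyc α β := by
    refine (P.acyc α β).anti (bi_mono fun e he => ?_)
    rw [set_apply] at he; split_ifs at he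
    · simp at he
    · exact he

theorem PEC.color (P : PEC H c) (hxy : H.Adj x y) (hn : c s(x, y) = none) (hx : ¬Has c x α)
    (hy : ¬Has c y α) (h : ∀ β, β ≠ α → Has c x β → Has c y β → ¬R c α β x y) :
    PEC H (set c x y (some α)) := by
  have hne := hxy.ne
  have hR : ∀ β, ¬R c α β x y := by
    intro β
    by_cases hβ : β = α
    · subst hβ; exact not_R_of_miss hx hx hne
    by_cases h1 : Has c x β
    · by_cases h2 : Has c y β
      · exact h β hβ h1 h2
      · exact not_R_of_miss' hy h2 hne
    · exact not_R_of_miss hx h1 hne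
  have hac : ∀ β, (bi (set c x y (some α)) α β).IsAcyclic := by
    intro β
    refine ((P.acyc α β).sup_edge_of_not_reachable (hR β)).anti ?_
    intro a b hab
    rw [bi_adj, set_apply] at hab
    rw [sup_adj, bi_adj, edge_adj]
    split_ifs at hab with h
    · right; simp at h; tauto
    · left; exact hab
  refine ⟨?_, ?_, ?_⟩
  · intro a b γ hab
    rw [set_mk] at hab; split_ifs at hab with h
    · rcases h with ⟨rfl, rfl⟩ | ⟨rfl, rfl⟩
      exacts [hxy, hxy.symm]
    · exact P.supp hab
  · intro a b d γ h1 h2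
    rw [set_mk] at h1 h2
    split_ifs at h1 h2 with h3 h4 h4
    · grind
    · simp only [Option.some.injEq] at h1; subst h1
      rcases h3 with ⟨rfl, rfl⟩ | ⟨rfl, rfl⟩
      · exact absurd ⟨_, h2⟩ hx
      · exact absurd ⟨_, h2⟩ hy
    · simp only [Option.some.injEq] at h2; subst h2
      rcases h4 with ⟨rfl, rfl⟩ | ⟨rfl, rfl⟩
      · exact absurd ⟨_, h1⟩ hx
      · exact absurd ⟨_, h1⟩ hy
    · exact P.proper h1 h2
  · intro γ δ
    by_cases h1 : γ = α
    · subst h1; exact hac δ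
    by_cases h2 : δ = α
    · subst h2; rw [bi_comm]; exact hac γ
    · refine (P.acyc γ δ).anti (bi_mono fun e he => ?_)
      rw [set_apply] at he; split_ifs at he
      · simp [Ne.symm h1, Ne.symm h2] at he
      · exact he

end

section

variable {V K : Type*} [DecidableEq V] {H : SimpleGraph V} {c c' : Sym2 V → Option K}
  {α β γ δ p q r s : K} {x y z w u v a b : V} {o o' : Option K}

theorem has_set_of (hx : z ≠ x) (hy : z ≠ y) : Has (set c x y o) z γ ↔ Has c z γ := by
  simp [Has, set_mk, hx, hy]

theorem has_set (P : PEC H c) : Has (set c x y o) x γ ↔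
    o = some γ ∨ (Has c x γ ∧ c s(x, y) ≠ some γ) := by
  constructor
  · rintro ⟨t, ht⟩
    rw [set_mk] at ht
    split_ifs at ht with h
    · exact .inl ht
    · refine .inr ⟨⟨t, ht⟩, fun h' => ?_⟩
      have := P.proper ht h'
      subst this
      simp at h
  · rintro (h | ⟨⟨t, ht⟩, h⟩)
    · exact ⟨y, by simp [set_mk, h]⟩
    · refine ⟨t, ?_⟩
      rw [set_mk, if_neg, ht]
      rintro (⟨-, rfl⟩ | ⟨rfl, rfl⟩)
      · exact h ht
      · exact h ht

theorem has_set' (P : PEC H c) : Has (set c x y o) y γ ↔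
    o = some γ ∨ (Has c y γ ∧ c s(x, y) ≠ some γ) := by
  rw [set_swap, has_set P, col_swap c x y]

theorem set_none_set (c : Sym2 V → Option K) (x y : V) (o o' : Option K) :
    set (set c x y o) x y o' = set c x y o' := by
  simp [set]

theorem set_comm (c : Sym2 V → Option K) (o o' : Option K) (h : s(x, y) ≠ s(z, w)) :
    set (set c x y o) z w o' = set (set c z w o') x y o := by
  simp only [set]
  rw [Function.update_comm h]

theorem col_inj (h1 : c s(x, y) = some α) (h2 : c s(x, y) = some β) : α = β := by
  rw [h1] at h2; exact Option.some.inj h2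

theorem recolor_or (P : PEC H c) (hc : c s(v, x) = some δ) (hv : ¬Has c v r) (hx : ¬Has c x r) :
    PEC H (set c v x (some r)) ∨ ∃ s, s ≠ δ ∧ s ≠ r ∧ Has c x s ∧ Has c v s ∧ R c r s v x := by
  by_contra! hcon
  obtain ⟨h1, h2⟩ := hcon
  apply h1
  rw [← set_none_set c v x none]
  refine (P.erase v x).color (P.supp hc) (by simp [set_mk]) (fun h => hv (has_set_none h))
    (fun h => hx (has_set_none h)) ?_
  intro β hβ hvβ hxβ hR
  rw [has_set P] at hvβ
  rw [has_set' P] at hxβ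
  simp at hvβ hxβ
  exact h2 β (fun h => hvβ.2 (h ▸ hc)) hβ hxβ.1 hvβ.1 (hR.of_set (by simp) (by simp))

/-- Exchange the colours `p` of `vx` and `q` of `vy`. -/
def swap (c : Sym2 V → Option K) (v x y : V) (p q : K) : Sym2 V → Option K :=
  set (set c v x (some q)) v y (some p)

/-- Uncolour `vx` and `vy`. -/
def erase₂ (c : Sym2 V → Option K) (v x y : V) : Sym2 V → Option K :=
  set (set c v x none) v y none

theorem edge_ne (hxy : x ≠ y) : s(v, x) ≠ s(v, y) := by
  simp only [ne_eq, Sym2.eq_iff, not_or]; grind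

theorem swap_eq (hxy : x ≠ y) :
    swap c v x y p q = set (set (erase₂ c v x y) v x (some q)) v y (some p) := by
  rw [erase₂, set_comm _ _ _ (edge_ne hxy), set_none_set, set_comm _ _ _ (edge_ne hxy.symm),
    set_none_set, swap]

theorem swap_pec (P : PEC H c) (hx : c s(v, x) = some p) (hy : c s(v, y) = some q) (hpq : p ≠ q)
    (hqx : ¬Has c x q) (hpy : ¬Has c y p)
    (h1 : ∀ s, s ≠ p → s ≠ q → Has c v s → Has c x s → ¬R (erase₂ c v x y) q s v x)
    (h2 : ∀ s, s ≠ p → s ≠ q → Has c v s → Has c y s → ¬R (erase₂ c v x y) p s v y) :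
    PEC H (swap c v x y p q) := by
  have hxy : x ≠ y := by rintro rfl; exact hpq (col_inj hx hy)
  rw [swap_eq hxy]
  have hvx := (P.supp hx).ne
  have hvy := (P.supp hy).ne
  have P1 : PEC H (erase₂ c v x y) := (P.erase v x).erase v y
  have hm : ∀ {z γ}, Has (erase₂ c v x y) z γ → Has c z γ := fun h => has_set_none (has_set_none h)
  have hvq : ¬Has (erase₂ c v x y) v q := by
    rw [erase₂, has_set (P.erase v x), set_mk]; simp [hxy.symm, hvx, hy]
  have hvp : ¬Has (erase₂ c v x y) v p := by
    intro h
    have := has_set_none h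
    rw [has_set P] at this
    simp [hx] at this
  have hxp : ¬Has (erase₂ c v x y) x p := by
    intro h
    have := has_set_none h
    rw [has_set' P] at this
    simp [hx] at this
  have P2 : PEC H (set (erase₂ c v x y) v x (some q)) := by
    refine P1.color (P.supp hx) (by simp [erase₂, set_mk]) hvq (fun h => hqx (hm h)) ?_
    intro β hβ hvβ hxβ
    have hβp : β ≠ p := by rintro rfl; exact hvp hvβ
    exact h1 β hβp hβ (hm hvβ) (hm hxβ)
  have hvp2 : ¬Has (set (erase₂ c v x y) v x (some q)) v p := by
    rw [has_set P1]; simp [hvp, hpq.symm]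
  have hxp2 : ¬Has (set (erase₂ c v x y) v x (some q)) x p := by
    rw [has_set' P1]; simp [hxp, hpq.symm]
  refine P2.color (P.supp hy) (by simp [erase₂, set_mk, hxy.symm, hvx]) hvp2 ?_ ?_
  · rw [has_set_of hvy.symm hxy.symm]; exact fun h => hpy (hm h)
  · intro β hβ hvβ hyβ hR
    by_cases hβq : β = q
    · subst hβq
      obtain ⟨z, hz, hzy⟩ := chase P2 hR.comm hvy hvp2
      have : z = x := P2.proper hz (by simp [set_mk])
      subst this
      exact hzy.elim hxy hxp2
    · rw [has_set P1] at hvβ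
      rw [has_set_of hvy.symm hxy.symm] at hyβ
      simp [Ne.symm hβq] at hvβ
      exact h2 β hβ hβq (hm hvβ.1) (hm hyβ)
        (hR.of_set (by simp [hpq.symm]) (by simp [Ne.symm hβq]))

theorem swap_pec' (P : PEC H c) (hx : c s(v, x) = some p) (hy : c s(v, y) = some q) (hpq : p ≠ q)
    (hqx : ¬Has c x q) (hpy : ¬Has c y p)
    (h : ∀ s z, s ≠ p → s ≠ q → c s(v, z) = some s → (¬Has c x s ∧ ¬Has c y s) ∨
      (¬Has c z p ∧ ¬Has c z q)) :
    PEC H (swap c v x y p q) := by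
  have hxy : x ≠ y := by rintro rfl; exact hpq (col_inj hx hy)
  have hvx := (P.supp hx).ne
  have hvy := (P.supp hy).ne
  have P1 : PEC H (erase₂ c v x y) := (P.erase v x).erase v y
  have hm : ∀ {z γ}, Has (erase₂ c v x y) z γ → Has c z γ := fun h => has_set_none (has_set_none h)
  have hvq : ¬Has (erase₂ c v x y) v q := by
    rw [erase₂, has_set (P.erase v x), set_mk]; simp [hxy.symm, hvx, hy]
  have hvp : ¬Has (erase₂ c v x y) v p := by
    intro h
    have := has_set_none h
    rw [has_set P] at this
    simp [hx] at this
  have hcol : ∀ {z s}, (erase₂ c v x y) s(v, z) = some s → c s(v, z) = some s := by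
    intro z s h
    rw [erase₂, set_apply] at h
    split_ifs at h
    rw [set_apply] at h
    split_ifs at h
    exact h
  refine swap_pec P hx hy hpq hqx hpy ?_ ?_
  · intro s hsp hsq hv hxs hR
    obtain ⟨z, hz, hz2⟩ := chase P1 hR.comm hvx hvq
    rcases hz2 with rfl | hz2
    · exact hsp (col_inj (hcol hz) hx)
    · rcases h s z hsp hsq (hcol hz) with h | h
      · exact h.1 hxs
      · exact h.2 (hm hz2)
  · intro s hsp hsq hv hxs hR
    obtain ⟨z, hz, hz2⟩ := chase P1 hR.comm hvy hvp
    rcases hz2 with rfl | hz2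
    · exact hsq (col_inj (hcol hz) hy)
    · rcases h s z hsp hsq (hcol hz) with h | h
      · exact h.2 hxs
      · exact h.1 (hm hz2)

theorem has_swap_of (hx : c s(v, x) = some p) (hy : c s(v, y) = some q) (hpq : p ≠ q)
    (hzx : z ≠ x) (hzy : z ≠ y) : Has (swap c v x y p q) z γ ↔ Has c z γ := by
  have hxy : x ≠ y := by rintro rfl; exact hpq (col_inj hx hy)
  by_cases hzv : z = v
  · subst hzv
    have key : ∀ t, swap c z x y p q s(z, t) =
        if t = y then some p else if t = x then some q else c s(z, t) := by
      intro t; simp only [swap, set_mk]; grind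
    constructor
    · rintro ⟨t, ht⟩
      rw [key] at ht
      split_ifs at ht with h1 h2
      · exact ⟨x, hx.trans ht⟩
      · exact ⟨y, hy.trans ht⟩
      · exact ⟨t, ht⟩
    · rintro ⟨t, ht⟩
      by_cases h1 : t = y
      · subst h1; exact ⟨x, by rw [key, if_neg hxy, if_pos rfl, ← hy, ht]⟩
      by_cases h2 : t = x
      · subst h2; exact ⟨y, by rw [key, if_pos rfl, ← hx, ht]⟩
      · exact ⟨t, by rw [key, if_neg h1, if_neg h2, ht]⟩
  · rw [swap, has_set_of hzv hzy, has_set_of hzv hzx]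

theorem has_swap_left (P : PEC H c) (hx : c s(v, x) = some p) (hy : c s(v, y) = some q)
    (hpq : p ≠ q) : Has (swap c v x y p q) x γ ↔ γ = q ∨ (Has c x γ ∧ γ ≠ p) := by
  have hxy : x ≠ y := by rintro rfl; exact hpq (col_inj hx hy)
  rw [swap, has_set_of (P.supp hx).ne.symm hxy, has_set' P, hx]
  simp [eq_comm]

theorem swap_R (P : PEC H c) (hx : c s(v, x) = some p) (hy : c s(v, y) = some q) (hpq : p ≠ q)
    (hrq : r ≠ q) (hva : v ≠ a) (hv : ¬Has c v r) (hR : R c p r a v) :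
    R (swap c v x y p q) p r a x := by
  obtain ⟨z, hz, hR2⟩ := chase_tail hR.symm hva hv
  obtain rfl := P.proper hz hx
  refine (hR2.mono fun e he => ?_).symm
  rw [set_apply] at he
  split_ifs at he with h1
  · simp at he
  · rw [swap, set_apply, set_apply, if_neg h1]
    split_ifs with h2
    · subst h2; rw [hy] at he; simp [hpq.symm, hrq.symm] at he
    · exact he

/-- After exchanging the colours, the bichromatic path from `a` ends at `x` instead of `v`. -/
theorem swap_not_R (P : PEC H c) (P' : PEC H (swap c v x y p q)) (hx : c s(v, x) = some p)
    (hy : c s(v, y) = some q) (hpq : p ≠ q)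
    (hrq : r ≠ q) (hva : v ≠ a) (hax : a ≠ x) (hay : a ≠ y) (hv : ¬Has c v r) (ha : ¬Has c a p)
    (hR : R c p r a v) (hza : z ≠ a) (hzx : z ≠ x)
    (hz : ¬Has (swap c v x y p q) z p ∨ ¬Has (swap c v x y p q) z r) :
    ¬R (swap c v x y p q) p r a z := by
  refine uniq P' hax hza.symm hzx.symm (.inl ?_) (.inl ?_) hz (swap_R P hx hy hpq hrq hva hv hR)
  · rwa [has_swap_of hx hy hpq hax hay]
  · rw [has_swap_left P hx hy hpq]; simp [hpq]

section Card

variable [Fintype K]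

open Classical in
/-- Colours appearing at `x`. -/
noncomputable def C (c : Sym2 V → Option K) (x : V) : Finset K := {α | Has c x α}

open Classical in
/-- Colours missing at `x`. -/
noncomputable def F (c : Sym2 V → Option K) (x : V) : Finset K := {α | ¬Has c x α}

@[simp] theorem mem_C : α ∈ C c x ↔ Has c x α := by simp [C]

@[simp] theorem mem_F : α ∈ F c x ↔ ¬Has c x α := by simp [F]

theorem card_C_add_card_F (c : Sym2 V → Option K) (x : V) :
    (C c x).card + (F c x).card = Fintype.card K := by
  classical
  rw [C, F, Finset.card_filter_add_card_filter_not, Finset.card_univ]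

open Classical in
/-- The neighbour of `x` along colour `α`. -/
noncomputable def nb (c : Sym2 V → Option K) (x : V) (α : K) : V :=
  if h : Has c x α then h.choose else x

theorem nb_spec (h : Has c x α) : c s(x, nb c x α) = some α := by
  rw [nb, dif_pos h]; exact h.choose_spec

theorem nb_injOn : Set.InjOn (nb c x) {α | Has c x α} := by
  intro _ hα _ hβ h
  refine col_inj (nb_spec hα) ?_
  rw [h]; exact nb_spec hβ

theorem card_C_le (N : Finset V) (h : ∀ y α, c s(x, y) = some α → y ∈ N) :
    (C c x).card ≤ N.card :=
  Finset.card_le_card_of_injOn (nb c x) (fun _ hα => h _ _ (nb_spec (mem_C.1 hα)))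
    (nb_injOn.mono fun _ hα => mem_C.1 hα)

variable [Fintype V] [DecidableRel H.Adj]

theorem card_C_le_degree (P : PEC H c) : (C c x).card ≤ H.degree x :=
  card_C_le _ fun y _ h => by simpa using P.supp h

theorem card_C_lt_degree (P : PEC H c) (hu : H.Adj x u) (hn : c s(x, u) = none) :
    (C c x).card < H.degree x := by
  refine lt_of_le_of_lt (card_C_le ((H.neighborFinset x).erase u) fun y _ h => ?_)
    (Finset.card_erase_lt_of_mem (by simpa using hu))
  rw [Finset.mem_erase]
  exact ⟨by rintro rfl; simp [hn] at h, by simpa using P.supp h⟩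

theorem card_le_degree (P : PEC H c) (S : Finset K) (h : ∀ α ∈ S, Has c x α) :
    S.card ≤ H.degree x :=
  (Finset.card_le_card fun α hα => mem_C.2 (h α hα)).trans (card_C_le_degree P)

/-- If the colours in `S` already fill up the degree, no other colour appears. -/
theorem mem_of_full (P : PEC H c) (S : Finset K) (h : ∀ α ∈ S, Has c x α)
    (hd : H.degree x ≤ S.card) (hγ : Has c x γ) : γ ∈ S := by
  have := Finset.eq_of_subset_of_card_le (fun α hα => mem_C.2 (h α hα))
    ((card_C_le_degree P).trans hd)
  rw [this]; exact mem_C.2 hγ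

end Card

end

section

variable {V K : Type*} [DecidableEq V] {H : SimpleGraph V} {c c' : Sym2 V → Option K}
  {α β γ δ p q r s : K} {x y z w u v a b : V} {o o' : Option K}

theorem not_R_erase (P : PEC H c) (h : c s(x, y) = some α) : ¬R (set c x y none) α β x y := by
  intro hR
  have hne := (P.supp h).ne
  have hb := isAcyclic_iff_forall_adj_isBridge.1 (P.acyc α β) (bi_adj.2 ⟨.inl h, hne⟩)
  rw [isBridge_iff] at hb
  apply hb
  refine SimpleGraph.Reachable.mono ?_ hR
  intro a b hab
  rw [bi_adj, set_apply] at hab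
  split_ifs at hab with h1
  · simp at hab
  · rw [deleteEdges_adj, bi_adj]
    exact ⟨hab, h1⟩

/-- A minimal graph without acyclic edge colouring by `K`. -/
structure Crit (H : SimpleGraph V) (K : Type*) [Fintype V] [Fintype K] [DecidableRel H.Adj] :
    Prop where
  uncol : ∀ c : Sym2 V → Option K, PEC H c → ∃ x y, H.Adj x y ∧ c s(x, y) = none
  col : ∀ x y, H.Adj x y → ∃ c : Sym2 V → Option K, PEC H c ∧ c s(x, y) = none ∧
    ∀ a b, H.Adj a b → s(a, b) ≠ s(x, y) → c s(a, b) ≠ none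
  deg : ∀ x, H.degree x + 2 ≤ Fintype.card K

/-- A colouring in which exactly the edges at `u` are uncoloured. -/
structure Hole (H : SimpleGraph V) (c : Sym2 V → Option K) (u : V) : Prop where
  pec : PEC H c
  un : ∀ y, c s(u, y) = none
  full : ∀ {x y}, H.Adj x y → x ≠ u → y ≠ u → c s(x, y) ≠ none

theorem Hole.of (h : Hole H c u) (P : PEC H c') (hn : ∀ e, c' e = none ↔ c e = none) :
    Hole H c' u :=
  ⟨P, fun y => (hn _).2 (h.un y), fun h1 h2 h3 h4 => h.full h1 h2 h3 ((hn _).1 h4)⟩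

theorem set_none_iff (hc : c s(x, y) = some α) :
    ∀ e, set c x y (some β) e = none ↔ c e = none := by
  intro e
  rw [set_apply]
  split_ifs with h
  · subst h; simp [hc]
  · rfl

theorem swap_none_iff (hx : c s(v, x) = some p) (hy : c s(v, y) = some q) :
    ∀ e, swap c v x y p q e = none ↔ c e = none := by
  intro e
  rw [swap, set_apply, set_apply]
  split_ifs with h h
  · subst h; simp [hy]
  · subst h; simp [hx]
  · rfl

theorem Hole.has_of_adj (h : Hole H c u) (hxy : H.Adj x y) (hx : x ≠ u) (hy : y ≠ u) :
    ∃ α, c s(x, y) = some α :=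
  Option.ne_none_iff_exists'.1 (h.full hxy hx hy)

/-- Colour one edge at the hole. -/
theorem color_first (P : PEC H c) (hu : ∀ y, c s(u, y) = none) (ha : H.Adj u a) (hp : ¬Has c a p) :
    PEC H (set c u a (some p)) := by
  have hn : ∀ α, ¬Has c u α := by rintro α ⟨y, hy⟩; simp [hu y] at hy
  exact P.color ha (hu a) (hn _) hp fun β _ h => absurd h (hn β)

theorem color_second (P : PEC H c) (hu : ∀ y, c s(u, y) = none) (ha : H.Adj u a) (hb : H.Adj u b)
    (hab : a ≠ b) (hp : ¬Has c a p) (hq : ¬Has c b q) (hpq : p ≠ q) (hR : ¬R c p q a b) :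
    PEC H (set (set c u a (some p)) u b (some q)) := by
  have hn : ∀ α, ¬Has c u α := by rintro α ⟨y, hy⟩; simp [hu y] at hy
  have P1 := color_first P hu ha hp
  have hu1 : ∀ α, Has (set c u a (some p)) u α → α = p := by
    intro α h
    rw [has_set P] at h
    exact h.elim (fun h => (Option.some.inj h).symm) (fun h => absurd h.1 (hn _))
  refine P1.color hb (by rw [set_mk, if_neg, hu]; grind) (fun h => hpq (hu1 _ h).symm) ?_ ?_
  · rwa [has_set_of hb.ne.symm hab.symm]
  · intro β _ hβ _ hRβ
    obtain rfl := hu1 β hβ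
    obtain ⟨z, hz, hz2⟩ := chase_tail hRβ.comm hb.ne (fun h => hpq (hu1 _ h).symm)
    obtain rfl := P1.proper hz (by simp [set_mk] : set c u a (some β) s(u, a) = some β)
    rw [set_none_set] at hz2
    exact hR (hz2.of_set (by simp) (by simp))

theorem color_third (P : PEC H c) (hu : ∀ y, c s(u, y) = none) (ha : H.Adj u a) (hb : H.Adj u b)
    (hv : H.Adj u v) (hab : a ≠ b) (hav : a ≠ v) (hbv : b ≠ v) (hp : ¬Has c a p) (hq : ¬Has c b q)
    (hr : ¬Has c v r) (hpq : p ≠ q) (hpr : p ≠ r) (hqr : q ≠ r) (h1 : ¬R c p q a b)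
    (h2 : ¬R c p r a v) (h3 : ¬R c q r b v) :
    PEC H (set (set (set c u a (some p)) u b (some q)) u v (some r)) := by
  have hn : ∀ α, ¬Has c u α := by rintro α ⟨y, hy⟩; simp [hu y] at hy
  have P1 := color_first P hu ha hp
  have P2 := color_second P hu ha hb hab hp hq hpq h1
  have hu1 : ∀ α, Has (set (set c u a (some p)) u b (some q)) u α → α = p ∨ α = q := by
    intro α h
    rw [has_set P1, has_set P] at h
    rcases h with h | ⟨h | h, -⟩
    · exact .inr (Option.some.inj h).symm
    · exact .inl (Option.some.inj h).symm
    · exact absurd h.1 (hn _)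
  have hur : ¬Has (set (set c u a (some p)) u b (some q)) u r := by
    intro h; rcases hu1 _ h with h | h
    · exact hpr h.symm
    · exact hqr h.symm
  refine P2.color hv (by rw [set_mk, if_neg, set_mk, if_neg, hu] <;> grind) hur ?_ ?_
  · rwa [has_set_of hv.ne.symm hbv.symm, has_set_of hv.ne.symm hav.symm]
  · intro β _ hβ _ hRβ
    rcases hu1 β hβ with rfl | rfl
    · obtain ⟨z, hz, hz2⟩ := chase_tail hRβ.comm hv.ne hur
      obtain rfl := P2.proper hz
        (by rw [set_mk, if_neg (by grind)]; simp [set_mk] :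
          set (set c u a (some β)) u b (some q) s(u, a) = some β)
      rw [set_comm _ _ _ (edge_ne hab.symm), set_none_set] at hz2
      exact h2 ((hz2.of_set (by simp [hpq.symm]) (by simp [hqr])).of_set (by simp) (by simp))
    · obtain ⟨z, hz, hz2⟩ := chase_tail hRβ.comm hv.ne hur
      obtain rfl := P2.proper hz
        (by simp [set_mk] :
          set (set c u a (some p)) u b (some β) s(u, b) = some β)
      rw [set_none_set] at hz2
      exact h3 ((hz2.of_set (by simp) (by simp)).of_set (by simp [hpq]) (by simp [hpr]))

section

variable [Fintype V] [Fintype K] [DecidableRel H.Adj]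

theorem Crit.card_F (Cr : Crit H K) (h : Hole H c u) (hx : H.Adj x u) :
    Fintype.card K + 1 ≤ (F c x).card + H.degree x ∧ 3 ≤ (F c x).card := by
  have h1 := card_C_lt_degree h.pec hx (col_symm (h.un x))
  have h2 := card_C_add_card_F c x
  have h3 := Cr.deg x
  omega

/-- A colouring with hole at the `2`-vertex `u`. -/
structure Hole2 (H : SimpleGraph V) (c : Sym2 V → Option K) (u v w : V) : Prop
    extends Hole H c u where
  nbr : ∀ y, H.Adj u y ↔ y = v ∨ y = w
  vw : v ≠ w

theorem Hole2.of (h : Hole2 H c u v w) (P : PEC H c') (hn : ∀ e, c' e = none ↔ c e = none) :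
    Hole2 H c' u v w :=
  ⟨h.toHole.of P hn, h.nbr, h.vw⟩

theorem Hole2.symm (h : Hole2 H c u v w) : Hole2 H c u w v :=
  ⟨h.toHole, fun y => by rw [h.nbr, or_comm], h.vw.symm⟩

/-- A colouring with hole at the `3`-vertex `u`. -/
structure Hole3 (H : SimpleGraph V) (c : Sym2 V → Option K) (u a b v : V) : Prop
    extends Hole H c u where
  nbr : ∀ y, H.Adj u y ↔ y = a ∨ y = b ∨ y = v
  ab : a ≠ b
  av : a ≠ v
  bv : b ≠ v

theorem Hole3.of (h : Hole3 H c u a b v) (P : PEC H c') (hn : ∀ e, c' e = none ↔ c e = none) :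
    Hole3 H c' u a b v :=
  ⟨h.toHole.of P hn, h.nbr, h.ab, h.av, h.bv⟩

theorem Hole3.swap_ab (h : Hole3 H c u a b v) : Hole3 H c u b a v :=
  ⟨h.toHole, fun y => by rw [h.nbr]; tauto, h.ab.symm, h.bv, h.av⟩

theorem Hole3.swap_av (h : Hole3 H c u a b v) : Hole3 H c u v b a :=
  ⟨h.toHole, fun y => by rw [h.nbr]; tauto, h.bv.symm, h.av.symm, h.ab.symm⟩

theorem Hole3.ua (h : Hole3 H c u a b v) : H.Adj u a := (h.nbr a).2 (.inl rfl)
theorem Hole3.ub (h : Hole3 H c u a b v) : H.Adj u b := (h.nbr b).2 (.inr (.inl rfl))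
theorem Hole3.uv (h : Hole3 H c u a b v) : H.Adj u v := (h.nbr v).2 (.inr (.inr rfl))
theorem Hole2.uv (h : Hole2 H c u v w) : H.Adj u v := (h.nbr v).2 (.inl rfl)
theorem Hole2.uw (h : Hole2 H c u v w) : H.Adj u w := (h.nbr w).2 (.inr rfl)

theorem Hole2.obs (h : Hole2 H c u v w) (Cr : Crit H K) (hq : ¬Has c w q) (hr : ¬Has c v r)
    (hqr : q ≠ r) : R c q r v w := by
  by_contra hR
  have P := color_second h.pec h.un h.uw h.uv h.vw.symm hq hr hqr (fun h => hR h.symm)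
  obtain ⟨x, y, hxy, hn⟩ := Cr.uncol _ P
  rw [set_mk] at hn
  split_ifs at hn with h1
  rw [set_mk] at hn
  split_ifs at hn with h2
  by_cases hx : x = u
  · subst hx; rcases (h.nbr _).1 hxy with rfl | rfl <;> simp_all
  by_cases hy : y = u
  · subst hy; rcases (h.nbr _).1 hxy.symm with rfl | rfl <;> simp_all
  exact h.full hxy hx hy hn

theorem Hole3.obs (h : Hole3 H c u a b v) (Cr : Crit H K) (hp : ¬Has c a p) (hq : ¬Has c b q)
    (hr : ¬Has c v r) (hpq : p ≠ q) (hpr : p ≠ r) (hqr : q ≠ r) :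
    R c p q a b ∨ R c p r a v ∨ R c q r b v := by
  by_contra! hcon
  have P := color_third h.pec h.un h.ua h.ub h.uv h.ab h.av h.bv hp hq hr hpq hpr hqr
    hcon.1 hcon.2.1 hcon.2.2
  obtain ⟨x, y, hxy, hn⟩ := Cr.uncol _ P
  rw [set_mk] at hn
  split_ifs at hn with h1
  rw [set_mk] at hn
  split_ifs at hn with h2
  rw [set_mk] at hn
  split_ifs at hn with h2
  by_cases hx : x = u
  · subst hx; rcases (h.nbr _).1 hxy with rfl | rfl | rfl <;> simp_all
  by_cases hy : y = u
  · subst hy; rcases (h.nbr _).1 hxy.symm with rfl | rfl | rfl <;> simp_all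
  exact h.full hxy hx hy hn

theorem Crit.exists_hole2 (Cr : Crit H K) (hN : ∀ y, H.Adj u y ↔ y = v ∨ y = w) (hvw : v ≠ w) :
    ∃ c : Sym2 V → Option K, Hole2 H c u v w := by
  have huv : H.Adj u v := (hN v).2 (.inl rfl)
  obtain ⟨c, P, h1, h2⟩ := Cr.col u v huv
  refine ⟨set c u w none, ⟨P.erase u w, ?_, ?_⟩, hN, hvw⟩
  · intro y
    rw [set_mk]
    split_ifs with h
    · rfl
    · by_contra hy
      obtain ⟨α, hα⟩ := Option.ne_none_iff_exists'.1 hy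
      rcases (hN y).1 (P.supp hα) with rfl | rfl
      · simp [h1] at hα
      · simp at h
  · intro x y hxy hx hy
    rw [set_mk, if_neg (by grind)]
    exact h2 x y hxy (by simp [hx, hy])

theorem Crit.exists_hole3 (Cr : Crit H K) (hN : ∀ y, H.Adj u y ↔ y = a ∨ y = b ∨ y = v)
    (hab : a ≠ b) (hav : a ≠ v) (hbv : b ≠ v) :
    ∃ (c : Sym2 V → Option K) (p q : K), Hole3 H c u a b v ∧ ¬Has c a p ∧ ¬Has c b q ∧ p ≠ q ∧
      ¬R c p q a b := by
  have huv : H.Adj u v := (hN v).2 (.inr (.inr rfl))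
  have hua : H.Adj u a := (hN a).2 (.inl rfl)
  have hub : H.Adj u b := (hN b).2 (.inr (.inl rfl))
  obtain ⟨c, P, h1, h2⟩ := Cr.col u v huv
  have ha : c s(u, a) ≠ none := h2 u a hua (edge_ne hav)
  have hb : c s(u, b) ≠ none := h2 u b hub (edge_ne hbv)
  obtain ⟨p, hp⟩ := Option.ne_none_iff_exists'.1 ha
  obtain ⟨q, hq⟩ := Option.ne_none_iff_exists'.1 hb
  have hpq : p ≠ q := by rintro rfl; exact hab (P.proper hp hq)
  refine ⟨set (set c u a none) u b none, p, q,
    ⟨⟨(P.erase u a).erase u b, ?_, ?_⟩, hN, hab, hav, hbv⟩, ?_, ?_, hpq, ?_⟩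
  · intro y
    rw [set_mk]
    split_ifs with h
    · rfl
    rw [set_mk]
    split_ifs with h'
    · rfl
    · by_contra hy
      obtain ⟨α, hα⟩ := Option.ne_none_iff_exists'.1 hy
      rcases (hN y).1 (P.supp hα) with rfl | rfl | rfl
      · simp at h'
      · simp at h
      · simp [h1] at hα
  · intro x y hxy hx hy
    rw [set_mk, if_neg (by grind), set_mk, if_neg (by grind)]
    exact h2 x y hxy (by simp [hx, hy])
  · rw [has_set_of hua.ne.symm hab, has_set' P]; simp [hp]
  · rw [has_set' (P.erase u a), set_mk, if_neg (by grind)]; simp [hq]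
  · intro hR
    have hq' : (set c u a none) s(u, b) = some q := by rw [set_mk, if_neg (by grind), hq]
    refine not_R_erase P hp (β := q) ?_
    have h3 : R (set c u a none) p q a b := hR.of_set (by simp) (by simp)
    exact ((h3.trans (R.edge (P.erase u a) (col_symm hq')).comm)).symm

end

end

section

variable {V K : Type*} [DecidableEq V] {H : SimpleGraph V} {c c' : Sym2 V → Option K}
  {α β γ δ p q r s : K} {x y z w u v a b : V} {o o' : Option K}
  [Fintype V] [Fintype K] [DecidableRel H.Adj]

/-- Ends of bichromatic paths determine each other. -/
theorem R_unique (P : PEC H c) (h : R c p q x y) (h' : R c p q x z) (hxy : x ≠ y) (hxz : x ≠ z)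
    (mx : ¬Has c x p ∨ ¬Has c x q) (my : ¬Has c y p ∨ ¬Has c y q)
    (mz : ¬Has c z p ∨ ¬Has c z q) : y = z := by
  by_contra hyz
  exact uniq P hxy hxz hyz mx my mz h h'

theorem exists_mem_ne (S : Finset K) (h : 2 ≤ S.card) (p : K) : ∃ r ∈ S, r ≠ p :=
  Finset.exists_mem_ne (by omega) p

theorem exists_mem_ne_ne (S : Finset K) (h : 3 ≤ S.card) (p q : K) : ∃ r ∈ S, r ≠ p ∧ r ≠ q := by
  classical
  have : ((S.erase p).erase q).Nonempty := by
    rw [← Finset.card_pos]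
    have h1 := Finset.pred_card_le_card_erase (s := S) (a := p)
    have h2 := Finset.pred_card_le_card_erase (s := S.erase p) (a := q)
    omega
  obtain ⟨r, hr⟩ := this
  simp only [Finset.mem_erase] at hr
  exact ⟨r, hr.2.2, hr.2.1, hr.1⟩

namespace Hole3

theorem card_v (h : Hole3 H c u a b v) (Cr : Crit H K) : 3 ≤ (F c v).card :=
  (Cr.card_F h.toHole h.uv.symm).2

theorem card_a (h : Hole3 H c u a b v) (Cr : Crit H K) : 3 ≤ (F c a).card :=
  (Cr.card_F h.toHole h.ua.symm).2

theorem card_b (h : Hole3 H c u a b v) (Cr : Crit H K) : 3 ≤ (F c b).card :=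
  (Cr.card_F h.toHole h.ub.symm).2

/-- If `a, b, v` all miss `q`, then `a, b` miss no other colour in common. -/
theorem common_ab (h : Hole3 H c u a b v) (Cr : Crit H K) (ha : ¬Has c a q) (hb : ¬Has c b q)
    (hv : ¬Has c v q) (hp : p ≠ q) (hpa : ¬Has c a p) : Has c b p := by
  by_contra hpb
  obtain ⟨r, hr, hrp, hrq⟩ := exists_mem_ne_ne _ (h.card_v Cr) p q
  rw [mem_F] at hr
  have h1 : R c p r a v := by
    rcases h.obs Cr hpa hb hr hp hrp.symm hrq.symm with h1 | h1 | h1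
    · exact absurd h1 (not_R_of_miss hpa ha h.ab)
    · exact h1
    · exact absurd h1 (not_R_of_miss' hv hr h.bv)
  have h2 : R c p r b v := by
    rcases h.obs Cr ha hpb hr hp.symm hrq.symm hrp.symm with h1 | h1 | h1
    · exact absurd h1 (not_R_of_miss ha hpa h.ab)
    · exact absurd h1 (not_R_of_miss' hv hr h.av)
    · exact h1
  exact h.ab (R_unique h.pec h1.symm h2.symm h.av.symm h.bv.symm (.inr hr) (.inl hpa) (.inl hpb))

theorem common_R (h : Hole3 H c u a b v) (Cr : Crit H K) (ha : ¬Has c a q) (hb : ¬Has c b q)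
    (hv : ¬Has c v q) (hp : p ≠ q) (hr : r ≠ q) (hpa : ¬Has c a p) (hrb : ¬Has c b r) :
    R c p r a b := by
  have hpr : p ≠ r := by rintro rfl; exact hrb (h.common_ab Cr ha hb hv hp hpa)
  rcases h.obs Cr hpa hrb hv hpr hp hr with h1 | h1 | h1
  · exact h1
  · exact absurd h1 (not_R_of_miss hpa ha h.av)
  · exact absurd h1 (not_R_of_miss hrb hb h.bv)

/-- The colours of `a` and `v`, `b` and `v` exchange roles as well. -/
theorem common_has (h : Hole3 H c u a b v) (Cr : Crit H K) (ha : ¬Has c a q) (hb : ¬Has c b q)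
    (hv : ¬Has c v q) (hp : p ≠ q) (hpa : ¬Has c a p) :
    Has c v p ∧ ∀ r, r ≠ q → ¬Has c v r → R c p r a v ∧ Has c (nb c v p) r := by
  have hvp : Has c v p := h.swap_ab.swap_av.swap_ab.common_ab Cr ha hv hb hp hpa
  refine ⟨hvp, fun r hr hvr => ?_⟩
  have hR : R c p r a v := h.swap_ab.swap_av.swap_ab.common_R Cr ha hv hb hp hr hpa hvr
  refine ⟨hR, ?_⟩
  obtain ⟨z, hz, hz2⟩ := chase h.pec hR.symm h.av.symm hvr
  rw [h.pec.proper (nb_spec hvp) hz]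
  rcases hz2 with rfl | hz2
  · exact absurd ⟨_, col_symm hz⟩ hpa
  · exact hz2

theorem common_big (h : Hole3 H c u a b v) (Cr : Crit H K) (ha : ¬Has c a q) (hb : ¬Has c b q)
    (hv : ¬Has c v q) (hdb : 4 ≤ H.degree b) (hp : p ≠ q) (hpa : ¬Has c a p) :
    4 ≤ H.degree (nb c v p) := by
  classical
  by_contra hsm
  obtain ⟨hvp, hM⟩ := h.common_has Cr ha hb hv hp hpa
  have hx := nb_spec hvp
  set x := nb c v p with hxdef
  have hxp : Has c x p := ⟨v, col_symm hx⟩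
  have hax : a ≠ x := by rintro rfl; exact hpa hxp
  have hbx : b ≠ x := by rintro h; rw [h] at hdb; exact hsm hdb
  have hcard := h.card_v Cr
  have hfull : ∀ γ, Has c x γ → γ = p ∨ (γ ≠ q ∧ ¬Has c v γ) := by
    intro γ hγ
    have := mem_of_full h.pec (insert p ((F c v).erase q)) (x := x) (γ := γ) ?_ ?_ hγ
    · simpa using this
    · intro α hα
      simp only [Finset.mem_insert, Finset.mem_erase, mem_F] at hα
      rcases hα with rfl | ⟨h1, h2⟩
      · exact hxp
      · exact (hM α h1 h2).2
    · rw [Finset.card_insert_of_notMem (by simp [hvp]),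
        Finset.card_erase_of_mem (by simpa using hv)]
      omega
  have hxq : ¬Has c x q := fun h => by
    rcases hfull q h with h | h
    · exact hp h.symm
    · exact h.1 rfl
  rcases recolor_or h.pec hx hv hxq with P' | ⟨s, h1, h2, h3, h4, h5⟩
  swap
  · rcases hfull s h3 with h | h
    · exact h1 h
    · exact h.2 h4
  have h' := h.of P' (set_none_iff hx)
  obtain ⟨t, ht, htq⟩ := exists_mem_ne _
    (show 2 ≤ (F c b).card from by have := h.card_b Cr; omega) q
  rw [mem_F] at ht
  have hvt : Has c v t := (h.swap_ab.common_has Cr hb ha hv htq ht).1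
  have hpt : R c p t a b := h.common_R Cr ha hb hv hp htq hpa ht
  have htp : t ≠ p := by rintro rfl; exact ht (h.common_ab Cr ha hb hv hp hpa)
  have ha' : ∀ γ, Has (set c v x (some q)) a γ ↔ Has c a γ := fun γ => has_set_of h.av hax
  have hb' : ∀ γ, Has (set c v x (some q)) b γ ↔ Has c b γ := fun γ => has_set_of h.bv hbx
  have hv' : ¬Has (set c v x (some q)) v p := by
    rw [has_set h.pec]; simp [hx, hp.symm]
  rcases h'.obs Cr (p := q) (q := t) (r := p) (by rwa [ha']) (by rwa [hb']) hv' htq.symm hp.symm htp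
    with h1 | h1 | h1
  · exact not_R_of_miss' (by rwa [hb']) (by rwa [hb']) h.ab h1
  · exact not_R_of_miss (by rwa [ha']) (by rwa [ha']) h.av h1
  · have h2 : R c p t b x :=
      ((h1.of_set (by simp [htq.symm]) (by simp [hp.symm])).comm).trans (R.edge h.pec hx)
    refine hax (R_unique h.pec hpt.symm h2 h.ab.symm hbx (.inr ht) (.inl hpa) (.inr ?_))
    intro h
    rcases hfull t h with h | h
    · exact htp h
    · exact h.2 hvt

/-- A colour missing at all three neighbours forces four colours at `v`. -/
theorem common_card (h : Hole3 H c u a b v) (Cr : Crit H K) (ha : ¬Has c a q) (hb : ¬Has c b q)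
    (hv : ¬Has c v q) : ∃ S : Finset K, 4 ≤ S.card ∧ ∀ s ∈ S, Has c v s ∧
      (4 ≤ H.degree a → 4 ≤ H.degree b → 4 ≤ H.degree (nb c v s)) := by
  classical
  refine ⟨(F c a).erase q ∪ (F c b).erase q, ?_, ?_⟩
  · rw [Finset.card_union_of_disjoint, Finset.card_erase_of_mem (by simpa using ha),
      Finset.card_erase_of_mem (by simpa using hb)]
    · have := h.card_a Cr; have := h.card_b Cr; omega
    · rw [Finset.disjoint_left]
      intro p h1 h2
      simp only [Finset.mem_erase, mem_F] at h1 h2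
      exact h2.2 (h.common_ab Cr ha hb hv h1.1 h1.2)
  · intro s hs
    simp only [Finset.mem_union, Finset.mem_erase, mem_F] at hs
    rcases hs with hs | hs
    · exact ⟨(h.common_has Cr ha hb hv hs.1 hs.2).1, fun _ h2 =>
        h.common_big Cr ha hb hv h2 hs.1 hs.2⟩
    · exact ⟨(h.swap_ab.common_has Cr hb ha hv hs.1 hs.2).1, fun h1 _ =>
        h.swap_ab.common_big Cr hb ha hv h1 hs.1 hs.2⟩

end Hole3

/-- The colour `p`, missing at `a`, can be completed at `b` but never at `v`. -/
structure InA (c : Sym2 V → Option K) (a b v : V) (p : K) : Prop where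
  miss : ¬Has c a p
  not_R : ∀ q, ¬Has c b q → ¬Has c v q → ¬R c p q a b
  R : ∀ r, ¬Has c v r → R c p r a v

/-- The colour `p`, missing at `a`, can never be completed at `b`. -/
structure InY (c : Sym2 V → Option K) (a b : V) (p : K) : Prop where
  miss : ¬Has c a p
  R : ∀ q, ¬Has c b q → R c p q a b

structure TypeB (c : Sym2 V → Option K) (a b v : V) : Prop where
  disj : ∀ p, ¬Has c a p → Has c v p
  D : ∃ q, ¬Has c b q ∧ ¬Has c v q
  A : ∃ p, InA c a b v p
  cases : ∀ p, ¬Has c a p → InA c a b v p ∨ InY c a b p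
  Y : ∀ p, InY c a b p → (∀ q, ¬Has c a q → Has c b q) ∧
    ∀ q, ∃ q', q' ≠ q ∧ ¬Has c b q' ∧ ¬Has c v q'

structure TypeC (c : Sym2 V → Option K) (a b v : V) : Prop where
  av : ∀ p, ¬Has c a p → Has c v p
  bv : ∀ p, ¬Has c b p → Has c v p
  ab : ∃ p q, p ≠ q ∧ ¬Has c a p ∧ ¬Has c b p ∧ ¬Has c a q ∧ ¬Has c b q

namespace Hole3

theorem typeC_R (h : Hole3 H c u a b v) (Cr : Crit H K) (hC : TypeC c a b v) (hr : ¬Has c v r) :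
    (∀ p, ¬Has c a p → R c p r a v) ∨ (∀ p, ¬Has c b p → R c p r b v) := by
  obtain ⟨p, q, hpq, hap, hbp, haq, hbq⟩ := hC.ab
  have hne : ∀ {s}, ¬Has c a s → s ≠ r := by rintro s hs rfl; exact hr (hC.av _ hs)
  have hne' : ∀ {s}, ¬Has c b s → s ≠ r := by rintro s hs rfl; exact hr (hC.bv _ hs)
  have hexcl : ∀ {s}, ¬Has c a s → ¬Has c b s → R c s r a v → ¬R c s r b v := by
    intro s h1 h2 h3 h4
    exact h.ab (R_unique h.pec h3.symm h4.symm h.av.symm h.bv.symm (.inr hr) (.inl h1) (.inl h2))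
  have ta : ∀ {s t}, s ≠ t → ¬Has c a s → ¬Has c a t → ¬Has c b t → R c s r a v ∨ R c t r b v := by
    intro s t hst h1 h2 h3
    exact (h.obs Cr h1 h3 hr hst (hne h1) (hne h2)).resolve_left (not_R_of_miss h1 h2 h.ab)
  have tb : ∀ {s t}, s ≠ t → ¬Has c a s → ¬Has c b s → ¬Has c b t → R c s r a v ∨ R c t r b v := by
    intro s t hst h1 h2 h3
    exact (h.obs Cr h1 h3 hr hst (hne h1) (hne' h3)).resolve_left (not_R_of_miss' h2 h3 h.ab)
  rcases ta hpq hap haq hbq with h1 | h1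
  · left
    intro s hs
    by_cases hsp : s = p
    · exact hsp ▸ h1
    exact (ta hsp hs hap hbp).resolve_right (hexcl hap hbp h1)
  · right
    intro s hs
    by_cases hsq : s = q
    · exact hsq ▸ h1
    exact (tb (Ne.symm hsq) haq hbq hs).resolve_left fun h2 => hexcl haq hbq h2 h1

theorem typeB (h : Hole3 H c u a b v) (Cr : Crit H K) (hC : (C c v).card ≤ 4)
    (hdisj : ∀ p, ¬Has c a p → Has c v p) (hp₀ : ¬Has c a p) (hbq₀ : ¬Has c b q)
    (hvq₀ : ¬Has c v q) (hgood : ¬R c p q a b) : TypeB c a b v := by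
  classical
  have hne : ∀ {p r}, ¬Has c a p → ¬Has c v r → p ≠ r := by
    rintro p _ hs hr rfl; exact hr (hdisj _ hs)
  have hR : ∀ {p q}, ¬Has c a p → ¬Has c b q → ¬Has c v q → ¬R c p q a b →
      ∀ {r}, ¬Has c v r → r ≠ q → R c p r a v := by
    intro p q hp hq hvq hg r hr hrq
    rcases h.obs Cr hp hq hr (hne hp hvq) (hne hp hr) hrq.symm with h1 | h1 | h1
    · exact absurd h1 hg
    · exact h1
    · exact absurd h1 (not_R_of_miss' hvq hr h.bv)
  have hexcl : ∀ {p q}, ¬Has c a p → ¬Has c b q → ¬Has c v q → R c p q a v → ¬R c p q a b := by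
    intro p q hp hq hvq h1 h2
    exact h.bv (R_unique h.pec h2 h1 h.ab h.av (.inl hp) (.inr hq) (.inr hvq))
  by_cases hD : ∃ q', q' ≠ q ∧ ¬Has c b q' ∧ ¬Has c v q'
  · have hD' : ∀ t, ∃ q', q' ≠ t ∧ ¬Has c b q' ∧ ¬Has c v q' := by
      intro t
      by_cases ht : t = q
      · rw [ht]; exact hD
      · exact ⟨q, Ne.symm ht, hbq₀, hvq₀⟩
    have hA : ∀ {p q}, ¬Has c a p → ¬Has c b q → ¬Has c v q → ¬R c p q a b → InA c a b v p := by
      intro p q hp hq hvq hg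
      have h1 : ∀ q', ¬Has c b q' → ¬Has c v q' → ¬R c p q' a b := by
        intro q' hbq' hvq'
        by_cases hqq : q' = q
        · rw [hqq]; exact hg
        · exact hexcl hp hbq' hvq' (hR hp hq hvq hg hvq' hqq)
      refine ⟨hp, h1, fun r hr => ?_⟩
      obtain ⟨q', h2, h3, h4⟩ := hD' r
      exact hR hp h3 h4 (h1 q' h3 h4) hr h2.symm
    refine ⟨hdisj, ⟨q, hbq₀, hvq₀⟩, ⟨p, hA hp₀ hbq₀ hvq₀ hgood⟩, ?_, ?_⟩
    · intro p hp
      by_cases hg : ∃ q, ¬Has c b q ∧ ¬Has c v q ∧ ¬R c p q a b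
      · obtain ⟨q, h1, h2, h3⟩ := hg
        exact .inl (hA hp h1 h2 h3)
      · push Not at hg
        refine .inr ⟨hp, fun q' hq' => ?_⟩
        by_cases hvq' : Has c v q'
        swap
        · exact hg q' hq' hvq'
        have hpq : R c p q a b := hg q hbq₀ hvq₀
        have hpq' : p ≠ q' := by
          rintro rfl
          exact not_R_of_miss' hq' hbq₀ h.ab hpq
        have hqq' : q' ≠ q := by rintro rfl; exact hvq₀ hvq'
        rcases h.obs Cr hp hq' hvq₀ hpq' (hne hp hvq₀) hqq' with h1 | h1 | h1
        · exact h1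
        · exact absurd hpq (hexcl hp hbq₀ hvq₀ h1)
        · exact absurd h1 (not_R_of_miss hq' hbq₀ h.bv)
    · intro p hp
      refine ⟨fun t ht => ?_, hD'⟩
      by_contra hbt
      exact not_R_of_miss hp.miss ht h.ab (hp.R t hbt)
  · push Not at hD
    obtain ⟨e, hea, heb⟩ : ∃ e, ¬Has c a e ∧ ¬Has c b e := by
      by_contra! hcon
      have h1 : (F c a ∪ (F c b).erase q).card ≤ (C c v).card := by
        refine Finset.card_le_card fun t ht => ?_
        simp only [Finset.mem_union, Finset.mem_erase, mem_F] at ht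
        rw [mem_C]
        rcases ht with ht | ht
        · exact hdisj t ht
        · exact hD t ht.1 ht.2
      rw [Finset.card_union_of_disjoint, Finset.card_erase_of_mem (by simpa using hbq₀)] at h1
      · have := h.card_a Cr; have := h.card_b Cr; omega
      · rw [Finset.disjoint_left]
        intro t ht ht2
        simp only [Finset.mem_erase, mem_F] at ht ht2
        exact ht2.2 (hcon t ht)
    have hmain : ∀ p, ¬Has c a p → R c p q a v := by
      intro p hp
      by_cases hpe : p = e
      · subst hpe
        obtain ⟨t, ht, htp, htq⟩ := exists_mem_ne_ne _ (h.card_b Cr) p q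
        rw [mem_F] at ht
        rcases h.obs Cr hp ht hvq₀ htp.symm (hne hp hvq₀) htq with h1 | h1 | h1
        · exact absurd h1 (not_R_of_miss' heb ht h.ab)
        · exact h1
        · exact absurd h1 (not_R_of_miss ht hbq₀ h.bv)
      · rcases h.obs Cr hp heb hvq₀ hpe (hne hp hvq₀) (hne hea hvq₀) with h1 | h1 | h1
        · exact absurd h1 (not_R_of_miss hp hea h.ab)
        · exact h1
        · exact absurd h1 (not_R_of_miss heb hbq₀ h.bv)
    have hA : ∀ p, ¬Has c a p → InA c a b v p := by
      intro p hp
      have hg := hexcl hp hbq₀ hvq₀ (hmain p hp)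
      refine ⟨hp, ?_, ?_⟩
      · intro q' h1 h2
        by_cases hqq : q' = q
        · rw [hqq]; exact hg
        · exact absurd (hD q' hqq h1) h2
      · intro r hr
        by_cases hrq : r = q
        · rw [hrq]; exact hmain p hp
        · exact hR hp hbq₀ hvq₀ hg hr hrq
    refine ⟨hdisj, ⟨q, hbq₀, hvq₀⟩, ⟨p, hA p hp₀⟩, fun p hp => .inl (hA p hp), ?_⟩
    intro p hp
    exact absurd (hp.R q hbq₀) ((hA p hp.miss).not_R q hbq₀ hvq₀)

theorem trichotomy (h : Hole3 H c u a b v) (Cr : Crit H K) (hC : (C c v).card ≤ 4)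
    (hp : ¬Has c a p) (hq : ¬Has c b q) (hpq : p ≠ q) (hg : ¬R c p q a b) :
    (∃ q, ¬Has c a q ∧ ¬Has c b q ∧ ¬Has c v q) ∨ TypeB c a b v ∨ TypeB c b a v ∨
      TypeC c a b v := by
  classical
  by_cases hci : ∃ q, ¬Has c a q ∧ ¬Has c b q ∧ ¬Has c v q
  · exact .inl hci
  push Not at hci
  right
  have key : ∀ {a b}, Hole3 H c u a b v → (∀ q, ¬Has c a q → ¬Has c b q → Has c v q) →
      ∀ {p q}, ¬Has c a p → ¬Has c b q → p ≠ q → ¬R c p q a b → Has c v p → ¬Has c v q →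
      TypeB c a b v := by
    intro a b h hci p q hp hq hpq hg hvp hvq
    refine h.typeB Cr hC ?_ hp hq hvq hg
    intro r hr
    by_contra hvr
    have hrq : q ≠ r := by rintro rfl; exact hvq (hci _ hr hq)
    have hrp : p ≠ r := by rintro rfl; exact hvr hvp
    rcases h.obs Cr hp hq hvr hpq hrp hrq with h1 | h1 | h1
    · exact hg h1
    · exact not_R_of_miss hp hr h.av h1
    · exact not_R_of_miss' hvq hvr h.bv h1
  have key2 : ∀ {a b}, Hole3 H c u a b v → (∀ q, ¬Has c a q → ¬Has c b q → Has c v q) →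
      ∀ {p q}, ¬Has c a p → ¬Has c b q → p ≠ q → ¬R c p q a b → Has c v p → Has c v q →
      ∀ {t}, ¬Has c b t → ¬Has c v t → TypeB c a b v := by
    intro a b h hci p q hp hq hpq hg hvp hvq t ht hvt
    have hpt : p ≠ t := by rintro rfl; exact hvt hvp
    have hqt : q ≠ t := by rintro rfl; exact hvt hvq
    refine key h hci hp ht hpt ?_ hvp hvt
    rcases h.obs Cr hp hq hvt hpq hpt hqt with h1 | h1 | h1
    · exact absurd h1 hg
    · intro h2
      exact h.bv (R_unique h.pec h2 h1 h.ab h.av (.inl hp) (.inr ht) (.inr hvt))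
    · exact absurd h1 (not_R_of_miss hq ht h.bv)
  have hci' : ∀ q, ¬Has c b q → ¬Has c a q → Has c v q := fun q h1 h2 => hci q h2 h1
  have hg' : ¬R c q p b a := fun h => hg h.symm.comm
  by_cases hvp : Has c v p <;> by_cases hvq : Has c v q
  · by_cases hb : ∃ t, ¬Has c b t ∧ ¬Has c v t
    · obtain ⟨t, h1, h2⟩ := hb
      exact .inl (key2 h hci hp hq hpq hg hvp hvq h1 h2)
    by_cases ha : ∃ t, ¬Has c a t ∧ ¬Has c v t
    · obtain ⟨t, h1, h2⟩ := ha
      exact .inr (.inl (key2 h.swap_ab hci' hq hp hpq.symm hg' hvq hvp h1 h2))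
    push Not at ha hb
    refine .inr (.inr ⟨ha, hb, ?_⟩)
    have hcard : 1 < (F c a ∩ F c b).card := by
      have h1 : (F c a ∪ F c b).card ≤ (C c v).card := by
        refine Finset.card_le_card fun t ht => ?_
        simp only [Finset.mem_union, mem_F] at ht
        rw [mem_C]
        exact ht.elim (ha t) (hb t)
      have h2 := Finset.card_union_add_card_inter (F c a) (F c b)
      have := h.card_a Cr
      have := h.card_b Cr
      omega
    obtain ⟨s, hs, t, ht, hst⟩ := Finset.one_lt_card.1 hcard
    simp only [Finset.mem_inter, mem_F] at hs ht
    exact ⟨s, t, hst, hs.1, hs.2, ht.1, ht.2⟩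
  · exact .inl (key h hci hp hq hpq hg hvp hvq)
  · exact .inr (.inl (key h.swap_ab hci' hq hp hpq.symm hg' hvq hvp))
  · exfalso
    obtain ⟨r, hr, hrp, hrq⟩ := exists_mem_ne_ne _ (h.card_v Cr) p q
    rw [mem_F] at hr
    rcases h.obs Cr hp hq hr hpq hrp.symm hrq.symm with h1 | h1 | h1
    · exact hg h1
    · exact not_R_of_miss' hvp hr h.av h1
    · exact not_R_of_miss' hvq hr h.bv h1

end Hole3

/-- Every neighbour of a `3`-vertex has degree at least `4`. -/
theorem Crit.four_le_degree (Cr : Crit H K) (hN : ∀ y, H.Adj u y ↔ y = a ∨ y = b ∨ y = v)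
    (hab : a ≠ b) (hav : a ≠ v) (hbv : b ≠ v) : 4 ≤ H.degree v := by
  by_contra hd
  obtain ⟨c, p, q, h, hp, hq, hpq, hg⟩ := Cr.exists_hole3 hN hab hav hbv
  have hCv := card_C_lt_degree h.pec h.uv.symm (col_symm (h.un v))
  have hsub : ∀ x, 3 ≤ (F c x).card → ¬∀ p, ¬Has c x p → Has c v p := by
    intro x hx h1
    have := Finset.card_le_card (s := F c x) (t := C c v) fun t ht => by
      rw [mem_F] at ht; rw [mem_C]; exact h1 t ht
    omega
  rcases h.trichotomy Cr (by omega) hp hq hpq hg with ⟨q, h1, h2, h3⟩ | hB | hB | hC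
  · obtain ⟨S, hS, hS2⟩ := h.common_card Cr h1 h2 h3
    have := Finset.card_le_card (s := S) (t := C c v) fun t ht => mem_C.2 (hS2 t ht).1
    omega
  · exact hsub a (h.card_a Cr) hB.disj
  · exact hsub b (h.card_b Cr) hB.disj
  · exact hsub a (h.card_a Cr) hC.av

end

section

variable {V K : Type*} [DecidableEq V] {H : SimpleGraph V} {c c' : Sym2 V → Option K}
  {α β γ δ p q r s t p₁ p₃ p₄ : K} {x y z w u v a b : V} {o o' : Option K}
  [Fintype V] [Fintype K] [DecidableRel H.Adj]

/-- The number of neighbours of `x` of degree at least `4`. -/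
def nbig (H : SimpleGraph V) [DecidableRel H.Adj] (x : V) : ℕ :=
  ((H.neighborFinset x).filter (4 ≤ H.degree ·)).card

theorem card_le_nbig (P : PEC H c) (S : Finset K)
    (h : ∀ s ∈ S, Has c x s ∧ 4 ≤ H.degree (nb c x s)) : S.card ≤ nbig H x := by
  refine Finset.card_le_card_of_injOn (nb c x) (fun s hs => ?_)
    (nb_injOn.mono fun s hs => (h s hs).1)
  simp only [Finset.coe_filter, Set.mem_ofPred_eq, mem_neighborFinset]
  exact ⟨P.supp (nb_spec (h s hs).1), (h s hs).2⟩

theorem Crit.full (Cr : Crit H K) (P : PEC H c) (hp : Has c x p) (S : Finset K)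
    (hS : ∀ r ∈ S, Has c x r) (hpS : p ∉ S) (hcard : Fintype.card K ≤ S.card + 3)
    (hγ : Has c x γ) : γ = p ∨ γ ∈ S := by
  classical
  rw [← Finset.mem_insert]
  refine mem_of_full P _ ?_ ?_ hγ
  · intro r hr
    rcases Finset.mem_insert.1 hr with rfl | hr
    exacts [hp, hS r hr]
  · rw [Finset.card_insert_of_notMem hpS]
    have := Cr.deg x
    omega

theorem has_nb (h : Has c x p) : Has c (nb c x p) p := ⟨x, col_symm (nb_spec h)⟩

/-- The neighbour reached by the first step of a bichromatic path. -/
theorem has_nb_of_R (P : PEC H c) (hR : R c p r a v) (hav : a ≠ v) (ha : ¬Has c a p)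
    (hv : ¬Has c v r) : Has c v p ∧ Has c (nb c v p) r := by
  obtain ⟨z, hz, hz2⟩ := chase P hR.symm hav.symm hv
  have hvp : Has c v p := ⟨_, hz⟩
  refine ⟨hvp, ?_⟩
  rw [P.proper (nb_spec hvp) hz]
  rcases hz2 with rfl | hz2
  · exact absurd ⟨_, col_symm hz⟩ ha
  · exact hz2

/-- The colours and paths at a `4`-vertex `v` next to a hole. -/
structure Four (c : Sym2 V → Option K) (a b v : V) (p₁ p₃ p₄ : K) : Prop where
  has : ∀ γ, Has c v γ ↔ γ = p₁ ∨ γ = p₃ ∨ γ = p₄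
  miss : ∀ γ, ¬Has c a γ ↔ Has c v γ
  A : InA c a b v p₁
  Y₃ : InY c a b p₃
  Y₄ : InY c a b p₄
  ne₁₃ : p₁ ≠ p₃
  ne₁₄ : p₁ ≠ p₄
  ne₃₄ : p₃ ≠ p₄
  B : TypeB c a b v

namespace Hole3

theorem full_v (h : Hole3 H c u a b v) (Cr : Crit H K) (hC : (C c v).card ≤ 3) (hp : Has c v p)
    (hM : ∀ r, ¬Has c v r → Has c (nb c v p) r) (hγ : Has c (nb c v p) γ) :
    γ = p ∨ ¬Has c v γ := by
  have := Cr.full h.pec (has_nb hp) (F c v) (fun r hr => hM r (mem_F.1 hr)) (by simpa using hp)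
    (by have := card_C_add_card_F c v; omega) hγ
  simpa using this

theorem not_two_A (h : Hole3 H c u a b v) (Cr : Crit H K) (hC : (C c v).card ≤ 3)
    (hB : TypeB c a b v) (hp : InA c a b v p) (hq : InA c a b v q) (hpq : p ≠ q) : False := by
  have hvp := hB.disj p hp.miss
  have hvq := hB.disj q hq.miss
  have hMp : ∀ r, ¬Has c v r → Has c (nb c v p) r := fun r hr =>
    (has_nb_of_R h.pec (hp.R r hr) h.av hp.miss hr).2
  have hMq : ∀ r, ¬Has c v r → Has c (nb c v q) r := fun r hr =>
    (has_nb_of_R h.pec (hq.R r hr) h.av hq.miss hr).2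
  have fp : ∀ γ, Has c (nb c v p) γ → γ = p ∨ ¬Has c v γ := fun γ => h.full_v Cr hC hvp hMp
  have fq : ∀ γ, Has c (nb c v q) γ → γ = q ∨ ¬Has c v γ := fun γ => h.full_v Cr hC hvq hMq
  have hx := nb_spec hvp
  have hy := nb_spec hvq
  have hxp := has_nb hvp
  have hyq := has_nb hvq
  set x := nb c v p
  set y := nb c v q
  have P' : PEC H (swap c v x y p q) := by
    refine swap_pec' h.pec hx hy hpq ?_ ?_ ?_
    · intro h1; rcases fp _ h1 with h1 | h1
      · exact hpq h1.symm
      · exact h1 hvq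
    · intro h1; rcases fq _ h1 with h1 | h1
      · exact hpq h1
      · exact h1 hvp
    · intro s z hsp hsq hs
      refine .inl ⟨fun h1 => ?_, fun h1 => ?_⟩
      · rcases fp _ h1 with h1 | h1
        · exact hsp h1
        · exact h1 ⟨_, hs⟩
      · rcases fq _ h1 with h1 | h1
        · exact hsq h1
        · exact h1 ⟨_, hs⟩
  have h' := h.of P' (swap_none_iff hx hy)
  have has' : ∀ {z γ}, z ≠ x → z ≠ y → (Has (swap c v x y p q) z γ ↔ Has c z γ) :=
    fun h1 h2 => has_swap_of hx hy hpq h1 h2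
  obtain ⟨d, hbd, hvd⟩ := hB.D
  obtain ⟨r, hr, hrd⟩ := exists_mem_ne _ (show 2 ≤ (F c v).card by have := h.card_v Cr; omega) d
  rw [mem_F] at hr
  have hax : a ≠ x := by rintro h1; exact hp.miss (h1 ▸ hxp)
  have hay : a ≠ y := by rintro h1; exact hq.miss (h1 ▸ hyq)
  have hbx : b ≠ x := by rintro h1; exact hbd (h1 ▸ hMp d hvd)
  have hby : b ≠ y := by rintro h1; exact hbd (h1 ▸ hMq d hvd)
  have hvx : v ≠ x := (h.pec.supp hx).ne
  have hvy : v ≠ y := (h.pec.supp hy).ne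
  have hne : ∀ {s}, ¬Has c v s → p ≠ s ∧ s ≠ q := by
    intro s hs; exact ⟨by rintro rfl; exact hs hvp, by rintro rfl; exact hs hvq⟩
  have hvd' : ¬Has (swap c v x y p q) v d := by rwa [has' hvx hvy]
  have hvr' : ¬Has (swap c v x y p q) v r := by rwa [has' hvx hvy]
  have hbd' : ¬Has (swap c v x y p q) b d := by rwa [has' hbx hby]
  have hap' : ¬Has (swap c v x y p q) a p := by rw [has' hax hay]; exact hp.miss
  rcases h'.obs Cr hap' hbd' hvr' (hne hvd).1 (hne hr).1 hrd.symm with h1 | h1 | h1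
  · exact swap_not_R h.pec P' hx hy hpq (hne hvd).2 h.av.symm hax hay hvd hp.miss (hp.R d hvd)
      h.ab.symm hbx (.inr hbd') h1
  · exact swap_not_R h.pec P' hx hy hpq (hne hr).2 h.av.symm hax hay hr hp.miss (hp.R r hr)
      h.av.symm hvx (.inr hvr') h1
  · exact not_R_of_miss' hvd' hvr' h.bv h1

theorem typeC_has (h : Hole3 H c u a b v) (Cr : Crit H K) (hC : TypeC c a b v)
    (hpa : ¬Has c a p) (hpb : ¬Has c b p) (hr : ¬Has c v r) : Has c (nb c v p) r := by
  rcases h.typeC_R Cr hC hr with h1 | h1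
  · exact (has_nb_of_R h.pec (h1 p hpa) h.av hpa hr).2
  · exact (has_nb_of_R h.pec (h1 p hpb) h.bv hpb hr).2

theorem typeC_absurd (h : Hole3 H c u a b v) (Cr : Crit H K) (hC3 : (C c v).card ≤ 3)
    (hC : TypeC c a b v) (hma : ∀ γ, Has c v γ → ¬Has c a γ) (hmb : ∀ γ, Has c v γ → ¬Has c b γ)
    (hp : Has c v p) (hq : Has c v q) (hs : Has c v s) (hpq : p ≠ q) (hps : p ≠ s) (hqs : q ≠ s)
    (hr : ¬Has c v r) (hRa : ∀ p, ¬Has c a p → R c p r a v) : False := by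
  have hMp : ∀ r, ¬Has c v r → Has c (nb c v p) r := fun r hr =>
    h.typeC_has Cr hC (hma p hp) (hmb p hp) hr
  have hMq : ∀ r, ¬Has c v r → Has c (nb c v q) r := fun r hr =>
    h.typeC_has Cr hC (hma q hq) (hmb q hq) hr
  have fp : ∀ γ, Has c (nb c v p) γ → γ = p ∨ ¬Has c v γ := fun γ => h.full_v Cr hC3 hp hMp
  have fq : ∀ γ, Has c (nb c v q) γ → γ = q ∨ ¬Has c v γ := fun γ => h.full_v Cr hC3 hq hMq
  have hx := nb_spec hp
  have hy := nb_spec hq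
  have hxp := has_nb hp
  have hyq := has_nb hq
  set x := nb c v p
  set y := nb c v q
  have P' : PEC H (swap c v x y p q) := by
    refine swap_pec' h.pec hx hy hpq ?_ ?_ ?_
    · intro h1; rcases fp _ h1 with h1 | h1
      · exact hpq h1.symm
      · exact h1 hq
    · intro h1; rcases fq _ h1 with h1 | h1
      · exact hpq h1
      · exact h1 hp
    · intro s z hsp hsq hs
      refine .inl ⟨fun h1 => ?_, fun h1 => ?_⟩
      · rcases fp _ h1 with h1 | h1
        · exact hsp h1
        · exact h1 ⟨_, hs⟩
      · rcases fq _ h1 with h1 | h1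
        · exact hsq h1
        · exact h1 ⟨_, hs⟩
  have h' := h.of P' (swap_none_iff hx hy)
  have has' : ∀ {z γ}, z ≠ x → z ≠ y → (Has (swap c v x y p q) z γ ↔ Has c z γ) :=
    fun h1 h2 => has_swap_of hx hy hpq h1 h2
  have hax : a ≠ x := by rintro h1; exact hma p hp (h1 ▸ hxp)
  have hay : a ≠ y := by rintro h1; exact hma q hq (h1 ▸ hyq)
  have hbx : b ≠ x := by rintro h1; exact hmb p hp (h1 ▸ hxp)
  have hby : b ≠ y := by rintro h1; exact hmb q hq (h1 ▸ hyq)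
  have hvx : v ≠ x := (h.pec.supp hx).ne
  have hvy : v ≠ y := (h.pec.supp hy).ne
  have hrq : r ≠ q := by rintro rfl; exact hr hq
  have hrp : r ≠ p := by rintro rfl; exact hr hp
  have hC' : TypeC (swap c v x y p q) a b v := by
    refine ⟨fun t => ?_, fun t => ?_, ?_⟩
    · rw [has' hax hay, has' hvx hvy]; exact hC.av t
    · rw [has' hbx hby, has' hvx hvy]; exact hC.bv t
    · simp only [has' hax hay, has' hbx hby]; exact hC.ab
  have hvr' : ¬Has (swap c v x y p q) v r := by rwa [has' hvx hvy]
  rcases h'.typeC_R Cr hC' hvr' with h1 | h1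
  · refine swap_not_R h.pec P' hx hy hpq hrq h.av.symm hax hay hr (hma p hp) (hRa p (hma p hp))
      h.av.symm hvx (.inr hvr') (h1 p ?_)
    rw [has' hax hay]; exact hma p hp
  · have h2 := h1 s (by rw [has' hbx hby]; exact hmb s hs)
    have h3 : R c s r b v := by
      rw [swap] at h2
      exact (h2.of_set (by simp [hps]) (by simp [hrp.symm])).of_set (by simp [hqs])
        (by simp [hrq.symm])
    exact h.ab (R_unique h.pec (hRa s (hma s hs)).symm h3.symm h.av.symm h.bv.symm (.inr hr)
      (.inl (hma s hs)) (.inl (hmb s hs)))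

theorem typeB_four (h : Hole3 H c u a b v) (Cr : Crit H K) (hC : (C c v).card ≤ 3)
    (hB : TypeB c a b v) : ∃ p₁ p₃ p₄, Four c a b v p₁ p₃ p₄ := by
  classical
  have hFC : F c a = C c v := Finset.eq_of_subset_of_card_le
    (fun t ht => mem_C.2 (hB.disj t (mem_F.1 ht))) (hC.trans (h.card_a Cr))
  have hm : ∀ γ, ¬Has c a γ ↔ Has c v γ := fun γ => by rw [← mem_F, hFC, mem_C]
  have h3 : (C c v).card = 3 := le_antisymm hC (hFC ▸ h.card_a Cr)
  obtain ⟨x, y, z, hxy, hxz, hyz, hCv⟩ := Finset.card_eq_three.1 h3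
  have hv : ∀ γ, Has c v γ ↔ γ = x ∨ γ = y ∨ γ = z := fun γ => by rw [← mem_C, hCv]; simp
  have two := fun {p q} hp hq hpq => h.not_two_A Cr hC hB (p := p) (q := q) hp hq hpq
  have hx := hB.cases x ((hm x).2 ((hv x).2 (.inl rfl)))
  have hy := hB.cases y ((hm y).2 ((hv y).2 (.inr (.inl rfl))))
  have hz := hB.cases z ((hm z).2 ((hv z).2 (.inr (.inr rfl))))
  obtain ⟨p, hp⟩ := hB.A
  rcases (hv p).1 (hB.disj p hp.miss) with rfl | rfl | rfl
  · exact ⟨p, y, z, hv, hm, hp, hy.resolve_left fun h => two hp h hxy,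
      hz.resolve_left fun h => two hp h hxz, hxy, hxz, hyz, hB⟩
  · exact ⟨p, x, z, fun γ => by rw [hv]; tauto, hm, hp, hx.resolve_left fun h => two h hp hxy,
      hz.resolve_left fun h => two hp h hyz, hxy.symm, hyz, hxz, hB⟩
  · exact ⟨p, x, y, fun γ => by rw [hv]; tauto, hm, hp, hx.resolve_left fun h => two h hp hxz,
      hy.resolve_left fun h => two h hp hyz, hxz.symm, hyz.symm, hxy, hB⟩

theorem four (h : Hole3 H c u a b v) (Cr : Crit H K) (hC : (C c v).card ≤ 3)
    (hp : ¬Has c a p) (hq : ¬Has c b q) (hpq : p ≠ q) (hg : ¬R c p q a b) :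
    ∃ p₁ p₃ p₄, Four c a b v p₁ p₃ p₄ ∨ Four c b a v p₁ p₃ p₄ := by
  classical
  rcases h.trichotomy Cr (by omega) hp hq hpq hg with ⟨q, h1, h2, h3⟩ | hB | hB | hT
  · obtain ⟨S, hS, hS2⟩ := h.common_card Cr h1 h2 h3
    have := Finset.card_le_card (s := S) (t := C c v) fun t ht => mem_C.2 (hS2 t ht).1
    omega
  · obtain ⟨p₁, p₃, p₄, h4⟩ := h.typeB_four Cr hC hB
    exact ⟨p₁, p₃, p₄, .inl h4⟩
  · obtain ⟨p₁, p₃, p₄, h4⟩ := h.swap_ab.typeB_four Cr hC hB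
    exact ⟨p₁, p₃, p₄, .inr h4⟩
  · exfalso
    have hFC : F c a = C c v := Finset.eq_of_subset_of_card_le
      (fun t ht => mem_C.2 (hT.av t (mem_F.1 ht))) (hC.trans (h.card_a Cr))
    have hFC' : F c b = C c v := Finset.eq_of_subset_of_card_le
      (fun t ht => mem_C.2 (hT.bv t (mem_F.1 ht))) (hC.trans (h.card_b Cr))
    have hma : ∀ γ, Has c v γ → ¬Has c a γ := fun γ h => by rwa [← mem_F, hFC, mem_C]
    have hmb : ∀ γ, Has c v γ → ¬Has c b γ := fun γ h => by rwa [← mem_F, hFC', mem_C]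
    obtain ⟨x, hx, y, hy, z, hz, hxy, hxz, hyz⟩ := Finset.two_lt_card.1
      (show 2 < (C c v).card from hFC ▸ h.card_a Cr)
    rw [mem_C] at hx hy hz
    obtain ⟨r, hr⟩ : (F c v).Nonempty := by
      rw [← Finset.card_pos]; have := h.card_v Cr; omega
    rw [mem_F] at hr
    rcases h.typeC_R Cr hT hr with h1 | h1
    · exact h.typeC_absurd Cr hC hT hma hmb hx hy hz hxy hxz hyz hr h1
    · refine h.swap_ab.typeC_absurd Cr hC ⟨hT.bv, hT.av, ?_⟩ hmb hma hx hy hz hxy hxz hyz hr h1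
      obtain ⟨p, q, h1, h2, h3, h4, h5⟩ := hT.ab
      exact ⟨p, q, h1, h3, h2, h5, h4⟩

end Hole3

end

section

variable {V K : Type*} [DecidableEq V] {H : SimpleGraph V} {c c' : Sym2 V → Option K}
  {α β γ δ p q r s t p₁ p₃ p₄ : K} {x y z w u v a b : V} {o o' : Option K}
  [Fintype V] [Fintype K] [DecidableRel H.Adj]

namespace Four

theorem symm (h4 : Four c a b v p₁ p₃ p₄) : Four c a b v p₁ p₄ p₃ :=
  ⟨fun γ => by rw [h4.has]; tauto, h4.miss, h4.A, h4.Y₄, h4.Y₃, h4.ne₁₄, h4.ne₁₃, h4.ne₃₄.symm,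
    h4.B⟩

theorem v₁ (h4 : Four c a b v p₁ p₃ p₄) : Has c v p₁ := (h4.has _).2 (.inl rfl)
theorem v₃ (h4 : Four c a b v p₁ p₃ p₄) : Has c v p₃ := (h4.has _).2 (.inr (.inl rfl))
theorem v₄ (h4 : Four c a b v p₁ p₃ p₄) : Has c v p₄ := (h4.has _).2 (.inr (.inr rfl))

theorem has_b (h4 : Four c a b v p₁ p₃ p₄) (hv : Has c v γ) : Has c b γ :=
  (h4.B.Y _ h4.Y₃).1 γ ((h4.miss γ).2 hv)

theorem card_F_a (h4 : Four c a b v p₁ p₃ p₄) : (F c a).card = 3 := by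
  classical
  have : F c a = {p₁, p₃, p₄} := by ext γ; simp [h4.miss, h4.has]
  rw [this, Finset.card_eq_three]
  exact ⟨_, _, _, h4.ne₁₃, h4.ne₁₄, h4.ne₃₄, rfl⟩

theorem card_C_v (h4 : Four c a b v p₁ p₃ p₄) : (C c v).card = 3 := by
  classical
  have : C c v = {p₁, p₃, p₄} := by ext γ; simp [h4.has]
  rw [this, Finset.card_eq_three]
  exact ⟨_, _, _, h4.ne₁₃, h4.ne₁₄, h4.ne₃₄, rfl⟩

theorem has_nb₃ (h4 : Four c a b v p₁ p₃ p₄) (h : Hole3 H c u a b v) (hq : ¬Has c b q) :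
    Has c (nb c b p₃) q :=
  (has_nb_of_R h.pec (h4.Y₃.R q hq) h.ab h4.Y₃.miss hq).2

theorem big₃ (h4 : Four c a b v p₁ p₃ p₄) (h : Hole3 H c u a b v) (Cr : Crit H K) :
    4 ≤ H.degree (nb c b p₃) := by
  classical
  have h1 := card_le_degree h.pec (x := nb c b p₃) (insert p₃ (F c b)) (by
    intro γ hγ
    rcases Finset.mem_insert.1 hγ with rfl | hγ
    · exact has_nb (h4.has_b h4.v₃)
    · exact h4.has_nb₃ h (mem_F.1 hγ))
  rw [Finset.card_insert_of_notMem (by simpa using h4.has_b h4.v₃)] at h1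
  have := h.card_b Cr
  omega

theorem nbig_a (h4 : Four c a b v p₁ p₃ p₄) (h : Hole3 H c u a b v) (Cr : Crit H K) :
    3 ≤ nbig H a := by
  classical
  refine (h.card_b Cr).trans (card_le_nbig h.pec _ fun q hq => ?_)
  rw [mem_F] at hq
  have hvq : ¬Has c v q := fun h => hq (h4.has_b h)
  obtain ⟨haq, hq3⟩ := has_nb_of_R h.pec (h4.Y₃.R q hq).symm.comm h.ab.symm hq h4.Y₃.miss
  obtain ⟨-, hq4⟩ := has_nb_of_R h.pec (h4.Y₄.R q hq).symm.comm h.ab.symm hq h4.Y₄.miss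
  obtain ⟨-, hq1⟩ := has_nb_of_R h.pec (h4.A.R q hvq).symm.comm h.av.symm hvq h4.A.miss
  refine ⟨haq, ?_⟩
  have h1 := card_le_degree h.pec (x := nb c a q) (insert q {p₁, p₃, p₄}) (by
    intro γ hγ
    simp only [Finset.mem_insert, Finset.mem_singleton] at hγ
    rcases hγ with rfl | rfl | rfl | rfl
    · exact has_nb haq
    · exact hq1
    · exact hq3
    · exact hq4)
  rw [Finset.card_insert_of_notMem, Finset.card_eq_three.2
    ⟨_, _, _, h4.ne₁₃, h4.ne₁₄, h4.ne₃₄, rfl⟩] at h1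
  · exact h1
  · simp only [Finset.mem_insert, Finset.mem_singleton, ← h4.has]
    exact hvq

/-- Exchanging the colours `p₃` and `p₄` at `b` allows the colouring to be completed. -/
theorem swap_absurd (h4 : Four c a b v p₁ p₃ p₄) (h : Hole3 H c u a b v) (Cr : Crit H K)
    (P' : PEC H (swap c b (nb c b p₃) (nb c b p₄) p₃ p₄)) : False := by
  have hx := nb_spec (h4.has_b h4.v₃)
  have hy := nb_spec (h4.has_b h4.v₄)
  have hx3 := has_nb (h4.has_b h4.v₃)
  have hy4 := has_nb (h4.has_b h4.v₄)
  have hxq : ∀ {q}, ¬Has c b q → Has c (nb c b p₃) q := h4.has_nb₃ h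
  have hyq : ∀ {q}, ¬Has c b q → Has c (nb c b p₄) q := h4.symm.has_nb₃ h
  set x := nb c b p₃
  set y := nb c b p₄
  have h' := h.of P' (swap_none_iff hx hy)
  have has' : ∀ {z γ}, z ≠ x → z ≠ y → (Has (swap c b x y p₃ p₄) z γ ↔ Has c z γ) :=
    fun h1 h2 => has_swap_of hx hy h4.ne₃₄ h1 h2
  obtain ⟨q, hq⟩ : (F c b).Nonempty := by
    rw [← Finset.card_pos]; have := h.card_b Cr; omega
  obtain ⟨r, hr, hrq⟩ := exists_mem_ne _ (show 2 ≤ (F c b).card by have := h.card_b Cr; omega) q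
  rw [mem_F] at hq hr
  have hvb : ∀ {q}, ¬Has c b q → ¬Has c v q := fun h1 h2 => h1 (h4.has_b h2)
  have hax : a ≠ x := by rintro h1; exact h4.Y₃.miss (h1 ▸ hx3)
  have hay : a ≠ y := by rintro h1; exact h4.Y₄.miss (h1 ▸ hy4)
  have hbx : b ≠ x := (h.pec.supp hx).ne
  have hby : b ≠ y := (h.pec.supp hy).ne
  have hvx : v ≠ x := by rintro h1; exact hvb hq (h1 ▸ hxq hq)
  have hvy : v ≠ y := by rintro h1; exact hvb hq (h1 ▸ hyq hq)
  have hne : ∀ {s}, ¬Has c b s → p₃ ≠ s ∧ s ≠ p₄ := by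
    intro s hs
    exact ⟨by rintro rfl; exact hs (h4.has_b h4.v₃), by rintro rfl; exact hs (h4.has_b h4.v₄)⟩
  have ha' : ¬Has (swap c b x y p₃ p₄) a p₃ := by rw [has' hax hay]; exact h4.Y₃.miss
  have hbq' : ¬Has (swap c b x y p₃ p₄) b q := by rwa [has' hbx hby]
  have hbr' : ¬Has (swap c b x y p₃ p₄) b r := by rwa [has' hbx hby]
  have hvr' : ¬Has (swap c b x y p₃ p₄) v r := by rw [has' hvx hvy]; exact hvb hr
  rcases h'.obs Cr ha' hbq' hvr' (hne hq).1 (hne hr).1 hrq.symm with h1 | h1 | h1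
  · exact swap_not_R h.pec P' hx hy h4.ne₃₄ (hne hq).2 h.ab.symm hax hay hq h4.Y₃.miss
      (h4.Y₃.R q hq) h.ab.symm hbx (.inr hbq') h1
  · exact swap_not_R h.pec P' hx hy h4.ne₃₄ (hne hr).2 h.ab.symm hax hay hr h4.Y₃.miss
      (h4.Y₃.R r hr) h.av.symm hvx (.inr hvr') h1
  · exact not_R_of_miss hbq' hbr' h.bv h1

/-- The exchange is possible when `p₃` and `p₄` lead to vertices seeing no other colours of `v`. -/
theorem swap_pec (h4 : Four c a b v p₁ p₃ p₄) (h : Hole3 H c u a b v)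
    (f₃ : ∀ γ, Has c (nb c b p₃) γ → γ = p₃ ∨ ¬Has c v γ)
    (f₄ : ∀ γ, Has c (nb c b p₄) γ → γ = p₄ ∨ ¬Has c v γ)
    (ht : ∀ t, Has c b t → ¬Has c v t → ¬Has c (nb c b t) p₃ ∧ ¬Has c (nb c b t) p₄) :
    PEC H (swap c b (nb c b p₃) (nb c b p₄) p₃ p₄) := by
  refine swap_pec' h.pec (nb_spec (h4.has_b h4.v₃)) (nb_spec (h4.has_b h4.v₄)) h4.ne₃₄ ?_ ?_ ?_
  · intro h1; rcases f₃ _ h1 with h1 | h1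
    · exact h4.ne₃₄ h1.symm
    · exact h1 h4.v₄
  · intro h1; rcases f₄ _ h1 with h1 | h1
    · exact h4.ne₃₄ h1
    · exact h1 h4.v₃
  · intro s z h1 h2 hs
    by_cases hvs : Has c v s
    · refine .inl ⟨fun h3 => ?_, fun h3 => ?_⟩
      · exact (f₃ _ h3).elim h1 fun h => h hvs
      · exact (f₄ _ h3).elim h2 fun h => h hvs
    · right
      have hbs : Has c b s := ⟨z, hs⟩
      rw [← h.pec.proper (nb_spec hbs) hs]
      exact ht s hbs hvs

theorem exists_t (h4 : Four c a b v p₁ p₃ p₄) (h : Hole3 H c u a b v) (Cr : Crit H K) :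
    ∃ t, ¬Has c v t ∧ Has c b t := by
  by_contra! hcon
  have hcard : Fintype.card K ≤ (F c b).card + 3 := by
    have h1 := card_C_add_card_F c v
    have h2 := h4.card_C_v
    have h3 : (F c v).card ≤ (F c b).card :=
      Finset.card_le_card fun t ht => mem_F.2 (hcon t (mem_F.1 ht))
    omega
  refine h4.swap_absurd h Cr (h4.swap_pec h ?_ ?_ fun t h1 h2 => absurd h1 (hcon t h2))
  · intro γ hγ
    refine (Cr.full h.pec (has_nb (h4.has_b h4.v₃)) (F c b)
      (fun r hr => h4.has_nb₃ h (mem_F.1 hr)) (by simpa using h4.has_b h4.v₃) hcard hγ).imp_right ?_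
    intro h1 h2
    exact mem_F.1 h1 (h4.has_b h2)
  · intro γ hγ
    refine (Cr.full h.pec (has_nb (h4.has_b h4.v₄)) (F c b)
      (fun r hr => h4.symm.has_nb₃ h (mem_F.1 hr)) (by simpa using h4.has_b h4.v₄)
      hcard hγ).imp_right ?_
    intro h1 h2
    exact mem_F.1 h1 (h4.has_b h2)

theorem five_le (h4 : Four c a b v p₁ p₃ p₄) (h : Hole3 H c u a b v) (Cr : Crit H K) :
    5 ≤ H.degree b := by
  classical
  obtain ⟨t, hvt, hbt⟩ := h4.exists_t h Cr
  have h1 : (insert t (C c v)).card ≤ (C c b).card := by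
    refine Finset.card_le_card fun s hs => ?_
    rcases Finset.mem_insert.1 hs with rfl | hs
    · exact mem_C.2 hbt
    · exact mem_C.2 (h4.has_b (mem_C.1 hs))
  rw [Finset.card_insert_of_notMem (by simpa using hvt), h4.card_C_v] at h1
  have := card_C_lt_degree h.pec h.ub.symm (col_symm (h.un b))
  omega

theorem not_recolor (h4 : Four c a b v p₁ p₃ p₄) (h : Hole3 H c u a b v) (Cr : Crit H K)
    (hq : ¬Has c b q) (hxq : ¬Has c (nb c b p₁) q) :
    ∃ t, ¬Has c v t ∧ Has c b t ∧ Has c (nb c b p₁) t ∧ Has c (nb c b t) q := by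
  have hb₁ := h4.has_b h4.v₁
  have hx := nb_spec hb₁
  have hx1 := has_nb hb₁
  set x := nb c b p₁
  have hax : a ≠ x := by rintro h1; exact h4.A.miss (h1 ▸ hx1)
  have hbx : b ≠ x := (h.pec.supp hx).ne
  have hvb : ∀ {q}, ¬Has c b q → ¬Has c v q := fun h1 h2 => h1 (h4.has_b h2)
  have h1q : p₁ ≠ q := by rintro rfl; exact hq hb₁
  rcases recolor_or h.pec hx hq hxq with P' | ⟨s, hs1, hsq, hxs, hbs, hR⟩
  · exfalso
    have h' := h.of P' (set_none_iff hx)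
    obtain ⟨r, hr, hrq⟩ := exists_mem_ne _ (show 2 ≤ (F c b).card by have := h.card_b Cr; omega) q
    rw [mem_F] at hr
    have h1r : p₁ ≠ r := by rintro rfl; exact hr hb₁
    have h3r : p₃ ≠ r := by rintro rfl; exact hr (h4.has_b h4.v₃)
    have h3q : p₃ ≠ q := by rintro rfl; exact hq (h4.has_b h4.v₃)
    have ha' : ∀ {γ}, Has (set c b x (some q)) a γ ↔ Has c a γ := has_set_of h.ab hax
    have hb1' : ¬Has (set c b x (some q)) b p₁ := by
      rw [has_set h.pec]; simp [hx, h1q.symm]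
    have hbr' : ¬Has (set c b x (some q)) b r := by
      rw [has_set h.pec]; simp [hr, hrq.symm]
    have hvr' : ¬Has (set c b x (some q)) v r := by
      by_cases hvx : v = x
      · rw [hvx, has_set' h.pec, ← hvx]; simp [hrq.symm, hvb hr]
      · rw [has_set_of h.bv.symm hvx]; exact hvb hr
    have ha3' : ¬Has (set c b x (some q)) a p₃ := by rw [ha']; exact h4.Y₃.miss
    have ha1' : ¬Has (set c b x (some q)) a p₁ := by rw [ha']; exact h4.A.miss
    rcases h'.obs Cr ha3' hb1' hvr' h4.ne₁₃.symm h3r h1r with h1 | h1 | h1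
    · exact not_R_of_miss ha3' ha1' h.ab h1
    · have h2 : R c p₃ r a v := h1.of_set (by simp [h3q.symm]) (by simp [hrq.symm])
      exact h.bv (R_unique h.pec (h4.Y₃.R r hr) h2 h.ab h.av (.inl h4.Y₃.miss) (.inr hr)
        (.inr (hvb hr)))
    · exact not_R_of_miss hb1' hbr' h.bv h1
  · have key : ∀ {p}, InY c a b p → s ≠ p := by
      rintro p hp rfl
      exact hax (R_unique h.pec (hp.R q hq).symm hR.comm h.ab.symm hbx (.inr hq) (.inl hp.miss)
        (.inr hxq))
    have hvs : ¬Has c v s := by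
      rw [h4.has]
      rintro (rfl | rfl | rfl)
      · exact hs1 rfl
      · exact key h4.Y₃ rfl
      · exact key h4.Y₄ rfl
    refine ⟨s, hvs, hbs, hxs, ?_⟩
    obtain ⟨z, hz, hz2⟩ := chase h.pec hR.comm hbx hq
    rw [h.pec.proper (nb_spec hbs) hz]
    rcases hz2 with rfl | hz2
    · exact absurd (col_inj hz hx) hs1
    · exact hz2

theorem has_t (h4 : Four c a b v p₁ p₃ p₄) (h : Hole3 H c u a b v) (Cr : Crit H K)
    (hvt : ¬Has c v t) (hbt : Has c b t) (hz : ¬Has c b r) (hzt : ¬Has c (nb c b t) r)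
    (hfull : ∀ s, Has c (nb c b t) s → s = t ∨ ¬Has c b s) : Has c (nb c b p₃) t := by
  have hx := nb_spec hbt
  have hxt := has_nb hbt
  set x := nb c b t
  have hbx : b ≠ x := (h.pec.supp hx).ne
  have hvb : ∀ {q}, ¬Has c b q → ¬Has c v q := fun h1 h2 => h1 (h4.has_b h2)
  rcases recolor_or h.pec hx hz hzt with P' | ⟨s, hs1, -, hxs, hbs, -⟩
  swap
  · exact absurd hbs ((hfull s hxs).resolve_left hs1)
  have h' := h.of P' (set_none_iff hx)
  obtain ⟨q, hq, hqr⟩ := exists_mem_ne _ (show 2 ≤ (F c b).card by have := h.card_b Cr; omega) r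
  rw [mem_F] at hq
  have h3r : p₃ ≠ r := by rintro rfl; exact hz (h4.has_b h4.v₃)
  have h3t : p₃ ≠ t := by rintro rfl; exact hvt h4.v₃
  have h3q : p₃ ≠ q := by rintro rfl; exact hq (h4.has_b h4.v₃)
  have hrt : r ≠ t := by rintro rfl; exact hz hbt
  have htq : t ≠ q := by rintro rfl; exact hq hbt
  have hother : ∀ {w γ}, γ ≠ r → ¬Has c w γ → ¬Has (set c b x (some r)) w γ := by
    intro w γ h1 h2
    by_cases hwb : w = b
    · rw [hwb] at h2 ⊢; rw [has_set h.pec]; simp [h1.symm, h2]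
    · by_cases hwx : w = x
      · rw [hwx] at h2 ⊢; rw [has_set' h.pec]; simp [h1.symm, h2]
      · rwa [has_set_of hwb hwx]
  have ha3' := hother h3r h4.Y₃.miss
  have hbt' : ¬Has (set c b x (some r)) b t := by
    rw [has_set h.pec]; simp [hx, hrt]
  have hbq' := hother hqr hq
  have hvq' := hother hqr (hvb hq)
  rcases h'.obs Cr ha3' hbt' hvq' h3t h3q htq with h1 | h1 | h1
  · obtain ⟨z, hz1, hz2⟩ := chase P' h1.symm h.ab.symm hbt'
    have hz3 : c s(b, z) = some p₃ := by
      rw [set_apply] at hz1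
      split_ifs at hz1 with h2
      · exact absurd (Option.some.inj hz1).symm h3r
      · exact hz1
    rw [h.pec.proper (nb_spec (h4.has_b h4.v₃)) hz3]
    rcases hz2 with rfl | hz2
    · exact absurd ⟨_, col_symm hz1⟩ ha3'
    · by_contra h2
      exact hother hrt.symm h2 hz2
  · exfalso
    have h2 : R c p₃ q a v := h1.of_set (by simp [h3r.symm]) (by simp [hqr.symm])
    exact h.bv (R_unique h.pec (h4.Y₃.R q hq) h2 h.ab h.av (.inl h4.Y₃.miss) (.inr hq)
        (.inr (hvb hq)))
  · exact absurd h1 (not_R_of_miss hbt' hbq' h.bv)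

theorem five_absurd (h4 : Four c a b v p₁ p₃ p₄) (h : Hole3 H c u a b v) (Cr : Crit H K)
    (hd : H.degree b = 5) (hvt : ¬Has c v t) (hbt : Has c b t)
    (s₁ : H.degree (nb c b p₁) ≤ 3) (sₜ : H.degree (nb c b t) ≤ 3) : False := by
  classical
  have hCb := card_C_lt_degree h.pec h.ub.symm (col_symm (h.un b))
  have hb : ∀ γ, Has c b γ → ¬Has c v γ → γ = t := by
    intro γ h1 h2
    have h3 : insert t (C c v) = C c b := by
      refine Finset.eq_of_subset_of_card_le (fun s hs => ?_) ?_
      · rcases Finset.mem_insert.1 hs with rfl | hs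
        · exact mem_C.2 hbt
        · exact mem_C.2 (h4.has_b (mem_C.1 hs))
      · rw [Finset.card_insert_of_notMem (by simpa using hvt), h4.card_C_v]; omega
    have h4 := mem_C.2 h1
    rw [← h3] at h4
    simpa [h2] using h4
  have hrec : ∀ q, ¬Has c b q → ¬Has c (nb c b p₁) q →
      Has c (nb c b p₁) t ∧ Has c (nb c b t) q := by
    intro q h1 h2
    obtain ⟨t', ht1, ht2, ht3⟩ := h4.not_recolor h Cr h1 h2
    rw [hb t' ht2 ht1] at ht3
    exact ht3
  have hb₁ := h4.has_b h4.v₁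
  have hcard := h.card_b Cr
  have h1t : p₁ ≠ t := by rintro rfl; exact hvt h4.v₁
  have hx₁t : Has c (nb c b p₁) t := by
    by_contra hcon
    have h1 := card_le_degree h.pec (x := nb c b p₁) (insert p₁ (F c b)) (by
      intro γ hγ
      rcases Finset.mem_insert.1 hγ with rfl | hγ
      · exact has_nb hb₁
      · by_contra h2
        exact hcon (hrec γ (mem_F.1 hγ) h2).1)
    rw [Finset.card_insert_of_notMem (by simpa using hb₁)] at h1
    omega
  have c1 := card_le_degree h.pec (x := nb c b p₁)
    (insert p₁ (insert t ((F c b).filter (Has c (nb c b p₁))))) (by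
      intro γ hγ
      simp only [Finset.mem_insert, Finset.mem_filter] at hγ
      rcases hγ with rfl | rfl | hγ
      exacts [has_nb hb₁, hx₁t, hγ.2])
  rw [Finset.card_insert_of_notMem (by simp [h1t, hb₁]),
    Finset.card_insert_of_notMem (by simp [hbt])] at c1
  have hS : ∀ γ ∈ insert t ((F c b).filter (¬Has c (nb c b p₁) ·)), Has c (nb c b t) γ := by
    intro γ hγ
    simp only [Finset.mem_insert, Finset.mem_filter, mem_F] at hγ
    rcases hγ with rfl | hγ
    exacts [has_nb hbt, (hrec γ hγ.1 hγ.2).2]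
  have c2 := card_le_degree h.pec _ hS
  have hcS : (insert t ((F c b).filter (¬Has c (nb c b p₁) ·))).card =
      ((F c b).filter (¬Has c (nb c b p₁) ·)).card + 1 :=
    Finset.card_insert_of_notMem (by simp [hbt])
  have c3 := Finset.card_filter_add_card_filter_not (s := F c b) (Has c (nb c b p₁))
  have hf : ∀ γ, Has c (nb c b t) γ → γ = t ∨ (¬Has c b γ ∧ ¬Has c (nb c b p₁) γ) := by
    intro γ hγ
    have := mem_of_full h.pec _ hS (by omega) hγ
    simpa using this
  obtain ⟨z, hz⟩ : ((F c b).filter (Has c (nb c b p₁))).Nonempty := by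
    rw [← Finset.card_pos]; omega
  simp only [Finset.mem_filter, mem_F] at hz
  have hzt : ¬Has c (nb c b t) z := by
    intro h1
    rcases hf z h1 with rfl | h2
    · exact hz.1 hbt
    · exact h2.2 hz.2
  have t₃ := h4.has_t h Cr hvt hbt hz.1 hzt fun s hs => (hf s hs).imp_right (·.1)
  have t₄ := h4.symm.has_t h Cr hvt hbt hz.1 hzt fun s hs => (hf s hs).imp_right (·.1)
  have hcv : Fintype.card K ≤ (F c v).card + 3 := by
    have := card_C_add_card_F c v; have := h4.card_C_v; omega
  refine h4.swap_absurd h Cr (h4.swap_pec h ?_ ?_ ?_)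
  · intro γ hγ
    have := Cr.full h.pec (has_nb (h4.has_b h4.v₃)) (F c v) (fun r hr => ?_)
      (by simpa using h4.v₃) hcv hγ
    · simpa using this
    · by_cases hbr : Has c b r
      · rw [hb r hbr (mem_F.1 hr)]; exact t₃
      · exact h4.has_nb₃ h hbr
  · intro γ hγ
    have := Cr.full h.pec (has_nb (h4.has_b h4.v₄)) (F c v) (fun r hr => ?_)
      (by simpa using h4.v₄) hcv hγ
    · simpa using this
    · by_cases hbr : Has c b r
      · rw [hb r hbr (mem_F.1 hr)]; exact t₄
      · exact h4.symm.has_nb₃ h hbr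
  · intro s h1 h2
    rw [hb s h1 h2]
    refine ⟨fun h3 => ?_, fun h3 => ?_⟩
    · rcases hf _ h3 with rfl | h3
      · exact hvt h4.v₃
      · exact h3.1 (h4.has_b h4.v₃)
    · rcases hf _ h3 with rfl | h3
      · exact hvt h4.v₄
      · exact h3.1 (h4.has_b h4.v₄)

theorem nbig_b (h4 : Four c a b v p₁ p₃ p₄) (h : Hole3 H c u a b v) (Cr : Crit H K) :
    2 ≤ nbig H b ∧ (H.degree b = 5 → 3 ≤ nbig H b) := by
  classical
  have b3 := h4.big₃ h Cr
  have b4 := h4.symm.big₃ h Cr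
  have key : ∀ s, s ≠ p₃ → s ≠ p₄ → Has c b s → 4 ≤ H.degree (nb c b s) → 3 ≤ nbig H b := by
    intro s h1 h2 h3 h5
    rw [← Finset.card_eq_three.2 ⟨s, p₃, p₄, h1, h2, h4.ne₃₄, rfl⟩]
    refine card_le_nbig h.pec _ fun r hr => ?_
    simp only [Finset.mem_insert, Finset.mem_singleton] at hr
    rcases hr with rfl | rfl | rfl
    exacts [⟨h3, h5⟩, ⟨h4.has_b h4.v₃, b3⟩, ⟨h4.has_b h4.v₄, b4⟩]
  constructor
  · rw [← Finset.card_pair h4.ne₃₄]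
    refine card_le_nbig h.pec _ fun r hr => ?_
    simp only [Finset.mem_insert, Finset.mem_singleton] at hr
    rcases hr with rfl | rfl
    exacts [⟨h4.has_b h4.v₃, b3⟩, ⟨h4.has_b h4.v₄, b4⟩]
  · intro hd
    obtain ⟨t, hvt, hbt⟩ := h4.exists_t h Cr
    by_contra hcon
    refine h4.five_absurd h Cr hd hvt hbt ?_ ?_
    · by_contra h1
      exact hcon (key p₁ h4.ne₁₃ h4.ne₁₄ (h4.has_b h4.v₁) (by omega))
    · by_contra h1
      refine hcon (key t ?_ ?_ hbt (by omega))
      · rintro rfl; exact hvt h4.v₃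
      · rintro rfl; exact hvt h4.v₄

theorem concl (h4 : Four c a b v p₁ p₃ p₄) (h : Hole3 H c u a b v) (Cr : Crit H K) :
    (5 ≤ H.degree a ∧ 3 ≤ nbig H a) ∧
      (5 ≤ H.degree b ∧ 2 ≤ nbig H b ∧ (H.degree b = 5 → 3 ≤ nbig H b)) := by
  have h5 := h4.five_le h Cr
  refine ⟨⟨?_, h4.nbig_a h Cr⟩, h5, h4.nbig_b h Cr⟩
  have h1 := Cr.deg b
  have h2 := (Cr.card_F h.toHole h.ua.symm).1
  have h3 := h4.card_F_a
  omega

end Four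

/-- The other neighbours of a `3`-vertex with a neighbour of degree `4`. -/
theorem Crit.four_nbr (Cr : Crit H K) (hN : ∀ y, H.Adj u y ↔ y = a ∨ y = b ∨ y = v)
    (hab : a ≠ b) (hav : a ≠ v) (hbv : b ≠ v) (hd : H.degree v = 4) :
    5 ≤ H.degree a ∧ 2 ≤ nbig H a ∧ (H.degree a = 5 → 3 ≤ nbig H a) := by
  obtain ⟨c, p, q, h, hp, hq, hpq, hg⟩ := Cr.exists_hole3 hN hab hav hbv
  have hCv := card_C_lt_degree h.pec h.uv.symm (col_symm (h.un v))
  obtain ⟨p₁, p₃, p₄, h4 | h4⟩ := h.four Cr (by omega) hp hq hpq hg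
  · obtain ⟨⟨h1, h2⟩, -⟩ := h4.concl h Cr
    exact ⟨h1, by omega, fun _ => h2⟩
  · exact (h4.concl h.swap_ab Cr).2

end

section

variable {V K : Type*} [DecidableEq V] {H : SimpleGraph V} {c c' : Sym2 V → Option K}
  {α β γ δ p q r s t p₁ p₃ p₄ : K} {x y z w u v a b : V} {o o' : Option K}
  [Fintype V] [Fintype K] [DecidableRel H.Adj]

namespace Hole3

theorem inA_has (h : Hole3 H c u a b v) (hA : InA c a b v p) (hr : ¬Has c v r) :
    Has c (nb c v p) r :=
  (has_nb_of_R h.pec (hA.R r hr) h.av hA.miss hr).2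

theorem inA_big (h : Hole3 H c u a b v) (Cr : Crit H K) (hB : TypeB c a b v)
    (hA : InA c a b v p) : 4 ≤ H.degree (nb c v p) := by
  classical
  have hvp := hB.disj p hA.miss
  have h1 := card_le_degree h.pec (x := nb c v p) (insert p (F c v)) (by
    intro γ hγ
    rcases Finset.mem_insert.1 hγ with rfl | hγ
    · exact has_nb hvp
    · exact h.inA_has hA (mem_F.1 hγ))
  rw [Finset.card_insert_of_notMem (by simpa using hvp)] at h1
  have := h.card_v Cr
  omega

/-- Every colour missing at `v` and at its `t`-neighbour is blocked through another colour. -/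
theorem served (h : Hole3 H c u a b v) (Cr : Crit H K) (hB : TypeB c a b v)
    (hA : InA c a b v p) (hY : InY c a b t) (htp : t ≠ p) (hr : ¬Has c v r)
    (hxr : ¬Has c (nb c v t) r) :
    ∃ s, s ≠ t ∧ s ≠ p ∧ Has c v s ∧ Has c (nb c v t) s ∧ Has c (nb c v s) r ∧
      R c s r v (nb c v t) := by
  have ht := hY.miss
  have hvt := hB.disj t ht
  have hvp := hB.disj p hA.miss
  have hx := nb_spec hvt
  have hxt := has_nb hvt
  set x := nb c v t
  have hax : a ≠ x := by rintro h1; exact ht (h1 ▸ hxt)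
  have hvx : v ≠ x := (h.pec.supp hx).ne
  have hne : ∀ {s r}, Has c v s → ¬Has c v r → s ≠ r := by rintro s r h1 h2 rfl; exact h2 h1
  rcases recolor_or h.pec hx hr hxr with P' | ⟨s, hst, hsr, hxs, hvs, hR⟩
  · exfalso
    have h' := h.of P' (set_none_iff hx)
    obtain ⟨q, hqr, hbq, hvq⟩ := (hB.Y t hY).2 r
    have hother : ∀ {w γ}, γ ≠ r → ¬Has c w γ → ¬Has (set c v x (some r)) w γ := by
      intro w γ h1 h2
      by_cases hwb : w = v
      · rw [hwb] at h2 ⊢; rw [has_set h.pec]; simp [h1.symm, h2]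
      · by_cases hwx : w = x
        · rw [hwx] at h2 ⊢; rw [has_set' h.pec]; simp [h1.symm, h2]
        · rwa [has_set_of hwb hwx]
    have hap' := hother (hne hvp hr) hA.miss
    have hat' := hother (hne hvt hr) ht
    have hbq' := hother hqr hbq
    have hvq' := hother hqr hvq
    have hvt' : ¬Has (set c v x (some r)) v t := by
      rw [has_set h.pec]; simp [hx, (hne hvt hr).symm]
    rcases h'.obs Cr hap' hbq' hvt' (hne hvp hvq) htp.symm (hne hvt hvq).symm with h1 | h1 | h1
    · exact hA.not_R q hbq hvq (h1.of_set (by simp [(hne hvp hr).symm]) (by simp [hqr.symm]))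
    · exact not_R_of_miss hap' hat' h.av h1
    · exact not_R_of_miss' hvq' hvt' h.bv h1
  · refine ⟨s, hst, ?_, hvs, hxs, ?_, hR.comm⟩
    · rintro rfl
      exact hax (R_unique h.pec (hA.R r hr).symm hR.comm h.av.symm hvx (.inr hr) (.inl hA.miss)
        (.inr hxr))
    · obtain ⟨z, hz, hz2⟩ := chase h.pec hR.comm hvx hr
      rw [h.pec.proper (nb_spec hvs) hz]
      rcases hz2 with rfl | hz2
      · exact absurd (col_inj hz hx) hst
      · exact hz2

/-- A unique blocking colour cannot serve two small neighbours of `v`. -/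
theorem one_inA_absurd (h : Hole3 H c u a b v) (Cr : Crit H K) (hC : (C c v).card ≤ 4)
    (hB : TypeB c a b v) (hA : InA c a b v p) (h₃ : InY c a b p₃) (h₄ : InY c a b p₄)
    (n₃ : p₃ ≠ p) (n₄ : p₄ ≠ p) (n₃₄ : p₃ ≠ p₄)
    (hsmall : ∀ s, Has c v s → s ≠ p → H.degree (nb c v s) ≤ 3) : False := by
  classical
  have hv := hB.disj p hA.miss
  have hv₃ := hB.disj p₃ h₃.miss
  have hv₄ := hB.disj p₄ h₄.miss
  have hM := h.card_v Cr
  obtain ⟨g, hg⟩ : ∃ g, ∀ s, Has c v s → s ≠ p → s ≠ p₃ → s ≠ p₄ → s = g := by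
    have h1 : ((((C c v).erase p).erase p₃).erase p₄).card ≤ 1 := by
      rw [Finset.card_erase_of_mem (by simp [hv₄, n₃₄.symm, n₄]),
        Finset.card_erase_of_mem (by simp [hv₃, n₃]), Finset.card_erase_of_mem (by simp [hv])]
      omega
    have : Nonempty K := ⟨p⟩
    obtain ⟨g, hg⟩ := Finset.card_le_one_iff_subset_singleton.1 h1
    refine ⟨g, fun s h1 h2 h3 h4 => ?_⟩
    simpa using hg (show s ∈ _ by simp [h1, h2, h3, h4])
  let A : K → Finset K := fun t => (F c v).filter (Has c (nb c v t))
  let G : K → Finset K := fun t => (F c v).filter fun r => (Has c v g ∧ g ≠ p ∧ g ≠ p₃ ∧ g ≠ p₄) ∧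
    Has c (nb c v t) g ∧ Has c (nb c v g) r ∧ ¬Has c (nb c v t) r ∧ R c g r v (nb c v t)
  have hsA : ∀ t, InY c a b t → t ≠ p → ∀ s, s ≠ t → Has c v s → Has c (nb c v t) s →
      (A t).card ≤ 1 ∧ ∀ s', s' ≠ s → s' ≠ t → Has c v s' → Has c (nb c v t) s' →
        (A t).card = 0 := by
    intro t hY htp s h1 h2 h3
    have hvt := hB.disj t hY.miss
    have htA : t ∉ A t := by simp [A, hvt]
    have hdeg := hsmall t hvt htp
    constructor
    · have h4 := card_le_degree h.pec (x := nb c v t) (insert t (insert s (A t))) (by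
        intro γ hγ
        simp only [Finset.mem_insert, A, Finset.mem_filter] at hγ
        rcases hγ with rfl | rfl | hγ
        exacts [has_nb hvt, h3, hγ.2])
      rw [Finset.card_insert_of_notMem (by simp [h1.symm, htA]),
        Finset.card_insert_of_notMem (by simp [A, h2])] at h4
      omega
    · intro s' h5 h6 h7 h8
      have h4 := card_le_degree h.pec (x := nb c v t) (insert t (insert s' (insert s (A t)))) (by
        intro γ hγ
        simp only [Finset.mem_insert, A, Finset.mem_filter] at hγ
        rcases hγ with rfl | rfl | rfl | hγ
        exacts [has_nb hvt, h8, h3, hγ.2])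
      rw [Finset.card_insert_of_notMem (by simp [h1.symm, h6.symm, htA]),
        Finset.card_insert_of_notMem (by simp [A, h7, h5]),
        Finset.card_insert_of_notMem (by simp [A, h2])] at h4
      omega
  have hA1 : ∀ t, InY c a b t → t ≠ p → (A t).card ≤ 1 := by
    intro t hY htp
    have hvt := hB.disj t hY.miss
    have hdeg := hsmall t hvt htp
    by_contra hcon
    have h4 := card_le_degree h.pec (x := nb c v t) (insert t (F c v)) (by
      intro γ hγ
      simp only [Finset.mem_insert, mem_F] at hγ
      rcases hγ with rfl | hγ
      · exact has_nb hvt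
      · by_contra h2
        obtain ⟨s, h3, -, h4, h5, -⟩ := h.served Cr hB hA hY htp hγ h2
        exact hcon (hsA t hY htp s h3 h4 h5).1)
    rw [Finset.card_insert_of_notMem (by simpa using hvt)] at h4
    omega
  have main : ∀ t t', InY c a b t → t ≠ p → InY c a b t' → t' ≠ p →
      (t = p₃ ∧ t' = p₄ ∨ t = p₄ ∧ t' = p₃) →
      (F c v).card ≤ (A t).card + (G t).card ∨
        (A t).card = 0 ∧ (F c v).card ≤ (A t').card + (G t).card := by
    intro t t' hY htp hY' htp' htt
    have hvt := hB.disj t hY.miss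
    have hvt' := hB.disj t' hY'.miss
    have hcov : ∀ r, ¬Has c v r →
        r ∈ A t ∨ r ∈ G t ∨ (t' ≠ t ∧ Has c (nb c v t) t' ∧ r ∈ A t') := by
      intro r hr
      by_cases hx : Has c (nb c v t) r
      · exact .inl (by simp [A, hr, hx])
      obtain ⟨s, h1, h2, h3, h4, h5, h6⟩ := h.served Cr hB hA hY htp hr hx
      by_cases hst : s = t'
      · subst hst
        exact .inr (.inr ⟨h1, h4, by simp [A, hr, h5]⟩)
      · have : s = g := by
          rcases htt with ⟨rfl, rfl⟩ | ⟨rfl, rfl⟩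
          exacts [hg s h3 h2 h1 hst, hg s h3 h2 hst h1]
        subst this
        refine .inr (.inl ?_)
        simp only [G, Finset.mem_filter, mem_F]
        refine ⟨hr, ⟨h3, h2, ?_⟩, h4, h5, hx, h6⟩
        rcases htt with ⟨rfl, rfl⟩ | ⟨rfl, rfl⟩
        exacts [⟨h1, hst⟩, ⟨hst, h1⟩]
    by_cases ht' : t' ≠ t ∧ Has c (nb c v t) t'
    · have h1 : (F c v).card ≤ (A t).card + ((G t).card + (A t').card) := by
        refine (Finset.card_le_card (t := A t ∪ (G t ∪ A t')) fun r hr => ?_).trans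
          ((Finset.card_union_le _ _).trans (Nat.add_le_add_left (Finset.card_union_le _ _) _))
        simp only [Finset.mem_union]
        exact (hcov r (mem_F.1 hr)).imp_right (Or.imp_right (·.2.2))
      have h2 := hA1 t hY htp
      have h3 := hA1 t' hY' htp'
      obtain ⟨r, hr⟩ : (G t).Nonempty := by rw [← Finset.card_pos]; omega
      simp only [G, Finset.mem_filter] at hr
      have hgt : g ≠ t ∧ g ≠ t' := by
        rcases htt with ⟨rfl, rfl⟩ | ⟨rfl, rfl⟩
        exacts [hr.2.1.2.2, hr.2.1.2.2.symm]
      have := (hsA t hY htp t' ht'.1 hvt' ht'.2).2 g hgt.2 hgt.1 hr.2.1.1 hr.2.2.1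
      right
      omega
    · left
      refine (Finset.card_le_card (t := A t ∪ G t) fun r hr => ?_).trans (Finset.card_union_le _ _)
      simp only [Finset.mem_union]
      rcases hcov r (mem_F.1 hr) with h1 | h1 | h1
      exacts [.inl h1, .inr h1, absurd ⟨h1.1, h1.2.1⟩ ht']
  have m3 := main p₃ p₄ h₃ n₃ h₄ n₄ (.inl ⟨rfl, rfl⟩)
  have m4 := main p₄ p₃ h₄ n₄ h₃ n₃ (.inr ⟨rfl, rfl⟩)
  have k3 := hA1 _ h₃ n₃
  have k4 := hA1 _ h₄ n₄
  have hGG : (G p₃).card + (G p₄).card ≤ 2 := by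
    rw [← Finset.card_union_of_disjoint]
    · by_contra! hcon
      obtain ⟨r, hr⟩ : (G p₃ ∪ G p₄).Nonempty := by rw [← Finset.card_pos]; omega
      have hgv : Has c v g ∧ g ≠ p := by
        simp only [G, Finset.mem_union, Finset.mem_filter] at hr
        tauto
      have h4 := card_le_degree h.pec (x := nb c v g) (insert g (G p₃ ∪ G p₄)) (by
        intro γ hγ
        simp only [Finset.mem_insert, G, Finset.mem_union, Finset.mem_filter] at hγ
        rcases hγ with rfl | hγ
        · exact has_nb hgv.1
        · tauto)
      rw [Finset.card_insert_of_notMem (by simp [G, hgv.1])] at h4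
      have := hsmall g hgv.1 hgv.2
      omega
    · rw [Finset.disjoint_left]
      intro r h1 h2
      simp only [G, Finset.mem_filter, mem_F] at h1 h2
      have e3 := nb_spec hv₃
      have e4 := nb_spec hv₄
      have := R_unique h.pec h1.2.2.2.2.2 h2.2.2.2.2.2 (h.pec.supp e3).ne (h.pec.supp e4).ne
        (.inr h1.1) (.inr h1.2.2.2.2.1) (.inr h2.2.2.2.2.1)
      rw [this] at e3
      rw [e3] at e4
      exact n₃₄ (Option.some.inj e4)
  omega

theorem two_nbig_of_typeB (h : Hole3 H c u a b v) (Cr : Crit H K) (hC : (C c v).card ≤ 4)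
    (hB : TypeB c a b v) : 2 ≤ nbig H v := by
  classical
  obtain ⟨p, hA⟩ := hB.A
  have hvp := hB.disj p hA.miss
  have key : ∀ s, s ≠ p → Has c v s → 4 ≤ H.degree (nb c v s) → 2 ≤ nbig H v := by
    intro s h1 h2 h3
    rw [← Finset.card_pair h1]
    refine card_le_nbig h.pec _ fun r hr => ?_
    simp only [Finset.mem_insert, Finset.mem_singleton] at hr
    rcases hr with rfl | rfl
    exacts [⟨h2, h3⟩, ⟨hvp, h.inA_big Cr hB hA⟩]
  by_contra hcon
  have hY : ∀ y, ¬Has c a y → y ≠ p → InY c a b y := by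
    intro y h1 h2
    refine (hB.cases y h1).resolve_left fun h3 => hcon (key y h2 (hB.disj y h1) ?_)
    exact h.inA_big Cr hB h3
  have h3 := h.card_a Cr
  obtain ⟨p₃, h₃, n₃⟩ := exists_mem_ne _ (show 2 ≤ (F c a).card by omega) p
  obtain ⟨p₄, h₄, n₄, n₃₄⟩ := exists_mem_ne_ne _ h3 p p₃
  rw [mem_F] at h₃ h₄
  refine h.one_inA_absurd Cr hC hB hA (hY _ h₃ n₃) (hY _ h₄ n₄) n₃ n₄ n₃₄.symm fun s h1 h2 => ?_
  by_contra h4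
  exact hcon (key s h2 h1 (by omega))

end Hole3

/-- A `5`-vertex with a neighbour of degree `3` has two neighbours of degree at least `4`. -/
theorem Crit.two_nbig (Cr : Crit H K) (hN : ∀ y, H.Adj u y ↔ y = a ∨ y = b ∨ y = v)
    (hab : a ≠ b) (hav : a ≠ v) (hbv : b ≠ v) (hd : H.degree v = 5) : 2 ≤ nbig H v := by
  classical
  obtain ⟨c, p, q, h, hp, hq, hpq, hg⟩ := Cr.exists_hole3 hN hab hav hbv
  have hC := card_C_lt_degree h.pec h.uv.symm (col_symm (h.un v))
  rcases h.trichotomy Cr (by omega) hp hq hpq hg with ⟨q, h1, h2, h3⟩ | hB | hB | hT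
  · obtain ⟨S, hS, hS2⟩ := h.common_card Cr h1 h2 h3
    have ha := Cr.four_le_degree (u := u) (a := b) (b := v) (v := a)
      (fun y => by rw [hN]; tauto) hbv hab.symm hav.symm
    have hb := Cr.four_le_degree (u := u) (a := a) (b := v) (v := b)
      (fun y => by rw [hN]; tauto) hav hab hbv.symm
    have := card_le_nbig h.pec S fun s hs => ⟨(hS2 s hs).1, (hS2 s hs).2 ha hb⟩
    omega
  · exact h.two_nbig_of_typeB Cr (by omega) hB
  · exact h.swap_ab.two_nbig_of_typeB Cr (by omega) hB
  · obtain ⟨p, q, hpq, hap, hbp, haq, hbq⟩ := hT.ab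
    have key : ∀ s, ¬Has c a s → ¬Has c b s → 4 ≤ H.degree (nb c v s) := by
      intro s h1 h2
      have hvs := hT.av s h1
      have h3 := card_le_degree h.pec (x := nb c v s) (insert s (F c v)) (by
        intro γ hγ
        rcases Finset.mem_insert.1 hγ with rfl | hγ
        · exact has_nb hvs
        · exact h.typeC_has Cr hT h1 h2 (mem_F.1 hγ))
      rw [Finset.card_insert_of_notMem (by simpa using hvs)] at h3
      have := h.card_v Cr
      omega
    rw [← Finset.card_pair hpq]
    refine card_le_nbig h.pec _ fun r hr => ?_
    simp only [Finset.mem_insert, Finset.mem_singleton] at hr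
    rcases hr with rfl | rfl
    exacts [⟨hT.av _ hap, key _ hap hbp⟩, ⟨hT.av _ haq, key _ haq hbq⟩]

end

section

variable {V K : Type*} [DecidableEq V] {H : SimpleGraph V} {c c' : Sym2 V → Option K}
  {α β γ δ p q r s t i j : K} {x y z w u v a b : V} {o o' : Option K}
  [Fintype V] [Fintype K] [DecidableRel H.Adj]

theorem Crit.degree_ne_one (Cr : Crit H K) (u : V) : H.degree u ≠ 1 := by
  intro hu
  obtain ⟨v, huv, huniq⟩ := degree_eq_one_iff_existsUnique_adj.1 hu
  obtain ⟨c, P, hn, hall⟩ := Cr.col u v huv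
  have hu : ∀ α, ¬Has c u α := by
    rintro α ⟨y, hy⟩
    rw [huniq y (P.supp hy), hn] at hy
    simp at hy
  obtain ⟨r, hr⟩ : (F c v).Nonempty := by
    rw [← Finset.card_pos]
    have h1 := card_C_lt_degree P huv.symm (col_symm hn)
    have h2 := card_C_add_card_F c v
    have h3 := Cr.deg v
    omega
  rw [mem_F] at hr
  obtain ⟨x, y, hxy, h1⟩ := Cr.uncol _ (P.color huv hn (hu r) hr fun β _ h => absurd h (hu β))
  rw [set_apply] at h1
  split_ifs at h1 with h2
  exact hall x y hxy h2 h1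

/-- The number of neighbours of `x` of degree `d`. -/
def nDeg (H : SimpleGraph V) [DecidableRel H.Adj] (d : ℕ) (x : V) : ℕ :=
  ((H.neighborFinset x).filter (H.degree · = d)).card

namespace Hole2

theorem card_v (h : Hole2 H c u v w) (Cr : Crit H K) : 3 ≤ (F c v).card :=
  (Cr.card_F h.toHole h.uv.symm).2

theorem has (h : Hole2 H c u v w) (Cr : Crit H K) (hq : ¬Has c w q) : Has c v q := by
  obtain ⟨r, hr, hrq⟩ := exists_mem_ne _ (show 2 ≤ (F c v).card by have := h.card_v Cr; omega) q
  rw [mem_F] at hr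
  exact (has_nb_of_R h.pec (h.obs Cr hq hr hrq.symm).symm h.vw.symm hq hr).1

theorem path (h : Hole2 H c u v w) (Cr : Crit H K) (hq : ¬Has c w q) (hr : ¬Has c v r) :
    R c q r v w :=
  h.obs Cr hq hr (by rintro rfl; exact hr (h.has Cr hq))

theorem has_nb (h : Hole2 H c u v w) (Cr : Crit H K) (hq : ¬Has c w q) (hr : ¬Has c v r) :
    Has c (nb c v q) r :=
  (has_nb_of_R h.pec (h.path Cr hq hr).symm h.vw.symm hq hr).2

theorem big (h : Hole2 H c u v w) (Cr : Crit H K) (hq : ¬Has c w q) :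
    4 ≤ H.degree (nb c v q) := by
  classical
  have h1 := card_le_degree h.pec (x := nb c v q) (insert q (F c v)) (by
    intro γ hγ
    rcases Finset.mem_insert.1 hγ with rfl | hγ
    · exact AcyclicEdge.has_nb (h.has Cr hq)
    · exact h.has_nb Cr hq (mem_F.1 hγ))
  rw [Finset.card_insert_of_notMem (by simpa using h.has Cr hq)] at h1
  have := h.card_v Cr
  omega

theorem card_F_le (h : Hole2 H c u v w) (Cr : Crit H K) : (F c w).card ≤ nbig H v :=
  card_le_nbig h.pec _ fun _ hq => ⟨h.has Cr (mem_F.1 hq), h.big Cr (mem_F.1 hq)⟩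

theorem four_le (h : Hole2 H c u v w) (Cr : Crit H K) : 4 ≤ H.degree w := by
  have h1 := card_C_lt_degree h.pec h.uw.symm (col_symm (h.un w))
  have h2 : (F c v).card ≤ (C c w).card :=
    Finset.card_le_card fun r hr => mem_C.2 (h.symm.has Cr (mem_F.1 hr))
  have := h.card_v Cr
  omega

/-- A small edge at `v` can be recoloured. -/
theorem exists_recolor (h : Hole2 H c u v w) (Cr : Crit H K) (n : ℕ) (hvs : Has c v s)
    (hwx : w ≠ nb c v s) (hn : n ≠ 0) (hdeg : (H.degree (nb c v s) - 1) * n ≤ 2)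
    (hother : ∀ t, Has c v t → Has c w t → t ≠ s → H.degree (nb c v t) ≤ n + 1) :
    ∃ r, ¬Has c v r ∧ ¬Has c (nb c v s) r ∧ PEC H (set c v (nb c v s) (some r)) := by
  classical
  by_contra! hcon
  have hx := nb_spec hvs
  have hxs := AcyclicEdge.has_nb hvs
  set x := nb c v s
  have hvx : v ≠ x := (h.pec.supp hx).ne
  have key : ∀ r, ¬Has c v r → ∃ t, Has c x t ∧ t ≠ s ∧
      ((¬Has c v t ∧ t = r) ∨ (Has c v t ∧ Has c w t ∧ Has c (nb c v t) r)) := by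
    intro r hr
    by_cases hxr : Has c x r
    · exact ⟨r, hxr, by rintro rfl; exact hr hvs, .inl ⟨hr, rfl⟩⟩
    rcases recolor_or h.pec hx hr hxr with P' | ⟨t, hts, -, hxt, hvt, hR⟩
    · exact absurd P' (hcon r hr hxr)
    refine ⟨t, hxt, hts, .inr ⟨hvt, ?_, ?_⟩⟩
    · by_contra hwt
      exact hwx (R_unique h.pec (h.path Cr hwt hr) hR.comm h.vw hvx (.inr hr) (.inl hwt) (.inr hxr))
    · obtain ⟨z, hz, hz2⟩ := chase h.pec hR.comm hvx hr
      rw [h.pec.proper (nb_spec hvt) hz]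
      rcases hz2 with rfl | hz2
      · exact absurd (col_inj hz hx) hts
      · exact hz2
  choose! f hf using key
  have h1 : (F c v).card ≤ n * ((C c x).erase s).card := by
    refine Finset.card_le_mul_card_image_of_maps_to (f := f) (fun r hr => ?_) n fun t _ => ?_
    · have := hf r (mem_F.1 hr)
      simp [this.1, this.2.1]
    · by_cases hvt : Has c v t
      · by_cases hne : ((F c v).filter fun r => f r = t).Nonempty
        · obtain ⟨r, hr⟩ := hne
          simp only [Finset.mem_filter, mem_F] at hr
          obtain ⟨hr, rfl⟩ := hr
          have h3 := hf r hr
          have h2 := card_le_degree h.pec (x := nb c v (f r))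
            (insert (f r) ((F c v).filter fun r' => f r' = f r)) (by
              intro γ hγ
              simp only [Finset.mem_insert, Finset.mem_filter, mem_F] at hγ
              rcases hγ with rfl | hγ
              · exact AcyclicEdge.has_nb hvt
              · have := hf γ hγ.1
                rw [hγ.2] at this
                exact (this.2.2.resolve_left fun h4 => h4.1 hvt).2.2)
          rw [Finset.card_insert_of_notMem (by simp [hvt])] at h2
          have := hother (f r) hvt (h3.2.2.resolve_left fun h4 => h4.1 hvt).2.1 h3.2.1
          omega
        · rw [Finset.not_nonempty_iff_eq_empty.1 hne]
          simp
      · refine (Finset.card_le_one.2 fun r hr r' hr' => ?_).trans (Nat.one_le_iff_ne_zero.2 hn)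
        simp only [Finset.mem_filter, mem_F] at hr hr'
        have e1 := (hf r hr.1).2.2.resolve_right fun h4 => hvt (hr.2 ▸ h4.1)
        have e2 := (hf r' hr'.1).2.2.resolve_right fun h4 => hvt (hr'.2 ▸ h4.1)
        rw [← e1.2, ← e2.2, hr.2, hr'.2]
  have h2 : ((C c x).erase s).card ≤ H.degree x - 1 := by
    rw [Finset.card_erase_of_mem (by simpa using hxs)]
    have := card_C_le_degree h.pec (x := x)
    omega
  have h3 := h.card_v Cr
  have h4 := Nat.mul_le_mul_left n h2
  rw [mul_comm] at hdeg
  omega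

theorem recolor_has (h : Hole2 H c u v w) (Cr : Crit H K) (hvs : Has c v s) (hws : Has c w s)
    (hwx : w ≠ nb c v s) (hr : ¬Has c v r) (hxr : ¬Has c (nb c v s) r)
    (P' : PEC H (set c v (nb c v s) (some r))) (hq : ¬Has c w q) :
    Has c (nb c v q) s ∧ Has c (nb c w s) q := by
  have hvq := h.has Cr hq
  have hx := nb_spec hvs
  set x := nb c v s
  have h' := h.of P' (set_none_iff hx)
  have hsr : s ≠ r := by rintro rfl; exact hr hvs
  have hqr : q ≠ r := by rintro rfl; exact hr hvq
  have hqs : q ≠ s := by rintro rfl; exact hq hws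
  have hlow : ∀ {z γ}, γ ≠ r → Has (set c v x (some r)) z γ → Has c z γ := by
    intro z γ h1 h2
    by_contra h3
    by_cases hwb : z = v
    · rw [hwb] at h2 h3; rw [has_set h.pec] at h2; simp [h1.symm, h3] at h2
    · by_cases hzx : z = x
      · rw [hzx] at h2 h3; rw [has_set' h.pec] at h2; simp [h1.symm, h3] at h2
      · rw [has_set_of hwb hzx] at h2
        exact h3 h2
  have hcol : ∀ {e γ}, γ ≠ r → set c v x (some r) e = some γ → c e = some γ := by
    intro e γ h1 h2
    rw [set_apply] at h2
    split_ifs at h2 with h3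
    · exact absurd (Option.some.inj h2).symm h1
    · exact h2
  have hwq' : ¬Has (set c v x (some r)) w q := fun h1 => hq (hlow hqr h1)
  have hvs' : ¬Has (set c v x (some r)) v s := by
    rw [has_set h.pec]; simp [hx, hsr.symm]
  have hR := h'.obs Cr hwq' hvs' hqs
  constructor
  · obtain ⟨z, hz, hz2⟩ := chase P' hR h.vw hvs'
    rw [h.pec.proper (nb_spec hvq) (hcol hqr hz)]
    rcases hz2 with rfl | hz2
    · exact absurd ⟨_, col_symm hz⟩ hwq'
    · exact hlow hsr hz2
  · obtain ⟨z, hz, hz2⟩ := chase P' hR.symm.comm h.vw.symm hwq'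
    rw [h.pec.proper (nb_spec hws) (hcol hsr hz)]
    rcases hz2 with rfl | hz2
    · exact absurd ⟨_, col_symm hz⟩ hvs'
    · exact hlow hqr hz2

/-- Exchanging two colours missing at `w` allows the colouring to be completed. -/
theorem swap_absurd (h : Hole2 H c u v w) (Cr : Crit H K) (hi : ¬Has c w i) (hj : ¬Has c w j)
    (hij : i ≠ j) (P' : PEC H (swap c v (nb c v i) (nb c v j) i j)) : False := by
  have hvi := h.has Cr hi
  have hvj := h.has Cr hj
  have hx := nb_spec hvi
  have hy := nb_spec hvj
  have hxi := AcyclicEdge.has_nb hvi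
  have hyj := AcyclicEdge.has_nb hvj
  set x := nb c v i
  set y := nb c v j
  have h' := h.of P' (swap_none_iff hx hy)
  obtain ⟨r, hr⟩ : (F c v).Nonempty := by
    rw [← Finset.card_pos]; have := h.card_v Cr; omega
  rw [mem_F] at hr
  have hwx : w ≠ x := by rintro h1; exact hi (h1 ▸ hxi)
  have hwy : w ≠ y := by rintro h1; exact hj (h1 ▸ hyj)
  have hvx : v ≠ x := (h.pec.supp hx).ne
  have hvy : v ≠ y := (h.pec.supp hy).ne
  have hrj : r ≠ j := by rintro rfl; exact hr hvj
  have hri : i ≠ r := by rintro rfl; exact hr hvi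
  have hr' : ¬Has (swap c v x y i j) v r := by rwa [has_swap_of hx hy hij hvx hvy]
  have hi' : ¬Has (swap c v x y i j) w i := by rwa [has_swap_of hx hy hij hwx hwy]
  exact swap_not_R h.pec P' hx hy hij hrj h.vw hwx hwy hr hi (h.path Cr hi hr).symm h.vw hvx
    (.inr hr') (h'.obs Cr hi' hr' hri).symm

theorem weak_has (h : Hole2 H c u v w) (Cr : Crit H K) (hn : nbig H v ≤ 3) (h3 : nDeg H 3 v ≤ 1)
    (hws : Has c w s) (hq : ¬Has c w q) : Has c (nb c v q) s ∧ Has c (nb c w s) q := by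
  classical
  have hF := (Cr.card_F h.toHole h.uw.symm).2
  by_cases hvs : Has c v s
  swap
  · exact ⟨h.has_nb Cr hq hvs, h.symm.has_nb Cr hvs hq⟩
  have small : ∀ t, Has c v t → Has c w t → H.degree (nb c v t) ≤ 3 := by
    intro t h1 h2
    by_contra h4
    have := card_le_nbig h.pec (x := v) (insert t (F c w)) fun r hr => by
      rcases Finset.mem_insert.1 hr with rfl | hr
      · exact ⟨h1, by omega⟩
      · exact ⟨h.has Cr (mem_F.1 hr), h.big Cr (mem_F.1 hr)⟩
    rw [Finset.card_insert_of_notMem (by simpa using h2)] at this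
    omega
  have hwx : w ≠ nb c v s := by
    intro h1
    have := small s hvs hws
    rw [← h1] at this
    have := h.four_le Cr
    omega
  have hs := small s hvs hws
  obtain ⟨r, hr, hxr, P'⟩ : ∃ r, ¬Has c v r ∧ ¬Has c (nb c v s) r ∧
      PEC H (set c v (nb c v s) (some r)) := by
    by_cases hd : H.degree (nb c v s) = 3
    · refine h.exists_recolor Cr 1 hvs hwx one_ne_zero (by omega) fun t h1 h2 h4 => ?_
      have h5 := small t h1 h2
      by_contra h6
      have h7 : H.degree (nb c v t) = 3 := by omega
      have h8 := Finset.card_le_one.1 h3 (nb c v t)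
        (by simpa [h7] using h.pec.supp (nb_spec h1)) (nb c v s)
        (by simpa [hd] using h.pec.supp (nb_spec hvs))
      have h9 := nb_spec h1
      rw [h8] at h9
      exact h4 (col_inj h9 (nb_spec hvs))
    · exact h.exists_recolor Cr 2 hvs hwx two_ne_zero (by omega) fun t h1 h2 _ => small t h1 h2
  exact h.recolor_has Cr hvs hws hwx hr hxr P' hq

theorem weak_full (h : Hole2 H c u v w) (Cr : Crit H K) (hn : nbig H v ≤ 3) (h3 : nDeg H 3 v ≤ 1)
    (hq : ¬Has c w q) (hγ : Has c (nb c v q) γ) : γ = q ∨ Has c w γ := by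
  have h1 := card_C_add_card_F c w
  have h2 := h.card_F_le Cr
  have := Cr.full h.pec (AcyclicEdge.has_nb (h.has Cr hq)) (C c w)
    (fun r hr => (h.weak_has Cr hn h3 (mem_C.1 hr) hq).1) (by simpa using hq) (by omega) hγ
  simpa using this

theorem weak_degree (h : Hole2 H c u v w) (Cr : Crit H K) (hn : nbig H v ≤ 3)
    (h3 : nDeg H 3 v ≤ 1) : 6 ≤ H.degree v := by
  classical
  by_contra hd
  have hF := (Cr.card_F h.toHole h.uw.symm).2
  have hCv := card_C_lt_degree h.pec h.uv.symm (col_symm (h.un v))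
  let B : K → K → K → Prop := fun s q p => R (set c v (nb c v q) none) q s v (nb c v p)
  suffices ∃ i j, i ≠ j ∧ ¬Has c w i ∧ ¬Has c w j ∧
      ∀ s, Has c v s → Has c w s → ¬B s j i ∧ ¬B s i j by
    obtain ⟨i, j, hij, hi, hj, hB⟩ := this
    have hx := nb_spec (h.has Cr hi)
    have hy := nb_spec (h.has Cr hj)
    have hxy : nb c v i ≠ nb c v j := by
      intro h1; rw [h1] at hx; exact hij (col_inj hx hy)
    refine h.swap_absurd Cr hi hj hij (swap_pec h.pec hx hy hij ?_ ?_ ?_ ?_)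
    · intro h1
      rcases h.weak_full Cr hn h3 hi h1 with h1 | h1
      exacts [hij h1.symm, hj h1]
    · intro h1
      rcases h.weak_full Cr hn h3 hj h1 with h1 | h1
      exacts [hij h1, hi h1]
    · intro s h1 h2 hvs hxs hR
      refine (hB s hvs ((h.weak_full Cr hn h3 hi hxs).resolve_left h1)).1 ?_
      rw [erase₂, set_comm _ _ _ (edge_ne hxy)] at hR
      exact hR.of_set (by simp) (by simp)
    · intro s h1 h2 hvs hys hR
      refine (hB s hvs ((h.weak_full Cr hn h3 hj hys).resolve_left h2)).2 ?_
      exact hR.of_set (by simp) (by simp)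
  obtain ⟨i, hi, j, hj, k, hk, hij, hik, hjk⟩ := Finset.two_lt_card.1
    (show 2 < (F c w).card by omega)
  simp only [mem_F] at hi hj hk
  by_cases hN : ∃ s, Has c v s ∧ Has c w s
  swap
  · exact ⟨i, j, hij, hi, hj, fun s h1 h2 => absurd ⟨s, h1, h2⟩ hN⟩
  obtain ⟨s, hvs, hws⟩ := hN
  have huniq : ∀ t, Has c v t → Has c w t → t = s := by
    intro t h1 h2
    have h4 : F c w ⊆ (C c v).erase s := by
      intro q hq
      rw [mem_F] at hq
      simp only [Finset.mem_erase, mem_C]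
      exact ⟨by rintro rfl; exact hq hws, h.has Cr hq⟩
    have h5 : (C c v).erase s ⊆ F c w := by
      rw [Finset.eq_of_subset_of_card_le h4]
      rw [Finset.card_erase_of_mem (by simpa using hvs)]
      omega
    by_contra h6
    exact mem_F.1 (h5 (by simp [h6, h1])) h2
  have hsmall : H.degree (nb c v s) ≤ 3 := by
    by_contra h4
    have := card_le_nbig h.pec (x := v) (insert s (F c w)) fun r hr => by
      rcases Finset.mem_insert.1 hr with rfl | hr
      · exact ⟨hvs, by omega⟩
      · exact ⟨h.has Cr (mem_F.1 hr), h.big Cr (mem_F.1 hr)⟩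
    rw [Finset.card_insert_of_notMem (by simpa using hws)] at this
    omega
  have hmiss : ∀ {q p}, ¬Has c w q → ¬Has c w p → q ≠ p → ¬Has c (nb c v p) q := by
    intro q p h1 h2 h4 h5
    rcases h.weak_full Cr hn h3 h2 h5 with h6 | h6
    exacts [h4 h6, h1 h6]
  have hvq : ∀ {q}, ¬Has c w q → ¬Has (set c v (nb c v q) none) v q := by
    intro q hq
    rw [has_set h.pec]
    simp [nb_spec (h.has Cr hq)]
  have hBu : ∀ {q p p'}, ¬Has c w q → ¬Has c w p → ¬Has c w p' → q ≠ p → q ≠ p' →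
      B s q p → B s q p' → p = p' := by
    intro q p p' h1 h2 h4 h5 h6 b1 b2
    have e1 := nb_spec (h.has Cr h2)
    have e2 := nb_spec (h.has Cr h4)
    have := R_unique (h.pec.erase _ _) b1 b2 (h.pec.supp e1).ne (h.pec.supp e2).ne
      (.inl (hvq h1)) (.inl fun h8 => hmiss h1 h2 h5 (has_set_none h8))
      (.inl fun h8 => hmiss h1 h4 h6 (has_set_none h8))
    rw [this] at e1
    exact col_inj e1 e2
  have hBx : ∀ {q p}, ¬Has c w q → ¬Has c w p → B s q p → Has c (nb c v s) q := by
    intro q p h1 h2 b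
    have e1 := nb_spec (h.has Cr h2)
    obtain ⟨z, hz, hz2⟩ := chase (h.pec.erase _ _) b.comm (h.pec.supp e1).ne (hvq h1)
    have hz' : c s(v, z) = some s := by
      rw [set_apply] at hz
      split_ifs at hz
      exact hz
    rw [h.pec.proper (nb_spec hvs) hz']
    rcases hz2 with rfl | hz2
    · exact absurd hws (col_inj hz' e1 ▸ h2)
    · exact has_set_none hz2
  have main : ∀ i j k, ¬Has c w i → ¬Has c w j → ¬Has c w k → i ≠ j → i ≠ k → j ≠ k →
      ¬Has c (nb c v s) i → ∃ i j, i ≠ j ∧ ¬Has c w i ∧ ¬Has c w j ∧ ¬B s j i ∧ ¬B s i j := by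
    intro i j k hi hj hk hij hik hjk hx
    by_cases b1 : B s j i
    · by_cases b2 : B s k i
      · exact ⟨j, k, hjk, hj, hk, fun b => hij (hBu hk hi hj hik.symm hjk.symm b2 b),
          fun b => hik (hBu hj hi hk hij.symm hjk b1 b)⟩
      · exact ⟨i, k, hik, hi, hk, b2, fun b => hx (hBx hi hk b)⟩
    · exact ⟨i, j, hij, hi, hj, b1, fun b => hx (hBx hi hj b)⟩
  obtain ⟨i', j', h1, h2, h4, h5⟩ : ∃ i j, i ≠ j ∧ ¬Has c w i ∧ ¬Has c w j ∧
      ¬B s j i ∧ ¬B s i j := by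
    by_cases hxi : Has c (nb c v s) i
    swap
    · exact main i j k hi hj hk hij hik hjk hxi
    by_cases hxj : Has c (nb c v s) j
    swap
    · exact main j i k hj hi hk hij.symm hjk hik hxj
    by_cases hxk : Has c (nb c v s) k
    swap
    · exact main k i j hk hi hj hik.symm hjk.symm hij hxk
    exfalso
    have h1 := card_le_degree h.pec (x := nb c v s) (insert s {i, j, k}) (by
      intro γ hγ
      simp only [Finset.mem_insert, Finset.mem_singleton] at hγ
      rcases hγ with rfl | rfl | rfl | rfl
      exacts [AcyclicEdge.has_nb hvs, hxi, hxj, hxk])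
    rw [Finset.card_insert_of_notMem, Finset.card_eq_three.2 ⟨_, _, _, hij, hik, hjk, rfl⟩] at h1
    · omega
    · simp only [Finset.mem_insert, Finset.mem_singleton]
      rintro (rfl | rfl | rfl)
      exacts [hi hws, hj hws, hk hws]
  refine ⟨i', j', h1, h2, h4, fun t h6 h7 => ?_⟩
  rw [huniq t h6 h7]
  exact h5

theorem weak_big (h : Hole2 H c u v w) (Cr : Crit H K) (hn : nbig H v ≤ 3)
    (h3 : nDeg H 3 v ≤ 1) (hwy : H.Adj w y) (hyu : y ≠ u) : 4 ≤ H.degree y := by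
  classical
  obtain ⟨s, hs⟩ := h.has_of_adj hwy h.uw.ne' hyu
  have hws : Has c w s := ⟨y, hs⟩
  have h1 := card_le_degree h.pec (x := nb c w s) (insert s (F c w)) (by
    intro γ hγ
    rcases Finset.mem_insert.1 hγ with rfl | hγ
    · exact AcyclicEdge.has_nb hws
    · exact (h.weak_has Cr hn h3 hws (mem_F.1 hγ)).2)
  rw [Finset.card_insert_of_notMem (by simpa using hws), h.pec.proper (nb_spec hws) hs] at h1
  have hF := (Cr.card_F h.toHole h.uw.symm).2
  omega

end Hole2

/-- The neighbours of a vertex of degree `2`. -/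
theorem Crit.two_nbr (Cr : Crit H K) (hN : ∀ y, H.Adj u y ↔ y = v ∨ y = w) (hvw : v ≠ w) :
    3 ≤ nbig H v ∧ 4 ≤ H.degree v ∧ Fintype.card K + 1 ≤ nbig H v + H.degree w := by
  obtain ⟨c, h⟩ := Cr.exists_hole2 hN hvw
  have h1 := h.card_F_le Cr
  have h2 := Cr.card_F h.toHole h.uw.symm
  exact ⟨by omega, h.symm.four_le Cr, by omega⟩

theorem Crit.weak_nbr (Cr : Crit H K) (hN : ∀ y, H.Adj u y ↔ y = v ∨ y = w) (hvw : v ≠ w)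
    (hn : nbig H v ≤ 3) (h3 : nDeg H 3 v ≤ 1) :
    6 ≤ H.degree v ∧ ∀ y, H.Adj w y → y ≠ u → 4 ≤ H.degree y := by
  obtain ⟨c, h⟩ := Cr.exists_hole2 hN hvw
  exact ⟨h.weak_degree Cr hn h3, fun y h1 h2 => h.weak_big Cr hn h3 h1 h2⟩

end

section

variable {V K : Type*} [DecidableEq V] {H : SimpleGraph V} {x y z w u v a b : V}
  [Fintype V] [Fintype K] [DecidableRel H.Adj]

theorem exists_nbr_of_degree_two (hu : H.degree u = 2) (hx : H.Adj u x) :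
    ∃ w, w ≠ x ∧ ∀ y, H.Adj u y ↔ y = x ∨ y = w := by
  rw [← card_neighborFinset_eq_degree] at hu
  have h1 : ((H.neighborFinset u).erase x).card = 1 := by
    rw [Finset.card_erase_of_mem (by simpa using hx), hu]
  obtain ⟨w, hw⟩ := Finset.card_eq_one.1 h1
  have h2 : ∀ y, y ≠ x ∧ H.Adj u y ↔ y = w := fun y => by
    simpa using Finset.ext_iff.1 hw y
  refine ⟨w, ((h2 w).2 rfl).1, fun y => ?_⟩
  by_cases hy : y = x
  · subst hy; simp [hx]
  · simp [hy, ← h2]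

theorem exists_nbr_of_degree_three (hu : H.degree u = 3) (hx : H.Adj u x) (hw : H.Adj u w)
    (hxw : x ≠ w) : ∃ b, x ≠ b ∧ b ≠ w ∧ ∀ y, H.Adj u y ↔ y = x ∨ y = b ∨ y = w := by
  rw [← card_neighborFinset_eq_degree] at hu
  have h1 : (((H.neighborFinset u).erase x).erase w).card = 1 := by
    rw [Finset.card_erase_of_mem (by simpa using ⟨hxw.symm, hw⟩),
      Finset.card_erase_of_mem (by simpa using hx), hu]
  obtain ⟨b, hb⟩ := Finset.card_eq_one.1 h1
  have h2 : ∀ y, y ≠ w ∧ y ≠ x ∧ H.Adj u y ↔ y = b := fun y => by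
    simpa using Finset.ext_iff.1 hb y
  have h3 := (h2 b).2 rfl
  refine ⟨b, h3.2.1.symm, h3.1, fun y => ?_⟩
  by_cases hy : y = x
  · subst hy; simp [hx]
  · by_cases hy' : y = w
    · subst hy'; simp [hw]
    · simp [hy, hy', ← h2]

theorem exists_nbr_of_degree_three' (hu : H.degree u = 3) (hx : H.Adj u x) :
    ∃ a b, a ≠ b ∧ a ≠ x ∧ b ≠ x ∧ ∀ y, H.Adj u y ↔ y = a ∨ y = b ∨ y = x := by
  have h1 : ((H.neighborFinset u).erase x).Nonempty := by
    rw [← Finset.card_pos, Finset.card_erase_of_mem (by simpa using hx),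
      card_neighborFinset_eq_degree, hu]
    norm_num
  obtain ⟨a, ha⟩ := h1
  simp only [Finset.mem_erase, mem_neighborFinset] at ha
  obtain ⟨b, h2, h3, h4⟩ := exists_nbr_of_degree_three hu ha.2 hx ha.1
  exact ⟨a, b, h2, ha.1, h3, h4⟩

/-- A neighbour of a `2`-vertex which cannot afford to give charge to it. -/
def Weak (H : SimpleGraph V) [DecidableRel H.Adj] (v : V) : Prop := nbig H v = 3 ∧ nDeg H 3 v ≤ 1

open Classical in
/-- The charge sent from `v` to its neighbour `u`. -/
noncomputable def give (H : SimpleGraph V) [DecidableRel H.Adj] (v u : V) : ℕ :=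
  if H.degree u = 2 then
    if Weak H v then 0 else if ∃ w, H.Adj u w ∧ w ≠ v ∧ Weak H w then 12 else 6
  else if H.degree u = 3 then
    if H.degree v = 4 then 0 else if ∃ w, H.Adj u w ∧ H.degree w = 4 then 3 else 2
  else 0

theorem give_of_big (hu : 4 ≤ H.degree u) : give H v u = 0 := by
  rw [give, if_neg (by omega), if_neg (by omega)]

theorem degree_eq_sum (h : ∀ y, H.Adj x y → 2 ≤ H.degree y) :
    H.degree x = nDeg H 2 x + nDeg H 3 x + nbig H x := by
  rw [← card_neighborFinset_eq_degree,
    ← Finset.card_filter_add_card_filter_not (s := H.neighborFinset x) (4 ≤ H.degree ·),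
    ← Finset.card_filter_add_card_filter_not (s := (H.neighborFinset x).filter (¬4 ≤ H.degree ·))
      (H.degree · = 2), Finset.filter_filter, Finset.filter_filter, nDeg, nDeg, nbig, add_comm]
  congr 3
  · refine Finset.filter_congr fun y _ => ?_
    omega
  · refine Finset.filter_congr fun y hy => ?_
    have := h y (by simpa using hy)
    omega

theorem sum_give_le (g₂ g₃ : ℕ) (h₂ : ∀ u, H.Adj x u → H.degree u = 2 → give H x u ≤ g₂)
    (h₃ : ∀ u, H.Adj x u → H.degree u = 3 → give H x u ≤ g₃) :
    ∑ u ∈ H.neighborFinset x, give H x u ≤ g₂ * nDeg H 2 x + g₃ * nDeg H 3 x := by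
  have h : ∀ u ∈ H.neighborFinset x, give H x u ≤
      (if H.degree u = 2 then g₂ else 0) + (if H.degree u = 3 then g₃ else 0) := by
    intro u hu
    rw [mem_neighborFinset] at hu
    by_cases e2 : H.degree u = 2
    · simpa [e2] using h₂ u hu e2
    by_cases e3 : H.degree u = 3
    · simpa [e3] using h₃ u hu e3
    · simp [give, e2, e3]
  refine (Finset.sum_le_sum h).trans ?_
  rw [Finset.sum_add_distrib, ← Finset.sum_filter, ← Finset.sum_filter, Finset.sum_const,
    Finset.sum_const, smul_eq_mul, smul_eq_mul, mul_comm, mul_comm _ g₃]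
  rfl

theorem nDeg_pos {d : ℕ} (h : H.Adj x u) (hu : H.degree u = d) : 0 < nDeg H d x :=
  Finset.card_pos.2 ⟨u, by simp [h, hu]⟩

theorem exists_of_nDeg_pos {d : ℕ} (h : 0 < nDeg H d x) : ∃ u, H.Adj x u ∧ H.degree u = d := by
  obtain ⟨u, hu⟩ := Finset.card_pos.1 h
  exact ⟨u, by simpa using hu⟩

theorem Crit.two_le_degree (Cr : Crit H K) (h : H.Adj x y) : 2 ≤ H.degree y := by
  have h1 := Cr.degree_ne_one y
  have h2 : 0 < H.degree y := (H.degree_pos_iff_exists_adj y).2 ⟨x, h.symm⟩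
  omega

/-- The other neighbour of a `2`-vertex next to a weak vertex. -/
theorem Crit.weak_opposite (Cr : Crit H K) (hN : ∀ y, H.Adj u y ↔ y = v ∨ y = w) (hvw : v ≠ w)
    (hv : Weak H v) : 6 ≤ H.degree w ∧ H.degree w ≤ nbig H w + 1 ∧ nDeg H 2 w = 1 ∧
      nDeg H 3 w = 0 := by
  obtain ⟨h1, h2⟩ := Cr.weak_nbr hN hvw hv.1.le hv.2
  obtain ⟨-, -, h3⟩ := Cr.two_nbr hN hvw
  have h4 := Cr.deg v
  have h5 := hv.1
  have huw : H.Adj w u := ((hN w).2 (.inr rfl)).symm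
  have hu : H.degree u = 2 := by
    rw [← card_neighborFinset_eq_degree, ← Finset.card_pair hvw]
    congr 1
    ext y
    simp [hN]
  have h6 : H.degree w ≤ nbig H w + 1 := by
    have : ((H.neighborFinset w).erase u).card ≤ nbig H w :=
      Finset.card_le_card fun y hy => by
        simp only [Finset.mem_erase, mem_neighborFinset] at hy
        simp [hy.2, h2 y hy.2 hy.1]
    rw [Finset.card_erase_of_mem (by simpa using huw), card_neighborFinset_eq_degree] at this
    omega
  have h7 := degree_eq_sum (x := w) fun y hy => Cr.two_le_degree hy
  have h8 := nDeg_pos huw hu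
  omega

theorem Crit.discharge_big (Cr : Crit H K) (hx : 4 ≤ H.degree x) :
    ∑ u ∈ H.neighborFinset x, give H x u ≤ 6 * (H.degree x - 4) := by
  have hsum := degree_eq_sum (x := x) fun y hy => Cr.two_le_degree hy
  have g₃ : ∀ u, H.Adj x u → H.degree u = 3 → give H x u ≤ 3 := by
    intro u _ hu
    rw [give, if_neg (by omega), if_pos hu]
    split_ifs <;> omega
  have n2 : 0 < nDeg H 2 x → 3 ≤ nbig H x ∧ (Weak H x → 6 ≤ H.degree x) := by
    intro h
    obtain ⟨u, hxu, hu⟩ := exists_of_nDeg_pos h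
    obtain ⟨w, hw, hN⟩ := exists_nbr_of_degree_two hu hxu.symm
    exact ⟨(Cr.two_nbr hN hw.symm).1, fun hW => (Cr.weak_nbr hN hw.symm hW.1.le hW.2).1⟩
  by_cases hA : ∃ u, H.Adj x u ∧ H.degree u = 2 ∧ ∃ w, H.Adj u w ∧ w ≠ x ∧ Weak H w
  · obtain ⟨u, hxu, hu, w, huw, hwx, hW⟩ := hA
    have hN : ∀ y, H.Adj u y ↔ y = w ∨ y = x := by
      obtain ⟨w', -, hN⟩ := exists_nbr_of_degree_two hu hxu.symm
      obtain rfl := ((hN w).1 huw).resolve_left hwx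
      intro y; rw [hN, or_comm]
    obtain ⟨h1, h2, h3, h4⟩ := Cr.weak_opposite hN hwx hW
    have := sum_give_le 12 3 (fun u _ hu => by rw [give, if_pos hu]; split_ifs <;> omega) g₃
    omega
  have g₂ : ∀ u, H.Adj x u → H.degree u = 2 → give H x u ≤ 6 := by
    intro u hxu hu
    rw [give, if_pos hu]
    split_ifs with h1 h2
    exacts [by omega, absurd ⟨u, hxu, hu, h2⟩ hA, le_rfl]
  have hs := sum_give_le 6 3 g₂ g₃
  by_cases h2 : nDeg H 2 x = 0
  swap
  · obtain ⟨h3, h4⟩ := n2 (by omega)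
    by_cases hW : Weak H x
    · have h5 := h4 hW
      have := sum_give_le (x := x) 0 3 (fun u _ hu => by rw [give, if_pos hu, if_pos hW]) g₃
      have := hW.2
      omega
    · have : nbig H x = 3 → 2 ≤ nDeg H 3 x := fun h => by
        by_contra h5
        exact hW ⟨h, by omega⟩
      omega
  by_cases h4 : H.degree x = 4
  · have := sum_give_le (x := x) 6 0 g₂ fun u _ hu => by
      rw [give, if_neg (by omega), if_pos hu, if_pos h4]
    omega
  by_cases hB : ∃ u, H.Adj x u ∧ H.degree u = 3 ∧ ∃ w, H.Adj u w ∧ H.degree w = 4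
  · obtain ⟨u, hxu, hu, w, huw, hw⟩ := hB
    obtain ⟨b, h5, h6, hN⟩ := exists_nbr_of_degree_three hu hxu.symm huw
      (by rintro rfl; exact h4 hw)
    have := Cr.four_nbr hN h5 (by rintro rfl; exact h4 hw) h6 hw
    omega
  have := sum_give_le (x := x) 6 2 g₂ fun u hxu hu => by
    rw [give, if_neg (by omega), if_pos hu]
    split_ifs with h6
    exacts [absurd ⟨u, hxu, hu, h6⟩ hB, le_rfl]
  by_cases h5 : H.degree x = 5
  · by_cases h6 : nDeg H 3 x = 0
    · omega
    obtain ⟨u, hxu, hu⟩ := exists_of_nDeg_pos (H := H) (x := x) (d := 3) (by omega)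
    obtain ⟨a, b, hab, hax, hbx, hN⟩ := exists_nbr_of_degree_three' hu hxu.symm
    have := Cr.two_nbig hN hab hax hbx h5
    omega
  · omega

theorem Crit.discharge (Cr : Crit H K) (hx : 0 < H.degree x) :
    24 + ∑ u ∈ H.neighborFinset x, give H x u ≤
      6 * H.degree x + ∑ u ∈ H.neighborFinset x, give H u x := by
  have h1 := Cr.degree_ne_one x
  rcases (show H.degree x = 2 ∨ H.degree x = 3 ∨ 4 ≤ H.degree x by omega) with h2 | h3 | h4
  · obtain ⟨v, hxv⟩ := (H.degree_pos_iff_exists_adj x).1 hx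
    obtain ⟨w, hwv, hN⟩ := exists_nbr_of_degree_two h2 hxv
    have hNf : H.neighborFinset x = {v, w} := by ext y; simp [hN]
    have hN' : ∀ y, H.Adj x y ↔ y = w ∨ y = v := fun y => by rw [hN, or_comm]
    have d1 := (Cr.two_nbr hN hwv.symm).2.1
    have d2 := (Cr.two_nbr hN' hwv).2.1
    rw [hNf, Finset.sum_pair hwv.symm, Finset.sum_pair hwv.symm, give_of_big d1, give_of_big d2]
    have key : ∀ {v w}, (∀ y, H.Adj x y ↔ y = v ∨ y = w) → v ≠ w → Weak H v →
        give H w x = 12 := by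
      intro v w hN hvw hW
      have h5 := Cr.weak_opposite hN hvw hW
      rw [give, if_pos h2, if_neg, if_pos ⟨v, (hN v).2 (.inl rfl), hvw, hW⟩]
      intro hW'
      have := hW'.1
      omega
    by_cases hv : Weak H v
    · have := key hN hwv.symm hv
      omega
    by_cases hw : Weak H w
    · have := key hN' hwv hw
      omega
    have k : ∀ {v}, ¬Weak H v → 6 ≤ give H v x := by
      intro v hv
      rw [give, if_pos h2, if_neg hv]
      split_ifs <;> omega
    have := k hv
    have := k hw
    omega
  · obtain ⟨v, hxv⟩ := (H.degree_pos_iff_exists_adj x).1 hx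
    have big : ∀ y ∈ H.neighborFinset x, 4 ≤ H.degree y := by
      intro y hy
      obtain ⟨a, b, hab, hax, hbx, hN⟩ := exists_nbr_of_degree_three' h3
        ((mem_neighborFinset ..).1 hy)
      exact Cr.four_le_degree hN hab hax hbx
    rw [Finset.sum_eq_zero fun y hy => give_of_big (big y hy), h3]
    by_cases hB : ∃ w, H.Adj x w ∧ H.degree w = 4
    · obtain ⟨w, hxw, hw⟩ := hB
      obtain ⟨a, b, hab, hax, hbx, hN⟩ := exists_nbr_of_degree_three' h3 hxw
      have ha := Cr.four_nbr hN hab hax hbx hw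
      have hb := Cr.four_nbr (a := b) (b := a) (fun y => by rw [hN]; tauto) hab.symm hbx hax hw
      have k : ∀ {v}, H.degree v ≠ 4 → give H v x = 3 := by
        intro v hv
        rw [give, if_neg (by omega), if_pos h3, if_neg hv, if_pos ⟨w, hxw, hw⟩]
      have h5 : ∑ u ∈ ({a, b} : Finset V), give H u x ≤ ∑ u ∈ H.neighborFinset x, give H u x := by
        refine Finset.sum_le_sum_of_subset fun y hy => ?_
        simp only [Finset.mem_insert, Finset.mem_singleton] at hy
        rw [mem_neighborFinset, hN]
        tauto
      rw [Finset.sum_pair hab, k (by omega), k (by omega)] at h5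
      omega
    · have h5 : ∑ u ∈ H.neighborFinset x, 2 ≤ ∑ u ∈ H.neighborFinset x, give H u x := by
        refine Finset.sum_le_sum fun y hy => ?_
        have h6 : H.degree y ≠ 4 := fun h => hB ⟨y, by simpa using hy, h⟩
        rw [give, if_neg (by omega), if_pos h3, if_neg h6, if_neg hB]
      rw [Finset.sum_const, card_neighborFinset_eq_degree, h3] at h5
      simp only [smul_eq_mul] at h5
      omega
  · have := Cr.discharge_big h4
    omega

theorem Crit.four_mul_card_le (Cr : Crit H K) :
    4 * (Finset.univ.filter (0 < H.degree ·)).card ≤ 2 * H.edgeFinset.card := by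
  have hswap : ∑ x, ∑ u ∈ H.neighborFinset x, give H x u =
      ∑ x, ∑ u ∈ H.neighborFinset x, give H u x :=
    Finset.sum_comm' fun x y => by simp [adj_comm]
  have h1 : ∑ x, ((if 0 < H.degree x then 24 else 0) + ∑ u ∈ H.neighborFinset x, give H x u) ≤
      ∑ x, (6 * H.degree x + ∑ u ∈ H.neighborFinset x, give H u x) := by
    refine Finset.sum_le_sum fun x _ => ?_
    split_ifs with h
    · exact Cr.discharge h
    · have h2 : H.neighborFinset x = ∅ := by
        rw [← Finset.card_eq_zero, card_neighborFinset_eq_degree]; omega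
      simp [h2]
  rw [Finset.sum_add_distrib, Finset.sum_add_distrib, hswap, ← Finset.sum_filter,
    Finset.sum_const, ← Finset.mul_sum, H.sum_degrees_eq_twice_card_edges, smul_eq_mul] at h1
  omega

end

section

variable {V K : Type*} [DecidableEq V] {H G : SimpleGraph V} {c : Sym2 V → Option K} [Fintype V]
  [Fintype K]

theorem PEC.mono (h : PEC H c) (hle : H ≤ G) : PEC G c :=
  ⟨fun hc => hle (h.supp hc), h.proper, h.acyc⟩

theorem two_mul_card_edges_lt [DecidableRel H.Adj] (hG : maxAverageDegree G < 4) (hle : H ≤ G)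
    (hne : ∃ x y, H.Adj x y) :
    2 * H.edgeFinset.card < 4 * (Finset.univ.filter (0 < H.degree ·)).card := by
  let S : G.Subgraph :=
    { verts := {x | 0 < H.degree x}
      Adj := H.Adj
      adj_sub := fun h => hle h
      edge_vert := fun h => (H.degree_pos_iff_exists_adj _).2 ⟨_, h⟩
      symm := H.symm }
  obtain ⟨x, y, hxy⟩ := hne
  have hx : x ∈ S.verts := (H.degree_pos_iff_exists_adj _).2 ⟨_, hxy⟩
  have hfin : {r : ℝ | ∃ T : G.Subgraph, T.verts.Nonempty ∧
      r = 2 * (T.edgeSet.ncard : ℝ) / (T.verts.ncard : ℝ)}.Finite :=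
    (Set.finite_range fun T : G.Subgraph =>
      2 * (T.edgeSet.ncard : ℝ) / (T.verts.ncard : ℝ)).subset <| by
        rintro _ ⟨T, -, rfl⟩
        exact ⟨T, rfl⟩
  have hS := (le_csSup hfin.bddAbove ⟨S, ⟨x, hx⟩, rfl⟩).trans_lt hG
  have hE : S.edgeSet = H.edgeFinset := by
    ext e
    induction e with | h a b => simp [S]
  have hV : S.verts = (Finset.univ.filter (0 < H.degree ·) : Finset V) := by
    ext a
    simp [S]
  rw [hE, hV, Set.ncard_coe_finset, Set.ncard_coe_finset, div_lt_iff₀] at hS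
  · exact_mod_cast hS
  · rw [Nat.cast_pos, Finset.card_pos]
    exact ⟨x, by simpa [S] using hx⟩

theorem exists_full_coloring [DecidableRel G.Adj] (hG : maxAverageDegree G < 4)
    (hdeg : ∀ x, G.degree x + 2 ≤ Fintype.card K) (H : SimpleGraph V) (hle : H ≤ G) :
    ∃ c : Sym2 V → Option K, PEC H c ∧ ∀ x y, H.Adj x y → c s(x, y) ≠ none := by
  classical
  induction H using WellFoundedLT.induction with
  | ind H ih =>
    by_contra hno
    push Not at hno
    by_cases hne : ∃ x y, H.Adj x y
    · have Cr : Crit H K :=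
        { uncol := hno
          deg := fun x => (Nat.add_le_add_right (degree_le_of_le hle) 2).trans (hdeg x)
          col := fun x y hxy => by
            have hlt : H.deleteEdges {s(x, y)} < H :=
              lt_of_le_of_ne (deleteEdges_le _) fun h => by
                rw [← h] at hxy
                simp at hxy
            obtain ⟨c, hc, hf⟩ := ih _ hlt (hlt.le.trans hle)
            refine ⟨c, hc.mono hlt.le, ?_, fun a b hab h => hf a b (by simp [hab, h])⟩
            by_contra hs
            obtain ⟨α, hα⟩ := Option.ne_none_iff_exists'.1 hs
            simpa using hc.supp hα }
      exact absurd Cr.four_mul_card_le (not_le.2 (two_mul_card_edges_lt hG hle hne))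
    · obtain ⟨x, y, hxy, -⟩ := hno (fun _ => none)
        ⟨fun h => by simp at h, fun h => by simp at h, fun α β => by
          have : bi (V := V) (fun _ => none) α β = ⊥ := by
            ext a b
            simp [bi_adj]
          rw [this]
          exact isAcyclic_bot⟩
      exact hne ⟨x, y, hxy⟩

theorem PEC.isAcyclicEdgeColoring [Inhabited K] (h : PEC G c)
    (hf : ∀ x y, G.Adj x y → c s(x, y) ≠ none) :
    IsAcyclicEdgeColoring G fun e => (c e).getD default := by
  have key : ∀ e ∈ G.edgeSet, c e = some ((c e).getD default) := fun e he => by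
    induction e with | h a b =>
    obtain ⟨α, hα⟩ := Option.ne_none_iff_exists'.1 (hf a b he)
    rw [hα, Option.getD_some]
  refine ⟨?_, ?_⟩
  · rintro e he e' he' hne ⟨v, hv, hv'⟩ heq
    obtain ⟨a, rfl⟩ := hv
    obtain ⟨b, rfl⟩ := hv'
    have h₁ := key _ he
    have h₂ := key _ he'
    exact hne (by rw [h.proper h₁ (h₂.trans (congrArg some heq.symm))])
  · rintro v w hw ⟨a, b, hab⟩
    have hE : ∀ e ∈ w.edges, e ∈ (bi c a b).edgeSet := fun e he => by
      have hG := w.edges_subset_edgeSet he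
      have h₁ := key e hG
      have h₂ := hab e he
      induction e with | h x y =>
      refine bi_adj.2 ⟨?_, G.ne_of_adj hG⟩
      rw [h₁, Option.some_inj, Option.some_inj]
      exact h₂
    exact h.acyc a b _ (hw.transfer hE)

end

end AcyclicEdge

theorem stmt0 {V : Type*} [Fintype V] (G : SimpleGraph V) [DecidableRel G.Adj]
    (h : maxAverageDegree G < 4) :
    acyclicChromaticIndex G ≤ G.maxDegree + 2 := by
  classical
  obtain ⟨c, hc, hf⟩ := AcyclicEdge.exists_full_coloring (K := Fin (G.maxDegree + 2)) h
    (fun x => by simpa using G.degree_le_maxDegree x) G le_rfl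
  exact Nat.sInf_le ⟨_, hc.isAcyclicEdgeColoring hf⟩
end

section
/- Let G be a finite simple graph with maximum average degree mad(G) < 3. Then the acyclic chromatic index of G satisfies χ'_a(G) ≤ Δ(G) + 1, where Δ(G) is the maximum degree of G. -/
open SimpleGraph

section AcyclicColoring

variable {V α : Type*}

/-- The spanning subgraph of `G` formed by the edges of color `a` or `b`. -/
def bicoloredSubgraph (G : SimpleGraph V) (c : Sym2 V → α) (a b : α) : SimpleGraph V where
  Adj x y := G.Adj x y ∧ (c s(x, y) = a ∨ c s(x, y) = b)
  symm := ⟨fun x y h => by rwa [G.adj_comm, Sym2.eq_swap]⟩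
  loopless := ⟨fun x h => G.irrefl h.1⟩

/-- A reformulation of `IsAcyclicEdgeColoring` in terms of two-colored subgraphs. -/
structure IsForestColoring (G : SimpleGraph V) (c : Sym2 V → α) : Prop where
  proper : ∀ ⦃x y z⦄, G.Adj x y → G.Adj x z → c s(x, y) = c s(x, z) → y = z
  acyclic : ∀ a b, (bicoloredSubgraph G c a b).IsAcyclic

/-- No edge of `G` at `v` has color `a`. -/
def IsMissingColor (G : SimpleGraph V) (c : Sym2 V → α) (v : V) (a : α) : Prop :=
  ∀ x, G.Adj v x → c s(v, x) ≠ a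

theorem bicoloredSubgraph_comm (G : SimpleGraph V) (c : Sym2 V → α) (a b : α) :
    bicoloredSubgraph G c a b = bicoloredSubgraph G c b a := by
  ext x y
  simp only [bicoloredSubgraph]
  tauto

theorem IsForestColoring.isAcyclicEdgeColoring {G : SimpleGraph V} {c : Sym2 V → α}
    (h : IsForestColoring G c) : IsAcyclicEdgeColoring G c := by
  refine ⟨?_, ?_⟩
  · rintro e₁ h₁ e₂ h₂ hne ⟨v, hv₁, hv₂⟩ heq
    obtain ⟨y, rfl⟩ := Sym2.mem_iff_exists.1 hv₁
    obtain ⟨z, rfl⟩ := Sym2.mem_iff_exists.1 hv₂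
    exact hne (congrArg (fun x => s(v, x)) (h.proper h₁ h₂ heq))
  · rintro v w hw ⟨a, b, hab⟩
    have hmem : ∀ e ∈ w.edges, e ∈ (bicoloredSubgraph G c a b).edgeSet := by
      intro e he
      have hG := w.edges_subset_edgeSet he
      have hc := hab e he
      induction e with
      | _ x y => exact ⟨hG, hc⟩
    exact h.acyclic a b _ (hw.transfer hmem)

theorem IsForestColoring.mono {G H : SimpleGraph V} {c : Sym2 V → α}
    (h : IsForestColoring G c) (hle : H ≤ G) : IsForestColoring H c :=
  ⟨fun _ _ _ hy hz => h.proper (hle hy) (hle hz),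
    fun a b => (h.acyclic a b).anti fun x y (hxy : (bicoloredSubgraph H c a b).Adj x y) =>
      show (bicoloredSubgraph G c a b).Adj x y from ⟨hle hxy.1, hxy.2⟩⟩

theorem mem_of_reachable_of_closed {K : SimpleGraph V} {x y : V} (h : K.Reachable x y)
    (S : V → Prop) (hx : S x) (hS : ∀ a b, S a → K.Adj a b → S b) : S y := by
  obtain ⟨p⟩ := h
  induction p with
  | nil => exact hx
  | cons hadj _ ih => exact ih (hS _ _ hx hadj)

open scoped Classical in
/-- Coloring one new edge `uw` of `G`. -/
theorem IsForestColoring.update_edge {G G' : SimpleGraph V} {c : Sym2 V → α} {u w : V} {b : α}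
    (hc : IsForestColoring G' c) (huw : u ≠ w)
    (hG : ∀ x y, G.Adj x y → G'.Adj x y ∨ s(x, y) = s(u, w))
    (hu : IsMissingColor G' c u b) (hw : IsMissingColor G' c w b)
    (hr : ∀ a, ¬ (bicoloredSubgraph G' c a b).Reachable u w) :
    IsForestColoring G (Function.update c s(u, w) b) := by
  have hcol : ∀ e, e ≠ s(u, w) → Function.update c s(u, w) b e = c e := fun e he =>
    Function.update_of_ne he _ _
  have hself : Function.update c s(u, w) b s(u, w) = b := Function.update_self _ _ _
  have key : ∀ a, (bicoloredSubgraph G (Function.update c s(u, w) b) a b).IsAcyclic := by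
    intro a
    refine ((hc.acyclic a b).sup_edge_of_not_reachable (hr a)).anti ?_
    rintro x y ⟨hxy, hcxy⟩
    rw [sup_adj, edge_adj]
    by_cases he : s(x, y) = s(u, w)
    · exact Or.inr ⟨by simpa using he, hxy.ne⟩
    · rw [hcol _ he] at hcxy
      exact Or.inl ⟨(hG x y hxy).resolve_right he, hcxy⟩
  refine ⟨?_, ?_⟩
  · have hmiss : ∀ x y z, s(x, y) = s(u, w) → G'.Adj x z → c s(x, z) ≠ b := by
      intro x y z he
      rcases Sym2.eq_iff.1 he with ⟨rfl, rfl⟩ | ⟨rfl, rfl⟩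
      · exact hu z
      · exact hw z
    intro x y z hxy hxz heq
    by_cases hy : s(x, y) = s(u, w) <;> by_cases hz : s(x, z) = s(u, w)
    · exact Sym2.congr_right.1 (hy.trans hz.symm)
    · rw [hy, hself, hcol _ hz] at heq
      exact absurd heq.symm (hmiss x y z hy ((hG x z hxz).resolve_right hz))
    · rw [hz, hself, hcol _ hy] at heq
      exact absurd heq (hmiss x z y hz ((hG x y hxy).resolve_right hy))
    · rw [hcol _ hy, hcol _ hz] at heq
      exact hc.proper ((hG x y hxy).resolve_right hy) ((hG x z hxz).resolve_right hz) heq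
  · intro a a'
    by_cases ha' : a' = b
    · exact ha' ▸ key a
    by_cases ha : a = b
    · rw [bicoloredSubgraph_comm]
      exact ha ▸ key a'
    refine (hc.acyclic a a').anti ?_
    rintro x y ⟨hxy, hcxy⟩
    have he : s(x, y) ≠ s(u, w) := by
      intro he
      rw [he, hself] at hcxy
      exact hcxy.elim (fun h => ha h.symm) (fun h => ha' h.symm)
    rw [hcol _ he] at hcxy
    exact ⟨(hG x y hxy).resolve_right he, hcxy⟩

open scoped Classical in
/-- Coloring the edge at a vertex `u` of degree one. -/
theorem IsForestColoring.update_pendant_edge {G : SimpleGraph V} {c : Sym2 V → α} {u v : V} {b : α}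
    (hc : IsForestColoring (G.deleteIncidenceSet u) c) (huv : u ≠ v)
    (hu : ∀ x, G.Adj u x → x = v) (hv : IsMissingColor (G.deleteIncidenceSet u) c v b) :
    IsForestColoring G (Function.update c s(u, v) b) := by
  refine hc.update_edge huv ?_ ?_ hv ?_
  · intro x y hxy
    rw [deleteIncidenceSet_adj]
    by_cases hx : x = u
    · subst hx
      rw [hu y hxy]
      exact Or.inr rfl
    by_cases hy : y = u
    · subst hy
      rw [hu x hxy.symm]
      exact Or.inr Sym2.eq_swap
    exact Or.inl ⟨hxy, hx, hy⟩
  · intro x hx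
    exact absurd rfl (deleteIncidenceSet_adj.1 hx).2.1
  · intro a hr
    refine huv (mem_of_reachable_of_closed hr (fun x => x = u) rfl ?_).symm
    rintro x y rfl hxy
    exact absurd rfl (deleteIncidenceSet_adj.1 hxy.1).2.1

open scoped Classical in
/-- Coloring the two edges at a vertex `u` of degree two. -/
theorem IsForestColoring.update_two_edges {G : SimpleGraph V} {c : Sym2 V → α} {u v w : V}
    {a b : α} (hc : IsForestColoring (G.deleteIncidenceSet u) c)
    (huv : u ≠ v) (huw : u ≠ w) (hvw : v ≠ w) (hu : ∀ x, G.Adj u x → x = v ∨ x = w)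
    (hv : IsMissingColor (G.deleteIncidenceSet u) c v b)
    (hw : IsMissingColor (G.deleteIncidenceSet u) c w a) (hab : a ≠ b)
    (hr : ¬ (bicoloredSubgraph (G.deleteIncidenceSet u) c a b).Reachable v w) :
    IsForestColoring G (Function.update (Function.update c s(u, v) b) s(u, w) a) := by
  set G₁ := G.deleteEdges {s(u, w)} with hG₁
  have hadj₁ : ∀ x y, G₁.Adj x y ↔ G.Adj x y ∧ s(x, y) ≠ s(u, w) := by
    intro x y
    simp [hG₁, deleteEdges_adj]
  have hu₁ : ∀ x, G₁.Adj u x → x = v := by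
    intro x hx
    obtain ⟨hx, hne⟩ := (hadj₁ u x).1 hx
    refine (hu x hx).resolve_right ?_
    rintro rfl
    exact hne rfl
  have hdel : G₁.deleteIncidenceSet u = G.deleteIncidenceSet u := by
    ext x y
    simp only [deleteIncidenceSet_adj, hadj₁, ne_eq, Sym2.eq_iff]
    tauto
  have hc₁ : IsForestColoring G₁ (Function.update c s(u, v) b) :=
    IsForestColoring.update_pendant_edge (by rwa [hdel]) huv hu₁ (by rwa [hdel])
  have hself : Function.update c s(u, v) b s(u, v) = b := Function.update_self _ _ _
  have hcol : ∀ x y, x ≠ u → y ≠ u → Function.update c s(u, v) b s(x, y) = c s(x, y) := by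
    intro x y hx hy
    refine Function.update_of_ne ?_ _ _
    rw [ne_eq, Sym2.eq_iff]
    tauto
  have hdadj : ∀ x y, G₁.Adj x y → x ≠ u → y ≠ u → (G.deleteIncidenceSet u).Adj x y :=
    fun x y h hx hy => deleteIncidenceSet_adj.2 ⟨((hadj₁ x y).1 h).1, hx, hy⟩
  refine hc₁.update_edge huw ?_ ?_ ?_ ?_
  · intro x y hxy
    rw [hadj₁]
    tauto
  · intro x hx
    rw [hu₁ x hx, hself]
    exact hab.symm
  · intro x hx
    have hxu : x ≠ u := by
      rintro rfl
      exact hvw (hu₁ w hx.symm).symm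
    rw [hcol _ _ huw.symm hxu]
    exact hw x (hdadj _ _ hx huw.symm hxu)
  · intro d hd
    have hS := mem_of_reachable_of_closed hd (fun x => x = u ∨ (d = b ∧
      (bicoloredSubgraph (G.deleteIncidenceSet u) c a b).Reachable v x)) (Or.inl rfl) ?_
    · rcases hS with h | ⟨-, h⟩
      · exact huw h.symm
      · exact hr h
    · rintro x y hx ⟨hxy, hcxy⟩
      by_cases hy : y = u
      · exact Or.inl hy
      refine Or.inr ?_
      by_cases hxu : x = u
      · subst hxu
        obtain rfl := hu₁ y hxy
        rw [hself] at hcxy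
        exact ⟨(hcxy.resolve_right hab.symm).symm, Reachable.refl _⟩
      · obtain ⟨rfl, hvx⟩ := hx.resolve_left hxu
        rw [hcol _ _ hxu hy] at hcxy
        exact ⟨rfl, hvx.trans (Adj.reachable ⟨hdadj _ _ hxy hxu hy, hcxy.symm⟩)⟩

theorem eq_of_isPath_of_leaf {K : SimpleGraph V}
    (hdeg : ∀ a b c d, K.Adj a b → K.Adj a c → K.Adj a d → b = c ∨ b = d ∨ c = d)
    {y z : V} (hy : ∀ a b, K.Adj y a → K.Adj y b → a = b)
    (hz : ∀ a b, K.Adj z a → K.Adj z b → a = b) {a b : V} (hba : K.Adj b a)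
    (p : K.Walk a y) (hp : p.IsPath) (hbp : b ∉ p.support)
    (q : K.Walk a z) (hq : q.IsPath) (hbq : b ∉ q.support) : y = z := by
  induction p generalizing b with
  | nil =>
    cases q with
    | nil => rfl
    | cons h q' =>
      refine absurd ?_ hbq
      rw [hy _ _ hba.symm h]
      simp
  | cons h p' ih =>
    cases q with
    | nil =>
      refine absurd ?_ hbp
      rw [hz _ _ hba.symm h]
      simp
    | cons h' q' =>
      rcases hdeg _ _ _ _ hba.symm h h' with rfl | rfl | rfl
      · exact absurd (by simp) hbp
      · exact absurd (by simp) hbq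
      · rw [Walk.cons_isPath_iff] at hp hq
        exact ih hy h hp.1 hp.2 q' hq.1 hq.2

/-- A component of a graph of maximum degree two has at most two leaves. -/
theorem eq_of_reachable_of_leaf {K : SimpleGraph V}
    (hdeg : ∀ a b c d, K.Adj a b → K.Adj a c → K.Adj a d → b = c ∨ b = d ∨ c = d)
    {x y z : V} (hx : ∀ a b, K.Adj x a → K.Adj x b → a = b)
    (hy : ∀ a b, K.Adj y a → K.Adj y b → a = b) (hz : ∀ a b, K.Adj z a → K.Adj z b → a = b)
    (hxy : x ≠ y) (hxz : x ≠ z) (hry : K.Reachable x y) (hrz : K.Reachable x z) : y = z := by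
  obtain ⟨p, hp⟩ := hry.exists_isPath
  obtain ⟨q, hq⟩ := hrz.exists_isPath
  cases p with
  | nil => exact absurd rfl hxy
  | cons h p' =>
    cases q with
    | nil => exact absurd rfl hxz
    | cons h' q' =>
      obtain rfl := hx _ _ h h'
      rw [Walk.cons_isPath_iff] at hp hq
      exact eq_of_isPath_of_leaf hdeg hy hz h p' hp.1 hp.2 q' hq.1 hq.2

open scoped Classical in
theorem le_card_isMissingColor_add_degree {k : ℕ} (G : SimpleGraph V)
    (c : Sym2 V → Fin k) (v : V) [Fintype (G.neighborSet v)] :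
    k ≤ (Finset.univ.filter (IsMissingColor G c v)).card + G.degree v := by
  have hle : (Finset.univ.filter (fun a => ¬ IsMissingColor G c v a)).card ≤ G.degree v := by
    rw [← card_neighborFinset_eq_degree]
    refine (Finset.card_le_card ?_).trans
      (Finset.card_image_le (s := G.neighborFinset v) (f := fun x => c s(v, x)))
    intro a ha
    simp only [IsMissingColor] at ha
    push Not at ha
    simpa using ha
  have := Finset.card_filter_add_card_filter_not (s := (Finset.univ : Finset (Fin k)))
    (p := IsMissingColor G c v)
  rw [Finset.card_univ, Fintype.card_fin] at this
  omega

theorem degree_deleteIncidenceSet_add_one_le {G : SimpleGraph V} {u v : V}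
    [Fintype (G.neighborSet v)] [Fintype ((G.deleteIncidenceSet u).neighborSet v)]
    (huv : G.Adj u v) : (G.deleteIncidenceSet u).degree v + 1 ≤ G.degree v := by
  rw [← card_neighborFinset_eq_degree, ← card_neighborFinset_eq_degree]
  refine Finset.card_lt_card ⟨?_, ?_⟩
  · intro x
    simp only [mem_neighborFinset, deleteIncidenceSet_adj]
    tauto
  · intro h
    have := h ((mem_neighborFinset _ _ _).2 huv.symm)
    rw [mem_neighborFinset, deleteIncidenceSet_adj] at this
    exact this.2.2 rfl

section TwoVertex

variable [Fintype V] {k : ℕ} {G : SimpleGraph V} {c : Sym2 V → Fin k} {u v w : V}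

theorem reachable_of_not_colorable (hno : ∀ c : Sym2 V → Fin k, ¬ IsForestColoring G c)
    (hc : IsForestColoring (G.deleteIncidenceSet u) c) (huv : G.Adj u v) (huw : G.Adj u w)
    (hvw : v ≠ w) (hu : ∀ x, G.Adj u x → x = v ∨ x = w) {a b : Fin k}
    (ha : IsMissingColor (G.deleteIncidenceSet u) c w a)
    (hb : IsMissingColor (G.deleteIncidenceSet u) c v b) (hab : a ≠ b) :
    (bicoloredSubgraph (G.deleteIncidenceSet u) c a b).Reachable v w := by
  classical
  by_contra hr
  exact hno _ (hc.update_two_edges huv.ne huw.ne hvw hu hb ha hab hr)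

open scoped Classical in
theorem le_card_isMissingColor_deleteIncidenceSet (c : Sym2 V → Fin k) (huv : G.Adj u v) :
    k + 1 ≤ (Finset.univ.filter (IsMissingColor (G.deleteIncidenceSet u) c v)).card
      + G.degree v := by
  have h₁ := le_card_isMissingColor_add_degree (G.deleteIncidenceSet u) c v
  have h₂ := degree_deleteIncidenceSet_add_one_le huv
  omega

open scoped Classical in
theorem not_isMissingColor_of_not_colorable
    (hno : ∀ c : Sym2 V → Fin k, ¬ IsForestColoring G c)
    (hc : IsForestColoring (G.deleteIncidenceSet u) c) (huv : G.Adj u v) (huw : G.Adj u w)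
    (hvw : v ≠ w) (hu : ∀ x, G.Adj u x → x = v ∨ x = w) (hk : ∀ x, G.degree x < k) {a : Fin k}
    (ha : IsMissingColor (G.deleteIncidenceSet u) c w a) :
    ¬ IsMissingColor (G.deleteIncidenceSet u) c v a := by
  intro hav
  have hcard := le_card_isMissingColor_deleteIncidenceSet c huv
  have hkv := hk v
  obtain ⟨b, hb, hba⟩ := Finset.exists_mem_ne (show 1 <
    (Finset.univ.filter (IsMissingColor (G.deleteIncidenceSet u) c v)).card by omega) a
  rw [Finset.mem_filter] at hb
  have hr := reachable_of_not_colorable hno hc huv huw hvw hu ha hb.2 hba.symm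
  refine hvw (mem_of_reachable_of_closed hr (fun x => x = v) rfl ?_).symm
  rintro x y rfl ⟨hxy, h | h⟩
  · exact absurd h (hav _ hxy)
  · exact absurd h (hb.2 _ hxy)

open scoped Classical in
theorem exists_adj_of_not_colorable
    (hno : ∀ c : Sym2 V → Fin k, ¬ IsForestColoring G c)
    (hc : IsForestColoring (G.deleteIncidenceSet u) c) (huv : G.Adj u v) (huw : G.Adj u w)
    (hvw : v ≠ w) (hu : ∀ x, G.Adj u x → x = v ∨ x = w) (hk : ∀ x, G.degree x < k) {a : Fin k}
    (ha : IsMissingColor (G.deleteIncidenceSet u) c w a) :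
    ∃ x, (G.deleteIncidenceSet u).Adj v x ∧ c s(v, x) = a ∧
      ∀ b, IsMissingColor (G.deleteIncidenceSet u) c v b →
        ¬ IsMissingColor (G.deleteIncidenceSet u) c x b := by
  have hav := not_isMissingColor_of_not_colorable hno hc huv huw hvw hu hk ha
  simp only [IsMissingColor, not_forall, not_not] at hav
  obtain ⟨x, hvx, hcx⟩ := hav
  refine ⟨x, hvx, hcx, fun b hb hbx => ?_⟩
  have hab : a ≠ b := hcx ▸ hb x hvx
  have hr := reachable_of_not_colorable hno hc huv huw hvw hu ha hb hab
  have hS := mem_of_reachable_of_closed hr (fun y => y = v ∨ y = x) (Or.inl rfl) ?_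
  · rcases hS with h | rfl
    · exact hvw h.symm
    · exact ha v hvx.symm (by rwa [Sym2.eq_swap])
  · rintro y z (rfl | rfl) ⟨hyz, h | h⟩
    · exact Or.inr (hc.proper hyz hvx (h.trans hcx.symm))
    · exact absurd h (hb _ hyz)
    · refine Or.inl (hc.proper hyz hvx.symm (h.trans ?_))
      rw [← hcx, Sym2.eq_swap]
    · exact absurd h (hbx _ hyz)

open scoped Classical in
theorem card_two_vertices_add_le_of_not_colorable
    (hno : ∀ c : Sym2 V → Fin k, ¬ IsForestColoring G c)
    (hc : IsForestColoring (G.deleteIncidenceSet u) c) (huv : G.Adj u v) (huw : G.Adj u w)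
    (hvw : v ≠ w) (hu : ∀ x, G.Adj u x → x = v ∨ x = w) (hk : ∀ x, G.degree x < k) :
    ((G.neighborFinset v).filter (fun x => G.degree x = 2)).card + (k + 1)
      ≤ G.degree v + G.degree w := by
  have hA := le_card_isMissingColor_deleteIncidenceSet c huw
  have hB := le_card_isMissingColor_deleteIncidenceSet c huv
  have hkv := hk v
  have hle : (Finset.univ.filter (IsMissingColor (G.deleteIncidenceSet u) c w)).card
      ≤ ((G.neighborFinset v).filter (fun x => ¬ G.degree x = 2)).card := by
    refine (Finset.card_le_card ?_).trans (Finset.card_image_le (f := fun x => c s(v, x)))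
    intro a ha
    rw [Finset.mem_filter] at ha
    obtain ⟨x, hvx, hcx, hx⟩ := exists_adj_of_not_colorable hno hc huv huw hvw hu hk ha.2
    rw [Finset.mem_image]
    refine ⟨x, ?_, hcx⟩
    rw [Finset.mem_filter, mem_neighborFinset]
    refine ⟨(deleteIncidenceSet_adj.1 hvx).1, ?_⟩
    have hav := not_isMissingColor_of_not_colorable hno hc huv huw hvw hu hk ha.2
    have hsub : insert a (Finset.univ.filter (IsMissingColor (G.deleteIncidenceSet u) c v)) ⊆
        (G.neighborFinset x).image (fun y => c s(x, y)) := by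
      intro b hb
      rw [Finset.mem_image]
      rcases Finset.mem_insert.1 hb with rfl | hb
      · exact ⟨v, by simpa using (deleteIncidenceSet_adj.1 hvx).1.symm, by rw [Sym2.eq_swap, hcx]⟩
      · have := hx b (Finset.mem_filter.1 hb).2
        simp only [IsMissingColor, not_forall, not_not] at this
        obtain ⟨y, hxy, hcy⟩ := this
        exact ⟨y, by simpa using (deleteIncidenceSet_adj.1 hxy).1, hcy⟩
    have hcard := (Finset.card_le_card hsub).trans Finset.card_image_le
    rw [Finset.card_insert_of_notMem (by simpa using hav), card_neighborFinset_eq_degree] at hcard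
    omega
  have hsplit := Finset.card_filter_add_card_filter_not (s := G.neighborFinset v)
    (p := fun x => G.degree x = 2)
  rw [card_neighborFinset_eq_degree] at hsplit
  omega

open scoped Classical in
theorem colorable_of_four_colors {c : Sym2 V → Fin 4}
    (hc : IsForestColoring (G.deleteIncidenceSet u) c) (huv : G.Adj u v) (huw : G.Adj u w)
    (hvw : v ≠ w) (hu : ∀ x, G.Adj u x → x = v ∨ x = w) (hk : ∀ x, G.degree x < 4) :
    ∃ c : Sym2 V → Fin 4, IsForestColoring G c := by
  by_contra! hno
  have hA := le_card_isMissingColor_deleteIncidenceSet c huw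
  have hB := le_card_isMissingColor_deleteIncidenceSet c huv
  have hkv := hk v
  have hkw := hk w
  obtain ⟨a₁, ha₁, a₂, ha₂, ha⟩ := Finset.one_lt_card.1 (show 1 <
    (Finset.univ.filter (IsMissingColor (G.deleteIncidenceSet u) c w)).card by omega)
  obtain ⟨b₁, hb₁, b₂, hb₂, hb⟩ := Finset.one_lt_card.1 (show 1 <
    (Finset.univ.filter (IsMissingColor (G.deleteIncidenceSet u) c v)).card by omega)
  simp only [Finset.mem_filter, Finset.mem_univ, true_and] at ha₁ ha₂ hb₁ hb₂
  obtain ⟨x₁, hx₁, hcx₁, hbx₁⟩ := exists_adj_of_not_colorable hno hc huv huw hvw hu hk ha₁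
  obtain ⟨x₂, hx₂, hcx₂, hbx₂⟩ := exists_adj_of_not_colorable hno hc huv huw hvw hu hk ha₂
  set G' := G.deleteIncidenceSet u with hG'
  have hadj : ∀ x y, G'.Adj x y ↔ G.Adj x y ∧ x ≠ u ∧ y ≠ u := fun x y => deleteIncidenceSet_adj
  have hx₁₂ : x₁ ≠ x₂ := by
    rintro rfl
    exact ha (hcx₁.symm.trans hcx₂)
  have hab : ∀ x a b, G'.Adj v x → c s(v, x) = a → IsMissingColor G' c v b → a ≠ b :=
    fun x a b hx hcx hb => hcx ▸ hb x hx
  have hdeg : ∀ x (s : Finset V), (∀ y ∈ s, G.Adj x y) → s.card < 4 := by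
    intro x s hs
    refine lt_of_le_of_lt ?_ (hk x)
    rw [← card_neighborFinset_eq_degree]
    exact Finset.card_le_card fun y hy => (mem_neighborFinset _ _ _).2 (hs y hy)
  have hvonly : ∀ x, G'.Adj v x → x = x₁ ∨ x = x₂ := by
    intro x hx
    by_contra! hne
    have := hdeg v {u, x, x₁, x₂} (by
      simp only [Finset.mem_insert, Finset.mem_singleton]
      rintro y (rfl | rfl | rfl | rfl)
      exacts [huv.symm, ((hadj _ _).1 hx).1, ((hadj _ _).1 hx₁).1, ((hadj _ _).1 hx₂).1])
    rw [Finset.card_eq_four.2 ⟨u, x, x₁, x₂, ((hadj _ _).1 hx).2.2.symm,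
      ((hadj _ _).1 hx₁).2.2.symm, ((hadj _ _).1 hx₂).2.2.symm, hne.1, hne.2, hx₁₂, rfl⟩] at this
    omega
  have hmiss : ∀ x a a', G'.Adj v x → c s(v, x) = a → a ≠ a' →
      IsMissingColor G' c w a' →
      (∀ b, IsMissingColor G' c v b → ¬ IsMissingColor G' c x b) → IsMissingColor G' c x a' := by
    intro x a a' hvx hcx haa' ha' hbx y hxy hcy
    have h₁ := hbx b₁ hb₁
    have h₂ := hbx b₂ hb₂
    simp only [IsMissingColor, not_forall, not_not] at h₁ h₂
    obtain ⟨y₁, hy₁, hcy₁⟩ := h₁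
    obtain ⟨y₂, hy₂, hcy₂⟩ := h₂
    have hav := not_isMissingColor_of_not_colorable hno hc huv huw hvw hu hk ha'
    simp only [IsMissingColor, not_forall, not_not] at hav
    obtain ⟨z, hz, hcz⟩ := hav
    have hcxv : c s(x, v) = a := by rw [Sym2.eq_swap, hcx]
    have hne : ∀ {p q d e}, c s(x, p) = d → c s(x, q) = e → d ≠ e → p ≠ q := by
      rintro p q d e hp hq hde rfl
      exact hde (hp.symm.trans hq)
    have := hdeg x {v, y, y₁, y₂} (by
      simp only [Finset.mem_insert, Finset.mem_singleton]
      rintro y (rfl | rfl | rfl | rfl)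
      exacts [((hadj _ _).1 hvx).1.symm, ((hadj _ _).1 hxy).1, ((hadj _ _).1 hy₁).1,
        ((hadj _ _).1 hy₂).1])
    rw [Finset.card_eq_four.2 ⟨v, y, y₁, y₂, hne hcxv hcy haa',
      hne hcxv hcy₁ (hab _ _ _ hvx hcx hb₁), hne hcxv hcy₂ (hab _ _ _ hvx hcx hb₂),
      hne hcy hcy₁ (hab _ _ _ hz hcz hb₁), hne hcy hcy₂ (hab _ _ _ hz hcz hb₂),
      hne hcy₁ hcy₂ hb, rfl⟩] at this
    omega
  have hm₁ := hmiss x₁ a₁ a₂ hx₁ hcx₁ ha ha₂ hbx₁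
  have hm₂ := hmiss x₂ a₂ a₁ hx₂ hcx₂ ha.symm ha₁ hbx₂
  have hsub : ∀ {x y}, (G'.deleteIncidenceSet v).Adj x y → G'.Adj x y :=
    fun h => (deleteIncidenceSet_adj.1 h).1
  set c₂ := Function.update (Function.update c s(v, x₁) a₂) s(v, x₂) a₁ with hc₂
  have hgood : IsForestColoring G' c₂ := by
    refine (hc.mono (deleteIncidenceSet_le G' v)).update_two_edges hx₁.ne hx₂.ne hx₁₂ hvonly
      (fun y hy => hm₁ y (hsub hy)) (fun y hy => hm₂ y (hsub hy)) ha ?_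
    intro hr
    refine hx₁₂ (mem_of_reachable_of_closed hr (fun x => x = x₁) rfl ?_).symm
    rintro x y rfl ⟨hxy, h | h⟩
    · refine absurd (hc.proper (hsub hxy) hx₁.symm (h.trans ?_)) (deleteIncidenceSet_adj.1 hxy).2.2
      rw [← hcx₁, Sym2.eq_swap]
    · exact absurd h (hm₁ _ (hsub hxy))
  have hc₂₁ : c₂ s(v, x₁) = a₂ := by
    rw [hc₂, Function.update_of_ne (by rwa [ne_eq, Sym2.congr_right]),
      Function.update_self]
  have hc₂₂ : c₂ s(v, x₂) = a₁ := Function.update_self _ _ _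
  have hc₂o : ∀ x y, x ≠ v → y ≠ v → c₂ s(x, y) = c s(x, y) := by
    intro x y hx hy
    rw [hc₂, Function.update_of_ne (by rw [ne_eq, Sym2.eq_iff]; tauto),
      Function.update_of_ne (by rw [ne_eq, Sym2.eq_iff]; tauto)]
  have hwv : ¬ G'.Adj w v := by
    intro h
    rcases hvonly w h.symm with rfl | rfl
    · exact ha₁ v h (by rw [Sym2.eq_swap, hcx₁])
    · exact ha₂ v h (by rw [Sym2.eq_swap, hcx₂])
  have hab₁ := hab _ _ _ hx₁ hcx₁ hb₁
  have hr := reachable_of_not_colorable hno hc huv huw hvw hu ha₁ hb₁ hab₁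
  have hr₂ := reachable_of_not_colorable hno hgood huv huw hvw hu
    (a := a₁) (b := b₁) ?_ ?_ hab₁
  · have hleaf : ∀ {x d}, IsMissingColor G' c x d → d = a₁ ∨ d = b₁ →
        ∀ y z, (bicoloredSubgraph G' c a₁ b₁).Adj x y → (bicoloredSubgraph G' c a₁ b₁).Adj x z →
          y = z := by
      rintro x d hd hor y z ⟨hy, hcy⟩ ⟨hz, hcz⟩
      have h₁ := hd y hy
      have h₂ := hd z hz
      refine hc.proper hy hz ?_
      rcases hor with rfl | rfl
      · rw [hcy.resolve_left h₁, hcz.resolve_left h₂]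
      · rw [hcy.resolve_right h₁, hcz.resolve_right h₂]
    have hnr : ¬ (bicoloredSubgraph G' c a₁ b₁).Reachable w x₂ := by
      intro h
      refine hx₂.ne (eq_of_reachable_of_leaf ?_ (hleaf ha₁ (Or.inl rfl)) (hleaf hb₁ (Or.inr rfl))
        (hleaf hm₂ (Or.inl rfl)) hvw.symm ?_ hr.symm h)
      · rintro x y z t ⟨hy, hcy⟩ ⟨hz, hcz⟩ ⟨ht, hct⟩
        have hyz := hc.proper hy hz
        have hyt := hc.proper hy ht
        have hzt := hc.proper hz ht
        rcases hcy with hcy | hcy <;> rcases hcz with hcz | hcz <;> rcases hct with hct | hct <;>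
          rw [hcy, hcz] at hyz <;> rw [hcy, hct] at hyt <;> rw [hcz, hct] at hzt <;> tauto
      · rintro rfl
        exact hwv hx₂.symm
    refine (mem_of_reachable_of_closed hr₂.symm
      (fun x => x ≠ v ∧ (bicoloredSubgraph G' c a₁ b₁).Reachable w x)
      ⟨hvw.symm, Reachable.refl _⟩ ?_).1 rfl
    rintro x y ⟨hxv, hx⟩ ⟨hxy, hcxy⟩
    by_cases hyv : y = v
    · subst hyv
      rcases hvonly x hxy.symm with rfl | rfl
      · rw [Sym2.eq_swap, hc₂₁] at hcxy
        rcases hcxy with h | h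
        · exact absurd h.symm ha
        · exact absurd h (hab _ _ _ hx₂ hcx₂ hb₁)
      · exact absurd hx hnr
    · rw [hc₂o _ _ hxv hyv] at hcxy
      exact ⟨hyv, hx.trans (Adj.reachable ⟨hxy, hcxy⟩)⟩
  · intro y hy
    have hyv : y ≠ v := by
      rintro rfl
      exact hwv hy
    rw [hc₂o _ _ hvw.symm hyv]
    exact ha₁ y hy
  · intro y hy
    rcases hvonly y hy with rfl | rfl
    · rw [hc₂₁]
      exact hab _ _ _ hx₂ hcx₂ hb₁
    · rw [hc₂₂]
      exact hab₁

end TwoVertex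

open scoped Classical in
/-- The discharging argument: every vertex `v` hands `(d(v) - 3) / n₂(v)` to each of its `n₂(v)`
neighbors of degree two. -/
theorem three_mul_card_support_le_sum_degrees [Fintype V] {k : ℕ} {G : SimpleGraph V}
    (hk : ∀ v, G.degree v < k) (hk₅ : 5 ≤ k) (hone : ∀ v, G.degree v ≠ 1)
    (htwo : ∀ u v w, G.Adj u v → G.Adj u w → v ≠ w → G.degree u = 2 →
      ((G.neighborFinset v).filter (fun x => G.degree x = 2)).card + (k + 1)
        ≤ G.degree v + G.degree w) :
    3 * (Finset.univ.filter (fun v => G.degree v ≠ 0)).card ≤ ∑ v, G.degree v := by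
  set n : V → ℕ := fun v => ((G.neighborFinset v).filter (fun x => G.degree x = 2)).card with hn
  have hpos : ∀ u v, G.Adj u v → G.degree u = 2 → 0 < n v := by
    intro u v huv hu
    exact Finset.card_pos.2 ⟨u, Finset.mem_filter.2 ⟨(mem_neighborFinset _ _ _).2 huv.symm, hu⟩⟩
  have hnbr : ∀ u, G.degree u = 2 → ∃ v w, v ≠ w ∧ G.neighborFinset u = {v, w} := by
    intro u hu
    rw [← card_neighborFinset_eq_degree] at hu
    exact Finset.card_eq_two.1 hu
  have htwo' : ∀ u v w, v ≠ w → G.neighborFinset u = {v, w} → G.degree u = 2 →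
      n v + (k + 1) ≤ G.degree v + G.degree w := by
    intro u v w hvw huvw hu
    refine htwo u v w ?_ ?_ hvw hu <;> rw [← mem_neighborFinset, huvw] <;> simp
  set f : V → ℚ := fun v => ((G.degree v : ℚ) - 3) / n v with hf
  have hfsum : ∀ u, G.degree u = 2 → 1 ≤ ∑ v ∈ G.neighborFinset u, f v := by
    intro u hu
    obtain ⟨v, w, hvw, huvw⟩ := hnbr u hu
    rw [huvw, Finset.sum_pair hvw]
    have h₁ := htwo' u v w hvw huvw hu
    have h₂ := htwo' u w v hvw.symm (by rw [huvw, Finset.pair_comm]) hu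
    have hv := hpos u v ((by rw [← mem_neighborFinset, huvw]; simp)) hu
    have hw := hpos u w ((by rw [← mem_neighborFinset, huvw]; simp)) hu
    have hkv := hk v
    have hkw := hk w
    have hlarge : ∀ x, 0 < n x → n x + 2 ≤ G.degree x → 4 ≤ G.degree x → 1 / 2 ≤ f x := by
      intro x hx hx₂ hx₄
      have hx' : (0 : ℚ) < n x := by exact_mod_cast hx
      have hx₂' : (n x : ℚ) + 2 ≤ G.degree x := by exact_mod_cast hx₂
      have hx₄' : (4 : ℚ) ≤ G.degree x := by exact_mod_cast hx₄
      rw [hf, div_le_div_iff₀ two_pos hx']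
      linarith
    have hthree : ∀ x y, G.degree x = 3 → n y = 1 → 4 ≤ G.degree y → 1 ≤ f x + f y := by
      intro x y hx hy hy₄
      have hy₄' : (4 : ℚ) ≤ G.degree y := by exact_mod_cast hy₄
      simp only [hf, hx, hy]
      norm_num
      linarith
    rcases (show G.degree v = 3 ∨ 4 ≤ G.degree v by omega) with h | h
    · exact hthree v w h (by omega) (by omega)
    rcases (show G.degree w = 3 ∨ 4 ≤ G.degree w by omega) with h' | h'
    · rw [add_comm]
      exact hthree w v h' (by omega) (by omega)
    · linarith [hlarge v hv (by omega) h, hlarge w hw (by omega) h']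
  have hvertex : ∀ v, (∑ u, if G.Adj u v ∧ G.degree u = 2 then f v else 0) +
      3 * (if G.degree v ≠ 0 then 1 else 0) ≤ (G.degree v : ℚ) +
        (if G.degree v = 2 then 1 else 0) := by
    intro v
    have hset : Finset.univ.filter (fun u => G.Adj u v ∧ G.degree u = 2) =
        (G.neighborFinset v).filter (fun x => G.degree x = 2) := by
      ext u
      simp [G.adj_comm]
    have hsum : (∑ u, if G.Adj u v ∧ G.degree u = 2 then f v else 0) = n v * f v := by
      rw [← Finset.sum_filter, hset, Finset.sum_const, nsmul_eq_mul]
    rw [hsum]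
    rcases Nat.eq_zero_or_pos (n v) with h | h
    · rw [h]
      have := hone v
      rcases (show G.degree v = 0 ∨ G.degree v = 2 ∨ 3 ≤ G.degree v by omega) with h' | h' | h'
      · simp [h']
      · simp [h']
        norm_num
      · have h₃ : (3 : ℚ) ≤ G.degree v := by exact_mod_cast h'
        rw [if_pos (by omega), if_neg (by omega)]
        simpa using h₃
    · obtain ⟨u, hu⟩ := Finset.card_pos.1 h
      rw [Finset.mem_filter, mem_neighborFinset] at hu
      obtain ⟨x, y, hxy, huxy⟩ := hnbr u hu.2
      have hvmem : v ∈ ({x, y} : Finset V) := by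
        rw [← huxy, mem_neighborFinset]
        exact hu.1.symm
      have h₁ := htwo' u x y hxy huxy hu.2
      have h₂ := htwo' u y x hxy.symm (by rw [huxy, Finset.pair_comm]) hu.2
      have hkx := hk x
      have hky := hk y
      have h₃ : 3 ≤ G.degree v := by
        rcases Finset.mem_insert.1 hvmem with rfl | hvy
        · omega
        · rw [Finset.mem_singleton] at hvy
          subst hvy
          omega
      have hne : (n v : ℚ) ≠ 0 := by exact_mod_cast h.ne'
      rw [if_pos (by omega), if_neg (by omega), hf, mul_div_cancel₀ _ hne]
      linarith
  have htotal := Finset.sum_le_sum fun v (_ : v ∈ (Finset.univ : Finset V)) => hvertex v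
  rw [Finset.sum_add_distrib, Finset.sum_add_distrib, Finset.sum_comm, ← Finset.mul_sum,
    Finset.sum_boole, Finset.sum_boole] at htotal
  have hrecv : ((Finset.univ.filter (fun u => G.degree u = 2)).card : ℚ) ≤
      ∑ u, ∑ v, if G.Adj u v ∧ G.degree u = 2 then f v else 0 := by
    rw [← Finset.sum_boole]
    refine Finset.sum_le_sum fun u _ => ?_
    by_cases hu : G.degree u = 2
    · simp only [hu, and_true, if_true]
      rw [← Finset.sum_filter, ← neighborFinset_eq_filter]
      exact hfsum u hu
    · simp [hu]
  have hfinal : (3 * (Finset.univ.filter (fun v => G.degree v ≠ 0)).card : ℚ) ≤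
      ∑ v, (G.degree v : ℚ) := by linarith
  exact_mod_cast hfinal

open scoped Classical in
/-- Sparsity makes every subgraph of `G` contain a vertex of small degree; the coloring is built by
removing one such vertex at a time. -/
theorem exists_isForestColoring_of_sparse [Fintype V] {k : ℕ} (hk₀ : 0 < k) (G : SimpleGraph V)
    (hk : ∀ v, G.degree v < k)
    (hsparse : ∀ H ≤ G, H ≠ ⊥ →
      ∑ v, H.degree v < 3 * (Finset.univ.filter (fun v => H.degree v ≠ 0)).card) :
    ∃ c : Sym2 V → Fin k, IsForestColoring G c := by
  induction G using WellFoundedLT.induction with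
  | ind G ih =>
  by_cases hbot : G = ⊥
  · subst hbot
    refine ⟨fun _ => ⟨0, hk₀⟩, fun _ _ _ h => absurd h (by simp), fun a b => ?_⟩
    exact isAcyclic_bot.anti fun x y h => h.1
  by_contra! hno
  have hdel : ∀ u v, G.Adj u v →
      ∃ c : Sym2 V → Fin k, IsForestColoring (G.deleteIncidenceSet u) c := by
    intro u v huv
    have hle := G.deleteIncidenceSet_le u
    refine ih _ (lt_of_le_of_ne hle ?_) ?_ fun H hH => hsparse H (hH.trans hle)
    · intro h
      rw [← h, deleteIncidenceSet_adj] at huv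
      exact huv.2.1 rfl
    · intro x
      refine lt_of_le_of_lt ?_ (hk x)
      rw [← card_neighborFinset_eq_degree, ← card_neighborFinset_eq_degree]
      refine Finset.card_le_card fun y hy => ?_
      rw [mem_neighborFinset] at hy ⊢
      exact hle hy
  have hone : ∀ u, G.degree u ≠ 1 := by
    intro u hu
    rw [← card_neighborFinset_eq_degree, Finset.card_eq_one] at hu
    obtain ⟨v, hv⟩ := hu
    have huv : ∀ x, G.Adj u x ↔ x = v := by
      intro x
      rw [← mem_neighborFinset, hv, Finset.mem_singleton]
    have hadj := (huv v).2 rfl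
    obtain ⟨c, hc⟩ := hdel u v hadj
    have hcard := le_card_isMissingColor_deleteIncidenceSet c hadj
    have hkv := hk v
    obtain ⟨b, hb⟩ := Finset.card_pos.1 (show 0 <
      (Finset.univ.filter (IsMissingColor (G.deleteIncidenceSet u) c v)).card by omega)
    exact hno _ (hc.update_pendant_edge hadj.ne (fun x => (huv x).1) (Finset.mem_filter.1 hb).2)
  have honly : ∀ u v w, G.Adj u v → G.Adj u w → v ≠ w → G.degree u = 2 →
      ∀ x, G.Adj u x → x = v ∨ x = w := by
    intro u v w huv huw hvw hu x hux
    by_contra! hne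
    have hle : ({x, v, w} : Finset V) ⊆ G.neighborFinset u := by
      intro y
      simp only [Finset.mem_insert, Finset.mem_singleton, mem_neighborFinset]
      rintro (rfl | rfl | rfl) <;> assumption
    have hcard := Finset.card_le_card hle
    rw [card_neighborFinset_eq_degree, hu,
      Finset.card_eq_three.2 ⟨x, v, w, hne.1, hne.2, hvw, rfl⟩] at hcard
    omega
  have htwo : ∀ u v w, G.Adj u v → G.Adj u w → v ≠ w → G.degree u = 2 →
      ((G.neighborFinset v).filter (fun x => G.degree x = 2)).card + (k + 1)
        ≤ G.degree v + G.degree w := by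
    intro u v w huv huw hvw hu
    obtain ⟨c, hc⟩ := hdel u v huv
    exact card_two_vertices_add_le_of_not_colorable hno hc huv huw hvw
      (honly u v w huv huw hvw hu) hk
  have hlt := hsparse G le_rfl hbot
  by_cases hk₅ : 5 ≤ k
  · exact absurd (three_mul_card_support_le_sum_degrees hk hk₅ hone htwo) (not_le.2 hlt)
  obtain ⟨u, hu⟩ : ∃ u, G.degree u = 2 := by
    by_contra! hne
    refine absurd hlt (not_lt.2 ?_)
    rw [mul_comm, ← smul_eq_mul, ← Finset.sum_const, Finset.sum_filter]
    refine Finset.sum_le_sum fun v _ => ?_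
    have h₁ := hone v
    have h₂ := hne v
    split_ifs <;> omega
  have hu' := hu
  rw [← card_neighborFinset_eq_degree, Finset.card_eq_two] at hu'
  obtain ⟨v, w, hvw, huvw⟩ := hu'
  have huv : G.Adj u v := by rw [← mem_neighborFinset, huvw]; simp
  have huw : G.Adj u w := by rw [← mem_neighborFinset, huvw]; simp
  have hcard := htwo u v w huv huw hvw hu
  have hpos : 0 < ((G.neighborFinset v).filter (fun x => G.degree x = 2)).card :=
    Finset.card_pos.2 ⟨u, by simpa [hu] using huv.symm⟩
  have hkv := hk v
  have hkw := hk w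
  obtain rfl : k = 4 := by omega
  obtain ⟨c, hc⟩ := hdel u v huv
  obtain ⟨c', hc'⟩ := colorable_of_four_colors hc huv huw hvw (honly u v w huv huw hvw hu) hk
  exact hno c' hc'

open scoped Classical in
theorem sum_degrees_lt_of_maxAverageDegree_lt [Fintype V] {G H : SimpleGraph V}
    (h : maxAverageDegree G < 3) (hH : H ≤ G) (hbot : H ≠ ⊥) :
    ∑ v, H.degree v < 3 * (Finset.univ.filter (fun v => H.degree v ≠ 0)).card := by
  let K : G.Subgraph :=
    { verts := {v | H.degree v ≠ 0}
      Adj := H.Adj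
      adj_sub := fun hxy => hH hxy
      edge_vert := fun hxy => ((H.degree_pos_iff_exists_adj _).2 ⟨_, hxy⟩).ne'
      symm := H.symm }
  have hverts : K.verts.ncard = (Finset.univ.filter (fun v => H.degree v ≠ 0)).card := by
    rw [← Set.ncard_coe_finset]
    congr 1
    ext v
    simp [K]
  have hedges : K.edgeSet = (H.edgeFinset : Set (Sym2 V)) := by
    ext e
    induction e with
    | _ x y => simp [K]
  have hne : K.verts.Nonempty := by
    obtain ⟨x, y, hxy⟩ := ne_bot_iff_exists_adj.1 hbot
    exact ⟨x, K.edge_vert hxy⟩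
  have hfin : {x : ℝ | ∃ H : G.Subgraph, H.verts.Nonempty ∧
      x = 2 * (H.edgeSet.ncard : ℝ) / (H.verts.ncard : ℝ)}.Finite := by
    refine (Set.finite_range fun H : G.Subgraph =>
      2 * (H.edgeSet.ncard : ℝ) / (H.verts.ncard : ℝ)).subset ?_
    rintro x ⟨H, -, rfl⟩
    exact ⟨H, rfl⟩
  have hlt := (le_csSup hfin.bddAbove ⟨K, hne, rfl⟩).trans_lt h
  have hpos : (0 : ℝ) < K.verts.ncard := by
    exact_mod_cast (Set.ncard_pos (Set.toFinite _)).2 hne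
  rw [div_lt_iff₀ hpos, hverts, hedges, Set.ncard_coe_finset] at hlt
  rw [sum_degrees_eq_twice_card_edges]
  exact_mod_cast hlt

end AcyclicColoring

theorem stmt1 {V : Type*} [Fintype V] (G : SimpleGraph V) [DecidableRel G.Adj]
    (h : maxAverageDegree G < 3) :
    acyclicChromaticIndex G ≤ G.maxDegree + 1 := by
  obtain ⟨c, hc⟩ := exists_isForestColoring_of_sparse (k := G.maxDegree + 1) (Nat.succ_pos _) G
    (fun v => by
      refine Nat.lt_succ_of_le ?_
      convert G.degree_le_maxDegree v)
    (fun H hH hbot => sum_degrees_lt_of_maxAverageDegree_lt h hH hbot)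
  exact Nat.sInf_le ⟨c, hc.isAcyclicEdgeColoring⟩
end
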